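/- Let (R, m) be an analytically unramified Cohen-Macaulay local ring of dimension d ≥ 3, Cohen-Macaulay type t(R), infinite residue field. Let I be an ideal with closure(I) = m and J a minimal reduction of I. If ē₃(I) = 0, then for all n ≥ 1: λ(closure(I^{n+1})/(J^n·closure(I))) ≤ t(R)·C(n+d−2, d−1). -/

import Mathlib

set_option synthInstance.maxHeartbeats 1000000
set_option maxHeartbeats 2000000

open IsLocalRing Polynomial Finset

variable {R : Type*}

/-- `x` is integral over the ideal `I`: it satisfies an equation
`x^n + a₁ x^{n-1} + ⋯ + aₙ = 0` with `aᵢ ∈ Iⁱ`. -/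
def IsIntegralOverIdeal [CommRing R] (I : Ideal R) (x : R) : Prop :=
  ∃ n : ℕ, 0 < n ∧ ∃ a : ℕ → R, (∀ i ∈ Finset.Icc 1 n, a i ∈ I ^ i) ∧
    x ^ n + ∑ i ∈ Finset.Icc 1 n, a i * x ^ (n - i) = 0

/-- The integral closure of an ideal (the set of integral elements is an ideal,
so the span equals it). -/
def intCl [CommRing R] (I : Ideal R) : Ideal R :=
  Ideal.span {x | IsIntegralOverIdeal I x}

/-- Length of a module, as the Krull dimension of its lattice of submodules. -/
noncomputable def mlen (R M : Type*) [CommRing R] [AddCommGroup M] [Module R M] :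
    WithBot ℕ∞ :=
  Order.krullDim (Submodule R M)

/-- The quotient module `N/(K ∩ N)` for ideals `N K`. -/
abbrev idealQuot [CommRing R] (N K : Ideal R) :=
  N ⧸ (Submodule.comap N.subtype K)

/-- Depth of `M` with respect to the ideal `J`: sup of lengths of `M`-regular
sequences contained in `J`. -/
noncomputable def rdepth (A : Type*) [CommRing A] (J : Ideal A)
    (M : Type*) [AddCommGroup M] [Module A M] : ℕ∞ :=
  sSup {n : ℕ∞ | ∃ rs : List A, (rs.length : ℕ∞) = n ∧ (∀ x ∈ rs, x ∈ J) ∧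
    RingTheory.Sequence.IsRegular M rs}

/-- A local ring is Cohen-Macaulay if its depth equals its Krull dimension. -/
def IsCMLocal (R : Type*) [CommRing R] [IsLocalRing R] : Prop :=
  (rdepth R (maximalIdeal R) R : WithBot ℕ∞) = ringKrullDim R

/-- A local ring is analytically unramified if its `m`-adic completion is reduced. -/
def AnalyticallyUnramified (R : Type*) [CommRing R] [IsLocalRing R] : Prop :=
  IsReduced (AdicCompletion (maximalIdeal R) R)

/-- An ideal is `m`-primary. -/
def IsMPrimary [CommRing R] [IsLocalRing R] (I : Ideal R) : Prop :=
  I.radical = maximalIdeal R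

/-- `J ⊆ I` is a minimal reduction: generated by `d = dim R` elements and
`I^{n+1} = J I^n` for `n ≫ 0`. -/
def IsMinimalReduction [CommRing R] (d : ℕ) (J I : Ideal R) : Prop :=
  J ≤ I ∧ (∃ s : Fin d → R, J = Ideal.span (Set.range s)) ∧
    ∃ N : ℕ, ∀ n ≥ N, I ^ (n + 1) = J * I ^ n

/-- Normal Hilbert data: `L n = λ(R/ intCl(I^{n+1}))` and for `n ≫ 0` this agrees
with the polynomial whose normalized coefficients are the `e i`. -/
def NormalHilbertData [CommRing R] (d : ℕ) (I : Ideal R) (L : ℕ → ℕ) (e : ℕ → ℤ) : Prop :=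
  (∀ n, mlen R (R ⧸ intCl (I ^ (n + 1))) = (L n : WithBot ℕ∞)) ∧
    ∃ N : ℕ, ∀ n ≥ N, (L n : ℤ) =
      ∑ i ∈ Finset.range (d + 1), (-1 : ℤ) ^ i * e i * ((n + d - i).choose (d - i))

/-- `t` is the Cohen-Macaulay type of the local ring `R` of dimension `d`:
`t = λ((Q : m)/Q)` for every ideal `Q` generated by a maximal regular sequence in `m`. -/
def CMTypeData (R : Type*) [CommRing R] [IsLocalRing R] (d t : ℕ) : Prop :=
  ∀ s : List R, s.length = d → (∀ x ∈ s, x ∈ maximalIdeal R) →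
    RingTheory.Sequence.IsRegular R s →
      mlen R (idealQuot ((Ideal.span {x | x ∈ s}).colon (maximalIdeal R))
        (Ideal.span {x | x ∈ s})) = (t : WithBot ℕ∞)

/-- The quotient module `N/(K ∩ N)` for submodules `N K` of a module. -/
abbrev submoduleQuot {A M : Type*} [CommRing A] [AddCommGroup M] [Module A M]
    (N K : Submodule A M) :=
  N ⧸ (Submodule.comap N.subtype K)

namespace Sally
open nonZeroDivisors in
lemma mvpoly_nzd {A : Type*} [CommRing A] : ∀ {d : ℕ} (p : MvPolynomial (Fin d) A)
    (β : Fin d →₀ ℕ), p.coeff β ∈ A⁰ → p ∈ (MvPolynomial (Fin d) A)⁰ := by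
  intro d
  induction d with
  | zero =>
    intro p β hp
    have e := MvPolynomial.isEmptyRingEquiv A (Fin 0)
    have : p = MvPolynomial.C (p.coeff β) := by
      ext m
      rw [Subsingleton.elim m β, Subsingleton.elim β 0]; simp
    rw [this]
    refine mem_nonZeroDivisors_iff_right.2 fun x hx => ?_
    ext m
    have := congrArg (MvPolynomial.coeff m) hx
    rw [mul_comm, MvPolynomial.coeff_C_mul, mul_comm] at this
    simpa using (mem_nonZeroDivisors_iff_right.1 hp) _ (by simpa using this)
  | succ d ih =>
    intro p β hp
    have h1 : (MvPolynomial.finSuccEquiv A d p) ∈ (Polynomial (MvPolynomial (Fin d) A))⁰ := by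
      refine Polynomial.mem_nonzeroDivisors_of_coeff_mem (β 0) (ih _ β.tail ?_)
      rw [MvPolynomial.finSuccEquiv_coeff_coeff, Finsupp.cons_tail]
      exact hp
    refine mem_nonZeroDivisors_iff_right.2 fun x hx => ?_
    have := congrArg (MvPolynomial.finSuccEquiv A d) hx
    rw [map_mul, map_zero] at this
    have := (mem_nonZeroDivisors_iff_right.1 h1) _ this
    simpa using this

/-- all coefficients in `J` -/
def CIn {R : Type*} [CommRing R] {d : ℕ} (J : Ideal R) (f : MvPolynomial (Fin d) R) : Prop :=
  ∀ α, f.coeff α ∈ J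

lemma CIn.map_eq {R : Type*} [CommRing R] {d : ℕ} {J : Ideal R} {f : MvPolynomial (Fin d) R} :
    CIn J f ↔ MvPolynomial.map (Ideal.Quotient.mk J) f = 0 := by
  constructor
  · intro h; ext α
    rw [MvPolynomial.coeff_map, MvPolynomial.coeff_zero]
    exact Ideal.Quotient.eq_zero_iff_mem.2 (h α)
  · intro h α
    have := congrArg (MvPolynomial.coeff α) h
    rw [MvPolynomial.coeff_map, MvPolynomial.coeff_zero] at this
    exact Ideal.Quotient.eq_zero_iff_mem.1 this

section
variable {R : Type*} [CommRing R] {d : ℕ}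

lemma CIn.add {J : Ideal R} {f g : MvPolynomial (Fin d) R} (hf : CIn J f) (hg : CIn J g) :
    CIn J (f + g) := by
  rw [CIn.map_eq] at *; simp [hf, hg]
lemma CIn.sub {J : Ideal R} {f g : MvPolynomial (Fin d) R} (hf : CIn J f) (hg : CIn J g) :
    CIn J (f - g) := by
  rw [CIn.map_eq] at *; simp [hf, hg]
lemma CIn.mul_left {J : Ideal R} {f : MvPolynomial (Fin d) R} (g) (hf : CIn J f) :
    CIn J (g * f) := by
  rw [CIn.map_eq] at *; simp [hf]
lemma CIn.mono {J K : Ideal R} (h : J ≤ K) {f : MvPolynomial (Fin d) R} (hf : CIn J f) :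
    CIn K f := fun α => h (hf α)
lemma CIn.mul_mem {m : Ideal R} [hm : m.IsPrime] {f g : MvPolynomial (Fin d) R}
    (h : CIn m (f * g)) : CIn m f ∨ CIn m g := by
  simp only [CIn.map_eq] at *
  rw [map_mul] at h
  exact mul_eq_zero.1 h
lemma CIn.pow_mem {m : Ideal R} [hm : m.IsPrime] {f : MvPolynomial (Fin d) R} {s : ℕ}
    (h : CIn m (f ^ s)) : CIn m f := by
  simp only [CIn.map_eq] at *
  rw [map_pow] at h
  exact eq_zero_of_pow_eq_zero h

lemma CIn.of_mul {J m : Ideal R} (sat : ∀ s b, s ∉ m → s * b ∈ J → b ∈ J)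
    {h f : MvPolynomial (Fin d) R} (hh : ¬ CIn m h) (hf : CIn J (h * f)) : CIn J f := by
  simp only [CIn, not_forall] at hh
  obtain ⟨β, hβ⟩ := hh
  rw [CIn.map_eq, map_mul] at hf
  rw [CIn.map_eq]
  have : (MvPolynomial.map (Ideal.Quotient.mk J) h) ∈ nonZeroDivisors _ := by
    refine mvpoly_nzd _ β ?_
    rw [MvPolynomial.coeff_map]
    refine mem_nonZeroDivisors_iff_right.2 fun x hx => ?_
    obtain ⟨x, rfl⟩ := Ideal.Quotient.mk_surjective x
    rw [← map_mul, Ideal.Quotient.eq_zero_iff_mem, mul_comm] at hx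
    exact Ideal.Quotient.eq_zero_iff_mem.2 (sat _ _ hβ hx)
  exact (mem_nonZeroDivisors_iff_right.1 this) _ (by rw [mul_comm]; exact hf)

/-- the ideal generated by the family -/
abbrev JJ (a : Fin d → R) : Ideal R := Ideal.span (Set.range a)

lemma mem_JJ_pow (a : Fin d → R) {n : ℕ} {y : R} :
    y ∈ JJ a ^ n ↔ ∃ p : MvPolynomial (Fin d) R, p.IsHomogeneous n ∧ p.eval a = y :=
  Ideal.mem_span_pow_iff_exists_isHomogeneous a y

lemma eval_mem_pow (a : Fin d → R) {n : ℕ} {p : MvPolynomial (Fin d) R} (hp : p.IsHomogeneous n) :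
    p.eval a ∈ JJ a ^ n := (mem_JJ_pow a).2 ⟨p, hp, rfl⟩

lemma eval_mem_mul (a : Fin d → R) {n : ℕ} {p : MvPolynomial (Fin d) R} (hp : p.IsHomogeneous n)
    {K : Ideal R} (hK : CIn K p) : p.eval a ∈ K * JJ a ^ n := by
  rw [MvPolynomial.eval_eq]
  refine Ideal.sum_mem _ fun α hα => Ideal.mul_mem_mul (hK α) ?_
  have : (MvPolynomial.monomial α (1:R)).eval a ∈ JJ a ^ n := by
    apply eval_mem_pow
    apply MvPolynomial.isHomogeneous_monomial
    have := hp (MvPolynomial.mem_support_iff.1 hα)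
    rw [← this, Finsupp.degree_eq_weight_one]; rfl
  simpa [MvPolynomial.eval_monomial, Finsupp.prod] using this

lemma mem_mul_pow (a : Fin d → R) {n : ℕ} {K : Ideal R} {y : R} (hy : y ∈ K * JJ a ^ n) :
    ∃ p : MvPolynomial (Fin d) R, p.IsHomogeneous n ∧ CIn K p ∧ p.eval a = y := by
  refine Submodule.mul_induction_on hy ?_ ?_
  · intro k hk z hz
    obtain ⟨p, hp, rfl⟩ := (mem_JJ_pow a).1 hz
    refine ⟨MvPolynomial.C k * p, ?_, ?_, by simp⟩
    · simpa using (MvPolynomial.isHomogeneous_C (Fin d) k).mul hp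
    · intro α
      rw [MvPolynomial.coeff_C_mul]
      exact K.mul_mem_right _ hk
  · rintro x y ⟨p, h1, h2, rfl⟩ ⟨q, h3, h4, rfl⟩
    exact ⟨p + q, h1.add h3, h2.add h4, by simp⟩

/-- quasi-regular system -/
structure QRS (a : Fin d → R) (m : Ideal R) : Prop where
  prime : m.IsPrime
  le : JJ a ≤ m
  pow_le : ∃ c, m ^ c ≤ JJ a
  sat : ∀ s b, s ∉ m → s * b ∈ JJ a → b ∈ JJ a
  qr : ∀ n (f : MvPolynomial (Fin d) R), f.IsHomogeneous n → f.eval a ∈ JJ a ^ (n + 1) →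
    CIn (JJ a) f

variable {a : Fin d → R} {m : Ideal R}

lemma QRS.nzd (H : QRS a m) {h : MvPolynomial (Fin d) R} {M : ℕ} (hh : h.IsHomogeneous M)
    (hm : ¬ CIn m h) : ∀ {n : ℕ} {y : R}, h.eval a * y ∈ JJ a ^ (M + n) → y ∈ JJ a ^ n := by
  intro n
  induction n with
  | zero => intro y _; simp
  | succ n ih =>
    intro y hy
    have h1 : y ∈ JJ a ^ n := ih (Ideal.pow_le_pow_right (by omega) hy)
    obtain ⟨f, hf, rfl⟩ := (mem_JJ_pow a).1 h1
    rw [← map_mul] at hy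
    have h2 := H.qr (M + n) (h * f) (hh.mul hf) hy
    have h3 := eval_mem_mul a hf (CIn.of_mul H.sat hm h2)
    rwa [← pow_succ'] at h3

/-- converse: a form whose value lies in a higher power has coefficients in `m`, indeed in `J`. -/
lemma QRS.coeff_mem_of (H : QRS a m) {h : MvPolynomial (Fin d) R} {M : ℕ} (hh : h.IsHomogeneous M)
    (he : h.eval a ∈ m * JJ a ^ M) : CIn m h := by
  obtain ⟨p, hp, hpm, hpe⟩ := mem_mul_pow a he
  have : (h - p).eval a ∈ JJ a ^ (M + 1) := by simp [hpe]
  have := (H.qr M _ (hh.sub hp) this).mono H.le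
  simpa using this.add hpm

end
end Sally

namespace Sally
section
variable {R : Type*} [CommRing R]

/-- length of `R/B`. -/
noncomputable abbrev ell (B : Ideal R) : ℕ∞ := Module.length R (R ⧸ B)

/-- length of `A/(A ∩ B)`. -/
noncomputable abbrev qlen (A B : Ideal R) : ℕ∞ :=
  Module.length R (A ⧸ (Submodule.comap A.subtype B))

lemma ell_eq_add {A B : Ideal R} (h : B ≤ A) : ell B = ell A + qlen A B := by
  let g : (R ⧸ B) →ₗ[R] (R ⧸ A) := Submodule.factor h
  let f : (A ⧸ (Submodule.comap A.subtype B)) →ₗ[R] (R ⧸ B) :=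
    Submodule.mapQ _ _ A.subtype le_rfl
  have hf : Function.Injective f := by
    rw [← LinearMap.ker_eq_bot, Submodule.ker_mapQ]
    simp
  have hg : Function.Surjective g := Submodule.factor_surjective h
  have hfg : Function.Exact f g := by
    intro y
    obtain ⟨y, rfl⟩ := Submodule.Quotient.mk_surjective _ y
    constructor
    · intro hy
      have hy' : y ∈ A := (Submodule.Quotient.mk_eq_zero A).1 hy
      exact ⟨Submodule.Quotient.mk ⟨y, hy'⟩, rfl⟩
    · rintro ⟨z, hz⟩
      obtain ⟨z, rfl⟩ := Submodule.Quotient.mk_surjective _ z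
      rw [← hz]
      exact (Submodule.Quotient.mk_eq_zero A).2 z.2
  have := Module.length_eq_add_of_exact f g hf hg hfg
  rw [add_comm] at this
  exact this

lemma ell_mono {A B : Ideal R} (h : B ≤ A) : ell A ≤ ell B := by
  rw [ell_eq_add h]; exact le_self_add

lemma qlen_add {A B C : Ideal R} (hCB : C ≤ B) (hBA : B ≤ A) (hC : ell C ≠ ⊤) :
    qlen A C = qlen A B + qlen B C := by
  have h1 := ell_eq_add hBA
  have h2 := ell_eq_add hCB
  have h3 := ell_eq_add (hCB.trans hBA)
  have h4 : ell A ≠ ⊤ := fun h => hC (top_le_iff.1 (h ▸ ell_mono (hCB.trans hBA)))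
  rw [h2, h1, add_assoc] at h3
  exact (WithTop.add_left_cancel h4 h3).symm

lemma le_qlen {ι : Type*} [Fintype ι] {A B K : Ideal R} (z : ι → R) (hz : ∀ i, z i ∈ A)
    (h : ∀ r : ι → R, ∑ i, r i * z i ∈ B → ∀ i, r i ∈ K) :
    (Fintype.card ι : ℕ∞) * ell K ≤ qlen A B := by
  classical
  let Z : (ι → R) →ₗ[R] A := Fintype.linearCombination R (fun i => (⟨z i, hz i⟩ : A))
  let φ : (ι → R) →ₗ[R] (A ⧸ (Submodule.comap A.subtype B)) := (Submodule.mkQ _).comp Z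
  let ψ : (ι → R) →ₗ[R] (ι → (R ⧸ K)) := LinearMap.pi (fun i => (Submodule.mkQ K).comp (LinearMap.proj i))
  have hψ : Function.Surjective ψ := by
    intro y
    choose x hx using fun i => Submodule.Quotient.mk_surjective K (y i)
    exact ⟨x, funext hx⟩
  have hk : LinearMap.ker φ ≤ LinearMap.ker ψ := by
    intro r hr
    have h1 : ∑ i, r i * z i ∈ B := by
      have : Z r ∈ Submodule.comap A.subtype B := (Submodule.Quotient.mk_eq_zero _).1 hr
      have h2 : ((Z r : A) : R) ∈ B := this
      simpa [Z, Fintype.linearCombination_apply] using h2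
    ext i
    exact (Submodule.Quotient.mk_eq_zero _).2 (h r h1 i)
  have e1 : Module.length R (ι → (R ⧸ K)) ≤ Module.length R ((ι → R) ⧸ LinearMap.ker φ) := by
    refine Module.length_le_of_surjective ((LinearMap.ker φ).liftQ ψ hk) ?_
    intro y
    obtain ⟨x, rfl⟩ := hψ y
    exact ⟨Submodule.Quotient.mk x, rfl⟩
  have e2 : Module.length R ((ι → R) ⧸ LinearMap.ker φ) ≤ qlen A B := by
    rw [φ.quotKerEquivRange.length_eq]
    exact Module.length_le_of_injective (Submodule.subtype _) (Submodule.injective_subtype _)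
  have e3 : Module.length R (ι → (R ⧸ K)) = (Fintype.card ι : ℕ∞) * ell K := by
    rw [Module.length_pi_of_fintype]; simp
  rw [← e3]
  exact e1.trans e2

lemma qlen_le {ι : Type*} [Fintype ι] {A B K : Ideal R} (z : ι → R) (hz : ∀ i, z i ∈ A)
    (h : A ≤ B ⊔ Ideal.span (Set.range z)) (hK : ∀ i, ∀ r ∈ K, r * z i ∈ B) :
    qlen A B ≤ (Fintype.card ι : ℕ∞) * ell K := by
  classical
  let Z : (ι → R) →ₗ[R] A := Fintype.linearCombination R (fun i => (⟨z i, hz i⟩ : A))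
  let φ : (ι → R) →ₗ[R] (A ⧸ (Submodule.comap A.subtype B)) := (Submodule.mkQ _).comp Z
  let ψ : (ι → R) →ₗ[R] (ι → (R ⧸ K)) := LinearMap.pi (fun i => (Submodule.mkQ K).comp (LinearMap.proj i))
  have hψ : Function.Surjective ψ := by
    intro y
    choose x hx using fun i => Submodule.Quotient.mk_surjective K (y i)
    exact ⟨x, funext hx⟩
  have hZ : ∀ r, ((Z r : A) : R) = ∑ i, r i * z i := by
    intro r; simp [Z, Fintype.linearCombination_apply]
  have hφ : Function.Surjective φ := by
    intro y
    obtain ⟨⟨y, hy⟩, rfl⟩ := Submodule.Quotient.mk_surjective _ y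
    obtain ⟨b, hb, c, hc, hbc⟩ := Submodule.mem_sup.1 (h hy)
    obtain ⟨r, hr⟩ := (Ideal.mem_span_range_iff_exists_fun).1 hc
    refine ⟨r, (Submodule.Quotient.eq _).2 ?_⟩
    change ((Z r : A) : R) - y ∈ B
    rw [hZ, hr, ← hbc]
    simpa using hb
  have hk : LinearMap.ker ψ ≤ LinearMap.ker φ := by
    intro r hr
    have h1 : ∀ i, r i ∈ K := by
      intro i
      have := congrFun hr i
      exact (Submodule.Quotient.mk_eq_zero _).1 this
    refine (Submodule.Quotient.mk_eq_zero _).2 ?_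
    change ((Z r : A) : R) ∈ B
    rw [hZ]
    exact Ideal.sum_mem _ fun i _ => hK i _ (h1 i)
  have e1 : qlen A B ≤ Module.length R ((ι → R) ⧸ LinearMap.ker ψ) := by
    refine Module.length_le_of_surjective ((LinearMap.ker ψ).liftQ φ hk) ?_
    intro y
    obtain ⟨x, rfl⟩ := hφ y
    exact ⟨Submodule.Quotient.mk x, rfl⟩
  have e2 : Module.length R ((ι → R) ⧸ LinearMap.ker ψ) = Module.length R (ι → (R ⧸ K)) :=
    (ψ.quotKerEquivOfSurjective hψ).length_eq
  have e3 : Module.length R (ι → (R ⧸ K)) = (Fintype.card ι : ℕ∞) * ell K := by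
    rw [Module.length_pi_of_fintype]; simp
  rw [← e3, ← e2]
  exact e1

lemma ell_top : ell (⊤ : Ideal R) = 0 := by
  rw [ell, Module.length_eq_zero_iff]
  infer_instance

/-- monomials of degree `n`. -/
abbrev Mon (d n : ℕ) := Sym (Fin d) n

/-- exponent of a monomial -/
noncomputable def Mon.exp {d n : ℕ} (s : Mon d n) : Fin d →₀ ℕ := Multiset.toFinsupp s.1

lemma Mon.exp_injective {d n : ℕ} : Function.Injective (Mon.exp (d := d) (n := n)) := by
  intro s t h
  exact Subtype.ext (Multiset.toFinsupp.injective h)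

lemma Mon.degree_exp {d n : ℕ} (s : Mon d n) : s.exp.degree = n := by
  have := Multiset.toFinsupp_sum_eq s.1
  rw [s.2] at this
  exact this

lemma Mon.exists_exp {d n : ℕ} (α : Fin d →₀ ℕ) (h : α.degree = n) : ∃ s : Mon d n, s.exp = α := by
  refine ⟨⟨Finsupp.toMultiset α, ?_⟩, ?_⟩
  · rw [Finsupp.card_toMultiset]; exact h
  · simp [Mon.exp]

variable {d : ℕ}
/-- polynomial with given coefficients -/
noncomputable def ofCoeff {n : ℕ} (r : Mon d n → R) : MvPolynomial (Fin d) R :=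
  ∑ s, MvPolynomial.monomial s.exp (r s)

lemma ofCoeff_homog {n : ℕ} (r : Mon d n → R) : (ofCoeff r).IsHomogeneous n :=
  MvPolynomial.IsHomogeneous.sum _ _ _ fun s _ =>
    MvPolynomial.isHomogeneous_monomial _ (s.degree_exp)

lemma coeff_ofCoeff {n : ℕ} (r : Mon d n → R) (s) : (ofCoeff r).coeff s.exp = r s := by
  classical
  rw [ofCoeff, MvPolynomial.coeff_sum, Finset.sum_eq_single s]
  · simp
  · intro b _ hb
    rw [MvPolynomial.coeff_monomial, if_neg]
    exact fun h => hb (Mon.exp_injective h)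
  · simp

lemma eq_ofCoeff {n : ℕ} {f : MvPolynomial (Fin d) R} (hf : f.IsHomogeneous n) :
    f = ofCoeff (fun s : Mon d n => f.coeff s.exp) := by
  ext α
  by_cases h : α.degree = n
  · obtain ⟨s, rfl⟩ := Mon.exists_exp α h
    rw [coeff_ofCoeff]
  · rw [hf.coeff_eq_zero h, (ofCoeff_homog _).coeff_eq_zero h]

/-- value of a monomial -/
noncomputable def mon (a : Fin d → R) {n : ℕ} (s : Mon d n) : R :=
  (MvPolynomial.monomial s.exp (1:R)).eval a

lemma eval_ofCoeff (a : Fin d → R) {n : ℕ} (r : Mon d n → R) :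
    (ofCoeff r).eval a = ∑ s, r s * mon a s := by
  simp [ofCoeff, mon, MvPolynomial.eval_monomial]

lemma mon_mem (a : Fin d → R) {n : ℕ} (s : Mon d n) : mon a s ∈ JJ a ^ n :=
  eval_mem_pow a (MvPolynomial.isHomogeneous_monomial _ s.degree_exp)

lemma pow_le_span_mon (a : Fin d → R) (n : ℕ) :
    JJ a ^ n ≤ Ideal.span (Set.range (mon a (n := n))) := by
  intro y hy
  obtain ⟨p, hp, rfl⟩ := (mem_JJ_pow a).1 hy
  rw [eq_ofCoeff hp, eval_ofCoeff]
  exact Ideal.sum_mem _ fun s _ => Ideal.mul_mem_left _ _ (Ideal.subset_span ⟨s, rfl⟩)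

lemma card_Mon (d n : ℕ) : Fintype.card (Mon d n) = d.multichoose n := by
  rw [Sym.card_sym_eq_multichoose, Fintype.card_fin]

lemma qlen_pow_le (a : Fin d → R) (n : ℕ) :
    qlen (JJ a ^ n) (JJ a ^ (n + 1)) ≤ (d.multichoose n : ℕ∞) * ell (JJ a) := by
  rw [← card_Mon]
  refine qlen_le (mon a) (mon_mem a) ((pow_le_span_mon a n).trans le_sup_right) ?_
  intro s r hr
  rw [pow_succ']
  exact Ideal.mul_mem_mul hr (mon_mem a s)

lemma QRS.qlen_pow {a : Fin d → R} {m : Ideal R} (H : QRS a m) (n : ℕ) :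
    qlen (JJ a ^ n) (JJ a ^ (n + 1)) = (d.multichoose n : ℕ∞) * ell (JJ a) := by
  refine le_antisymm (qlen_pow_le a n) ?_
  rw [← card_Mon]
  refine le_qlen (mon a) (mon_mem a) fun r hr s => ?_
  rw [← eval_ofCoeff] at hr
  rw [← coeff_ofCoeff r]
  exact H.qr n _ (ofCoeff_homog r) hr _

lemma QRS.ell_pow {a : Fin d → R} {m : Ideal R} (H : QRS a m) (n : ℕ) :
    ell (JJ a ^ n) = ((∑ i ∈ range n, d.multichoose i : ℕ) : ℕ∞) * ell (JJ a) := by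
  induction n with
  | zero => simp [Ideal.one_eq_top]
  | succ n ih =>
    rw [ell_eq_add (Ideal.pow_le_pow_right (Nat.le_succ n)), ih, H.qlen_pow, Finset.sum_range_succ]
    push_cast
    ring

lemma sum_multichoose (d n : ℕ) : ∑ i ∈ range (n + 1), d.multichoose i = (d + 1).multichoose n := by
  induction n with
  | zero => simp
  | succ n ih => rw [Finset.sum_range_succ, ih, Nat.multichoose_succ_succ, add_comm]

lemma ell_maximalIdeal [IsLocalRing R] : ell (maximalIdeal R) = 1 := by
  rw [ell, Module.length_eq_one_iff]
  have : (maximalIdeal R).IsMaximal := inferInstance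
  exact isSimpleModule_iff_isCoatom.2 this.out

lemma ell_lt_top_of_pow_le [IsLocalRing R] [IsNoetherianRing R] {Q : Ideal R} {c : ℕ}
    (h : maximalIdeal R ^ c ≤ Q) : ell Q ≠ ⊤ := by
  have hb : ∃ (k : ℕ) (b : Fin k → R), maximalIdeal R = JJ b := by
    obtain ⟨k, b, hb⟩ := Submodule.fg_iff_exists_fin_generating_family.1
      ((isNoetherianRing_iff_ideal_fg R).1 inferInstance (maximalIdeal R))
    exact ⟨k, b, hb.symm⟩
  obtain ⟨k, b, hb⟩ := hb
  have key : ∀ n, ell (maximalIdeal R ^ n) ≠ ⊤ := by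
    intro n
    induction n with
    | zero => simp [Ideal.one_eq_top]
    | succ n ih =>
      rw [ell_eq_add (Ideal.pow_le_pow_right (Nat.le_succ n))]
      have h2 := qlen_pow_le b n
      rw [← hb, ell_maximalIdeal, mul_one] at h2
      exact WithTop.add_ne_top.2 ⟨ih, ne_top_of_le_ne_top (ENat.coe_ne_top _) h2⟩
  exact fun h' => key c (top_le_iff.1 (h' ▸ ell_mono h))
end
end Sally

namespace Sally
section
variable {R : Type*} [CommRing R]

open Classical in
/-- the `J`-adic order norm. -/
noncomputable def mu0 (J : Ideal R) (x : R) : ℝ :=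
  if h : ∃ n, x ∉ J ^ n then (1/2 : ℝ) ^ (Nat.find h - 1) else 0

lemma mu0_nonneg (J : Ideal R) (x : R) : 0 ≤ mu0 J x := by
  unfold mu0; split_ifs <;> positivity

lemma mu0_le_iff (J : Ideal R) (x : R) (n : ℕ) : mu0 J x ≤ (1/2 : ℝ) ^ n ↔ x ∈ J ^ n := by
  classical
  unfold mu0
  split_ifs with h
  · have h0 : 0 < Nat.find h := by
      rw [Nat.find_pos]; simp
    rw [pow_le_pow_iff_right_of_lt_one₀ (by norm_num) (by norm_num)]
    constructor
    · intro h1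
      by_contra h2
      have h3 := Nat.find_min' h h2
      have h4 : x ∉ J ^ (n) := h2
      have h5 : n = Nat.find h - 1 := by omega
      have := Nat.find_min h (m := Nat.find h - 1) (by omega)
      rw [← h5] at this
      exact this h2
    · intro h1
      by_contra h2
      exact Nat.find_spec h (Ideal.pow_le_pow_right (by omega) h1)
  · push Not at h
    exact ⟨fun _ => h n, fun _ => by positivity⟩

lemma mu0_cases (J : Ideal R) (x : R) : mu0 J x = 0 ∨ ∃ n : ℕ, mu0 J x = (1/2 : ℝ) ^ n := by
  unfold mu0; split_ifs
  · exact Or.inr ⟨_, rfl⟩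
  · exact Or.inl rfl

lemma mu0_le_of (J : Ideal R) (x : R) {c : ℝ} (hc : 0 ≤ c)
    (h : ∀ n : ℕ, c ≤ (1/2 : ℝ) ^ n → x ∈ J ^ n) (hc' : c = 0 ∨ ∃ n : ℕ, c = (1/2 : ℝ) ^ n) :
    mu0 J x ≤ c := by
  rcases hc' with rfl | ⟨n, rfl⟩
  · refine ge_of_tendsto' (tendsto_pow_atTop_nhds_zero_of_lt_one (r := (1/2 : ℝ)) (by norm_num) (by norm_num)) ?_
    intro n
    exact (mu0_le_iff J x n).2 (h n (by positivity))
  · exact (mu0_le_iff J x n).2 (h n le_rfl)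

lemma mu0_nonarch (J : Ideal R) (x y : R) : mu0 J (x + y) ≤ max (mu0 J x) (mu0 J y) := by
  refine mu0_le_of J _ ((mu0_nonneg J x).trans (le_max_left _ _)) ?_ ?_
  · intro n hn
    rw [max_le_iff, mu0_le_iff, mu0_le_iff] at hn
    exact Ideal.add_mem _ hn.1 hn.2
  · rcases max_choice (mu0 J x) (mu0 J y) with h | h <;> rw [h] <;> exact mu0_cases J _

/-- the `J`-adic seminorm -/
noncomputable def mu (J : Ideal R) : RingSeminorm R where
  toFun := mu0 J
  map_zero' := by
    refine le_antisymm (mu0_le_of J 0 le_rfl (fun n _ => by simp) (Or.inl rfl)) (mu0_nonneg _ _)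
  add_le' x y := (mu0_nonarch J x y).trans (max_le_add_of_nonneg (mu0_nonneg _ _) (mu0_nonneg _ _))
  neg' x := by
    have key : ∀ y : R, mu0 J (-y) ≤ mu0 J y := fun y =>
      mu0_le_of J _ (mu0_nonneg _ _) (fun n hn => by
        rw [mu0_le_iff] at hn; exact neg_mem hn) (mu0_cases J y)
    exact le_antisymm (key x) (by simpa using key (-x))
  mul_le' x y := by
    have hx := mu0_cases J x
    have hy := mu0_cases J y
    rcases hx with hx | ⟨p, hx⟩
    · rw [hx, zero_mul]
      refine mu0_le_of J _ le_rfl (fun n _ => ?_) (Or.inl rfl)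
      exact Ideal.mul_mem_right _ _ ((mu0_le_iff J x n).1 (by rw [hx]; positivity))
    rcases hy with hy | ⟨q, hy⟩
    · rw [hy, mul_zero]
      refine mu0_le_of J _ le_rfl (fun n _ => ?_) (Or.inl rfl)
      exact Ideal.mul_mem_left _ _ ((mu0_le_iff J y n).1 (by rw [hy]; positivity))
    rw [hx, hy, ← pow_add, mu0_le_iff, pow_add]
    exact Ideal.mul_mem_mul ((mu0_le_iff J x p).1 hx.le) ((mu0_le_iff J y q).1 hy.le)

lemma mu_le_iff (J : Ideal R) (x : R) (n : ℕ) : mu J x ≤ (1/2 : ℝ) ^ n ↔ x ∈ J ^ n :=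
  mu0_le_iff J x n

lemma mu_one (J : Ideal R) : mu J 1 ≤ 1 := by
  have := (mu_le_iff J 1 0).2 (by simp)
  simpa using this

lemma mu_na (J : Ideal R) : IsNonarchimedean (mu J) := mu0_nonarch J

/-- the asymptotic Samuel seminorm of `J`. -/
noncomputable def nrm (J : Ideal R) : RingSeminorm R := smoothingSeminorm (mu J) (mu_one J) (mu_na J)

variable (J : Ideal R)

lemma nrm_add (x y : R) : nrm J (x + y) ≤ max (nrm J x) (nrm J y) :=
  isNonarchimedean_smoothingFun (mu J) (mu_one J) (mu_na J) x y

lemma nrm_pow (x : R) {n : ℕ} (hn : 1 ≤ n) : nrm J (x ^ n) = nrm J x ^ n :=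
  isPowMul_smoothingFun (mu J) (mu_one J) x hn

lemma nrm_mul (x y : R) : nrm J (x * y) ≤ nrm J x * nrm J y := map_mul_le_mul _ _ _

lemma nrm_nonneg (x : R) : 0 ≤ nrm J x := apply_nonneg _ _

lemma nrm_le {x : R} {n : ℕ} (h : x ∈ J ^ n) : nrm J x ≤ (1/2 : ℝ) ^ n :=
  (smoothingFun_le_self (mu J) x).trans ((mu_le_iff J x n).2 h)

lemma nrm_le_one (x : R) : nrm J x ≤ 1 := by simpa using nrm_le J (x := x) (n := 0) (by simp)

lemma nrm_zero : nrm J 0 = 0 := map_zero _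
lemma nrm_neg (x : R) : nrm J (-x) = nrm J x := map_neg_eq_map _ _

lemma nrm_sum {ι : Type*} (s : Finset ι) (f : ι → R) {c : ℝ} (hc : 0 ≤ c)
    (h : ∀ i ∈ s, nrm J (f i) ≤ c) : nrm J (∑ i ∈ s, f i) ≤ c := by
  classical
  induction s using Finset.induction_on with
  | empty => simpa [nrm_zero] using hc
  | insert i s hi ih =>
    rw [Finset.sum_insert hi]
    exact (nrm_add J _ _).trans (max_le (h i (by simp)) (ih fun j hj => h j (by simp [hj])))

lemma nrm_add_lt {x y : R} (h : nrm J y < nrm J x) : nrm J (x + y) = nrm J x := by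
  refine le_antisymm ((nrm_add J x y).trans (max_le le_rfl h.le)) ?_
  by_contra hc
  push Not at hc
  have := nrm_add J (x + y) (-y)
  rw [add_neg_cancel_right, nrm_neg] at this
  rcases le_max_iff.1 this with h1 | h1 <;> linarith

/-- the ideal of elements of norm at most `c`. -/
def Vc (c : ℝ) (hc : 0 ≤ c) : Ideal R where
  carrier := {x | nrm J x ≤ c}
  add_mem' := fun hx hy => (nrm_add J _ _).trans (max_le hx hy)
  zero_mem' := by simpa [nrm_zero] using hc
  smul_mem' := fun r x hx => by
    refine (nrm_mul J r x).trans ?_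
    exact (mul_le_of_le_one_left (nrm_nonneg J x) (nrm_le_one J r)).trans hx

/-- the normal filtration. -/
noncomputable def V (n : ℕ) : Ideal R := Vc J ((1/2 : ℝ) ^ n) (by positivity)

lemma mem_V {n : ℕ} {x : R} : x ∈ V J n ↔ nrm J x ≤ (1/2 : ℝ) ^ n := Iff.rfl

lemma V_anti {n k : ℕ} (h : n ≤ k) : V J k ≤ V J n := fun x hx =>
  le_trans ((mem_V J).1 hx) (pow_le_pow_of_le_one (by norm_num) (by norm_num) h)

lemma pow_le_V (n : ℕ) : J ^ n ≤ V J n := fun _ hx => nrm_le J hx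

lemma V_mul {n k : ℕ} : V J n * V J k ≤ V J (n + k) := by
  refine Ideal.mul_le.2 fun x hx y hy => ?_
  rw [mem_V] at *
  rw [pow_add]
  exact (nrm_mul J x y).trans (mul_le_mul hx hy (nrm_nonneg _ _) (by positivity))

lemma V_of_pow {n s : ℕ} (hs : 1 ≤ s) {x : R} (h : x ^ s ∈ V J (n * s)) : x ∈ V J n := by
  rw [mem_V] at *
  rw [nrm_pow J x hs, pow_mul] at h
  exact (pow_le_pow_iff_left₀ (nrm_nonneg _ _) (by positivity) (by omega)).1 h

lemma V_pow {n s : ℕ} {x : R} (h : x ∈ V J n) : x ^ s ∈ V J (n * s) := by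
  rcases Nat.eq_zero_or_pos s with rfl | hs
  · simpa [mem_V] using nrm_le_one J 1
  rw [mem_V] at *
  rw [nrm_pow J x hs, pow_mul]
  exact pow_le_pow_left₀ (nrm_nonneg _ _) h s

lemma V_zero : V J 0 = ⊤ := by
  rw [eq_top_iff]; intro x _; simpa [mem_V] using nrm_le_one J x

/-- what membership in `V` means. -/
lemma nrm_eventually {x : R} {n : ℕ} (h : x ∈ V J n) {k : ℕ} (hk : 1 ≤ k) :
    ∃ s₀ : ℕ, ∀ s ≥ s₀, ∀ p : ℕ, p * k + s ≤ n * k * s → x ^ s ∈ J ^ p := by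
  have ht := tendsto_smoothingFun_of_map_one_le_one (mu J) (mu_one J) x
  have h1 : smoothingFun (mu J) x < (1/2 : ℝ) ^ ((n : ℝ) - 1 / k) := by
    refine lt_of_le_of_lt h ?_
    rw [← Real.rpow_natCast]
    refine Real.rpow_lt_rpow_of_exponent_gt (by norm_num) (by norm_num) ?_
    have : (0 : ℝ) < 1 / k := by positivity
    linarith
  obtain ⟨s₀, hs₀⟩ := Filter.eventually_atTop.1 (ht.eventually_lt_const h1)
  refine ⟨max s₀ 1, fun s hs p hp => ?_⟩
  have hs1 : 1 ≤ s := le_trans (le_max_right _ _) hs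
  have h2 := hs₀ s (le_trans (le_max_left _ _) hs)
  rw [← mu_le_iff]
  have hsR : (0 : ℝ) < s := by exact_mod_cast hs1
  have h3 : mu J (x ^ s) ≤ ((1/2 : ℝ) ^ ((n : ℝ) - 1 / k)) ^ (s : ℝ) := by
    have := Real.rpow_le_rpow (by positivity) h2.le hsR.le
    rwa [smoothingSeminormSeq, ← Real.rpow_mul (apply_nonneg _ _), one_div_mul_cancel hsR.ne', Real.rpow_one] at this
  refine h3.trans ?_
  rw [← Real.rpow_mul (by norm_num), ← Real.rpow_natCast]
  refine Real.rpow_le_rpow_of_exponent_ge (by norm_num) (by norm_num) ?_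
  have hkR : (0 : ℝ) < k := by exact_mod_cast hk
  have hp' : (p : ℝ) * k + s ≤ n * k * s := by exact_mod_cast hp
  have : ((n : ℝ) - 1 / k) * s = (n * k * s - s) / k := by field_simp
  rw [this, le_div_iff₀ hkR]
  linarith

/-- a convenient sufficient criterion -/
lemma mem_V_of {x : R} {n c : ℕ} (h : ∀ s, 1 ≤ s → x ^ s ∈ J ^ (n * s - c)) : x ∈ V J n := by
  rw [mem_V]
  by_contra hc
  push Not at hc
  set q : ℝ := (1/2 : ℝ) ^ n with hq
  have hq0 : 0 < q := by positivity
  have h1 : 1 < nrm J x / q := (one_lt_div hq0).2 hc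
  obtain ⟨s, hs⟩ := pow_unbounded_of_one_lt ((2 : ℝ) ^ c) h1
  have hs1 : 1 ≤ s := by
    rcases Nat.eq_zero_or_pos s with rfl | h'
    · have := one_le_pow₀ (n := c) (one_le_two (α := ℝ)); simp at hs; linarith
    · exact h'
  have h2 := nrm_le J (h s hs1)
  rw [nrm_pow J x hs1] at h2
  have h3 : (1/2 : ℝ) ^ (n * s - c) ≤ 2 ^ c * q ^ s := by
    rw [hq, ← pow_mul]
    have : (1/2 : ℝ) ^ (n * s - c + c) ≤ (1/2 : ℝ) ^ (n * s) :=
      pow_le_pow_of_le_one (by norm_num) (by norm_num) (by omega)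
    rw [pow_add] at this
    have h4 : (1/2 : ℝ) ^ c * 2 ^ c = 1 := by rw [← mul_pow]; norm_num
    calc (1/2 : ℝ) ^ (n * s - c) = (1/2 : ℝ) ^ (n * s - c) * ((1/2 : ℝ) ^ c * 2 ^ c) := by rw [h4, mul_one]
      _ = 2 ^ c * ((1/2 : ℝ) ^ (n * s - c) * (1/2 : ℝ) ^ c) := by ring
      _ ≤ _ := by gcongr
  rw [div_pow, lt_div_iff₀ (by positivity)] at hs
  linarith

end
section
variable {R : Type*} [CommRing R] {d : ℕ} {a : Fin d → R} {m : Ideal R}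

lemma QRS.mu_form (H : QRS a m) {h : MvPolynomial (Fin d) R} {M : ℕ} (hh : h.IsHomogeneous M)
    (hm : ¬ CIn m h) (y : R) : mu (JJ a) (h.eval a * y) = (1/2 : ℝ) ^ M * mu (JJ a) y := by
  apply le_antisymm
  · refine (map_mul_le_mul (mu (JJ a)) _ _).trans ?_
    exact mul_le_mul_of_nonneg_right ((mu_le_iff _ _ _).2 (eval_mem_pow a hh)) (apply_nonneg _ _)
  · by_contra hc
    push Not at hc
    rcases mu0_cases (JJ a) (h.eval a * y) with h0 | ⟨p, hp⟩
    · have : mu0 (JJ a) y ≤ 0 := by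
        refine mu0_le_of _ _ le_rfl (fun n _ => H.nzd hh hm (n := n) ?_) (Or.inl rfl)
        rw [← mu0_le_iff, h0]; positivity
      have h1 : mu (JJ a) y = 0 := le_antisymm this (apply_nonneg _ _)
      rw [h1, mul_zero] at hc
      exact absurd hc (not_lt.2 (apply_nonneg _ _))
    · have hp' : mu (JJ a) (h.eval a * y) = (1/2 : ℝ) ^ p := hp
      rcases le_total M p with hMp | hMp
      · have : y ∈ JJ a ^ (p - M) := H.nzd hh hm (by
          rw [Nat.add_sub_cancel' hMp, ← mu_le_iff, hp'])
        rw [← mu_le_iff] at this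
        have h2 : (1/2 : ℝ) ^ M * mu (JJ a) y ≤ (1/2 : ℝ) ^ M * (1/2 : ℝ) ^ (p - M) := by gcongr
        rw [← pow_add, Nat.add_sub_cancel' hMp, ← hp'] at h2
        linarith
      · have h1 : mu (JJ a) y ≤ 1 := by simpa using (mu_le_iff (JJ a) y 0).2 (by simp)
        have h2 : (1/2 : ℝ) ^ M ≤ (1/2 : ℝ) ^ p := pow_le_pow_of_le_one (by norm_num) (by norm_num) hMp
        have h3 : (0 : ℝ) < (1/2) ^ M := by positivity
        rw [hp'] at hc
        nlinarith

lemma QRS.mu_form' (H : QRS a m) {h : MvPolynomial (Fin d) R} {M : ℕ} (hh : h.IsHomogeneous M)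
    (hm : ¬ CIn m h) : mu (JJ a) (h.eval a) = (1/2 : ℝ) ^ M := by
  have h1 : mu (JJ a) 1 = 1 := by
    refine le_antisymm (mu_one _) ?_
    rcases mu0_cases (JJ a) 1 with h0 | ⟨p, hp⟩
    · exfalso
      have : (1 : R) ∈ JJ a ^ 1 := by rw [← mu0_le_iff, h0]; positivity
      rw [pow_one] at this
      exact H.prime.ne_top ((Ideal.eq_top_iff_one _).2 (H.le this))
    · change 1 ≤ mu0 (JJ a) 1
      rw [hp]
      rcases Nat.eq_zero_or_pos p with rfl | hp0
      · simp
      · exfalso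
        have : (1 : R) ∈ JJ a ^ p := by rw [← mu0_le_iff, hp]
        exact H.prime.ne_top ((Ideal.eq_top_iff_one _).2 (H.le (Ideal.pow_le_self hp0.ne' this)))
  have := H.mu_form hh hm 1
  rwa [mul_one, h1, mul_one] at this

lemma QRS.nrm_form (H : QRS a m) {h : MvPolynomial (Fin d) R} {M : ℕ} (hh : h.IsHomogeneous M)
    (hm : ¬ CIn m h) (y : R) : nrm (JJ a) (h.eval a * y) = (1/2 : ℝ) ^ M * nrm (JJ a) y := by
  have hx : ∀ y, mu (JJ a) (h.eval a * y) = mu (JJ a) (h.eval a) * mu (JJ a) y := by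
    intro y; rw [H.mu_form hh hm, H.mu_form' hh hm]
  have h1 := smoothingSeminorm_of_mul (mu (JJ a)) (mu_one _) (mu_na _) hx y
  have h2 := smoothingSeminorm_apply_of_map_mul_eq_mul (mu (JJ a)) (mu_one _) (mu_na _) hx
  rw [h2, H.mu_form' hh hm] at h1
  exact h1

end
end Sally

namespace Sally
section
lemma multichoose_step {d : ℕ} (hd : 1 ≤ d) (p : ℕ) :
    (p + 1) * d.multichoose (p + 1) = (d + p) * d.multichoose p := by
  rw [Nat.multichoose_eq, Nat.multichoose_eq]
  obtain ⟨e, rfl⟩ : ∃ e, d = e + 1 := ⟨d - 1, by omega⟩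
  have := Nat.add_one_mul_choose_eq (e + p) p
  have h1 : e + 1 + (p + 1) - 1 = (e + p).succ := by omega
  have h2 : e + 1 + p - 1 = e + p := by omega
  have h3 : e + 1 + p = (e + p).succ := by omega
  rw [h1, h2, h3, this, mul_comm]

lemma multichoose_pos {d : ℕ} (hd : 1 ≤ d) (p : ℕ) : 0 < d.multichoose p := by
  rw [Nat.multichoose_eq]; exact Nat.choose_pos (by omega)

lemma multichoose_mono {d : ℕ} (hd : 1 ≤ d) : Monotone (d.multichoose) := by
  refine monotone_nat_of_le_succ fun p => ?_
  have := multichoose_step hd p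
  have h2 : (p + 1) * d.multichoose p ≤ (p + 1) * d.multichoose (p + 1) := by
    rw [this]; exact Nat.mul_le_mul_right _ (by omega)
  exact Nat.le_of_mul_le_mul_left h2 (by omega)

lemma multichoose_tendsto {d : ℕ} (hd : 1 ≤ d) (c : ℕ) :
    Filter.Tendsto (fun p : ℕ => (d.multichoose (p + c) : ℝ) / d.multichoose p) Filter.atTop (nhds 1) := by
  have h1 : Filter.Tendsto (fun p : ℕ => (d.multichoose (p + 1) : ℝ) / d.multichoose p) Filter.atTop (nhds 1) := by
    have e : ∀ p : ℕ, (d.multichoose (p + 1) : ℝ) / d.multichoose p = 1 + ((d : ℝ) - 1) * (1 / ((p : ℝ) + 1)) := by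
      intro p
      have h0 : (0 : ℝ) < d.multichoose p := by exact_mod_cast multichoose_pos hd p
      have h := multichoose_step hd p
      have h' : ((p : ℝ) + 1) * d.multichoose (p + 1) = (d + p) * d.multichoose p := by exact_mod_cast h
      have hp : (0 : ℝ) < (p : ℝ) + 1 := by positivity
      field_simp
      linarith
    simp_rw [e]
    have := (tendsto_one_div_add_atTop_nhds_zero_nat (𝕜 := ℝ)).const_mul ((d : ℝ) - 1)
    simpa using this.const_add 1
  induction c with
  | zero =>
    refine tendsto_const_nhds.congr fun p => ?_
    have h0 : (0 : ℝ) < d.multichoose p := by exact_mod_cast multichoose_pos hd p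
    simp [h0.ne']
  | succ c ih =>
    have h2 := (h1.comp (Filter.tendsto_add_atTop_nat c)).mul ih
    rw [one_mul] at h2
    refine h2.congr fun p => ?_
    have h0 : (0 : ℝ) < d.multichoose (p + c) := by exact_mod_cast multichoose_pos hd (p + c)
    simp only [Function.comp]
    rw [div_mul_div_cancel₀ h0.ne']
    rfl

lemma multichoose_ratio {d : ℕ} (hd : 1 ≤ d) (c : ℕ) {A B : ℕ} (hAB : A < B) :
    ∃ P, ∀ p ≥ P, A * d.multichoose (p + c) < B * d.multichoose p := by
  have h1 := (multichoose_tendsto hd c).const_mul (A : ℝ)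
  rw [mul_one] at h1
  have hAB' : (A : ℝ) < B := by exact_mod_cast hAB
  obtain ⟨P, hP⟩ := Filter.eventually_atTop.1 (h1.eventually_lt_const hAB')
  refine ⟨P, fun p hp => ?_⟩
  have h0 : (0 : ℝ) < d.multichoose p := by exact_mod_cast multichoose_pos hd p
  have := hP p hp
  rw [← mul_div_assoc, div_lt_iff₀ h0] at this
  exact_mod_cast this
end

section
variable {R : Type*} [CommRing R]

/-- `Σ_{j<i} x^j J^{p - n j}` -/
noncomputable def BB (J : Ideal R) (x : R) (n i p : ℕ) : Ideal R :=
  ∑ j ∈ range i, Ideal.span {x ^ j} * J ^ (p - n * j)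

variable {J : Ideal R} {x : R} {n : ℕ}

lemma BB_succ (i p : ℕ) : BB J x n (i + 1) p = BB J x n i p ⊔ Ideal.span {x ^ i} * J ^ (p - n * i) := by
  rw [BB, Finset.sum_range_succ]; rfl

lemma mem_BB {i p j : ℕ} (hj : j < i) {c : R} (hc : c ∈ J ^ (p - n * j)) : x ^ j * c ∈ BB J x n i p := by
  induction i with
  | zero => omega
  | succ i ih =>
    rw [BB_succ]
    rcases Nat.lt_succ_iff_lt_or_eq.1 hj with h | rfl
    · exact Ideal.mem_sup_left (ih h)
    · exact Ideal.mem_sup_right (Ideal.mul_mem_mul (Ideal.mem_span_singleton_self _) hc)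

lemma BB_le {i p : ℕ} {K : Ideal R} (h : ∀ j < i, ∀ c ∈ J ^ (p - n * j), x ^ j * c ∈ K) :
    BB J x n i p ≤ K := by
  induction i with
  | zero => simp [BB]
  | succ i ih =>
    rw [BB_succ]
    refine sup_le (ih fun j hj => h j (by omega)) ?_
    refine Ideal.mul_le.2 fun r hr c hc => ?_
    obtain ⟨b, rfl⟩ := Ideal.mem_span_singleton'.1 hr
    rw [mul_assoc]
    exact K.mul_mem_left _ (h i (by omega) c hc)

lemma BB_mul {i p M : ℕ} : J ^ M * BB J x n i p ≤ BB J x n i (p + M) := by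
  refine Ideal.mul_le.2 fun r hr c hc => ?_
  have : BB J x n i p ≤ Submodule.comap (LinearMap.mulLeft R r) (BB J x n i (p + M)) := by
    refine BB_le fun j hj c hc => ?_
    change r * (x ^ j * c) ∈ BB J x n i (p + M)
    rw [mul_left_comm]
    refine mem_BB hj ?_
    have h1 : r * c ∈ J ^ (M + (p - n * j)) := by
      rw [pow_add]; exact Ideal.mul_mem_mul hr hc
    exact Ideal.pow_le_pow_right (by omega) h1
  exact this hc

lemma BB_anti {i p q : ℕ} (h : p ≤ q) : BB J x n i q ≤ BB J x n i p :=
  BB_le fun j hj c hc => mem_BB hj (Ideal.pow_le_pow_right (by omega) hc)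

lemma BB_mono {i p : ℕ} : BB J x n i p ≤ BB J x n (i + 1) p := by
  rw [BB_succ]; exact le_sup_left

variable {d : ℕ} {a : Fin d → R} {m : Ideal R}

/-- a leading relation -/
def Rel (a : Fin d → R) (m : Ideal R) (x : R) (n i : ℕ) : Prop :=
  ∃ (q : ℕ) (h : MvPolynomial (Fin d) R), h.IsHomogeneous q ∧ ¬ CIn m h ∧
    h.eval a * x ^ i ∈ BB (JJ a) x n i (q + n * i)

lemma exists_rel [IsLocalRing R] [IsNoetherianRing R] (hd : 1 ≤ d) (H : QRS a (maximalIdeal R))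
    (hx : x ∈ V (JJ a) n) : ∃ i, 1 ≤ i ∧ Rel a (maximalIdeal R) x n i := by
  by_contra hcon
  push Not at hcon
  set J := JJ a with hJ
  obtain ⟨c0, hc0⟩ := H.pow_le
  have hfin : ∀ p, ell (J ^ p) ≠ ⊤ := by
    intro p
    refine ell_lt_top_of_pow_le (c := c0 * p) ?_
    rw [pow_mul]; exact Ideal.pow_right_mono hc0 p
  obtain ⟨e, he⟩ := ENat.ne_top_iff_exists.1 (show ell J ≠ ⊤ by simpa using hfin 1)
  -- lower bound
  have hlow : ∀ M p, n * M ≤ p → ell (BB J x n (M + 1) p) + (M * d.multichoose (p - n * M) : ℕ) ≤ ell (J ^ p) := by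
    intro M
    induction M with
    | zero =>
      intro p _
      have : BB J x n 1 p = J ^ p := by simp [BB]
      simp [this]
    | succ M ih =>
      intro p hp
      have hp' : n * M ≤ p := le_trans (Nat.mul_le_mul_left _ (Nat.le_succ M)) hp
      have h1 := ih p hp'
      rw [ell_eq_add (BB_mono (J := J) (x := x) (n := n) (i := M + 1) (p := p))] at h1
      have h2 : ((d.multichoose (p - n * (M + 1)) : ℕ) : ℕ∞) ≤
          qlen (BB J x n (M + 1 + 1) p) (BB J x n (M + 1) p) := by
        have := le_qlen (ι := Mon d (p - n * (M + 1))) (A := BB J x n (M + 1 + 1) p) (B := BB J x n (M + 1) p)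
          (K := maximalIdeal R) (fun s => x ^ (M + 1) * mon a s)
          (fun s => mem_BB (Nat.lt_succ_self _) (mon_mem a s)) ?_
        · rwa [card_Mon, ell_maximalIdeal, mul_one] at this
        · intro r hr s
          by_contra hs
          refine hcon (M + 1) (by omega) ⟨p - n * (M + 1), ofCoeff r, ofCoeff_homog r, ?_, ?_⟩
          · intro hc; apply hs; rw [← coeff_ofCoeff r]; exact hc _
          · rw [eval_ofCoeff, Finset.sum_mul, Nat.sub_add_cancel hp]
            convert hr using 2 with s
            ring
      have h3 : (((M + 1) * d.multichoose (p - n * (M + 1)) : ℕ) : ℕ∞) ≤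
          (M * d.multichoose (p - n * M) : ℕ) + (d.multichoose (p - n * (M + 1)) : ℕ) := by
        rw [← Nat.cast_add, add_mul, one_mul]
        have := multichoose_mono hd (show p - n * (M + 1) ≤ p - n * M from
          Nat.sub_le_sub_left (Nat.mul_le_mul_left _ (Nat.le_succ M)) _)
        have := Nat.mul_le_mul_left M this
        exact_mod_cast Nat.add_le_add_right this _
      calc _ ≤ ell (BB J x n (M + 1 + 1) p) + ((M * d.multichoose (p - n * M) : ℕ) + (d.multichoose (p - n * (M + 1)) : ℕ)) := by gcongr
        _ ≤ ell (BB J x n (M + 1 + 1) p) + ((M * d.multichoose (p - n * M) : ℕ) + qlen (BB J x n (M + 1 + 1) p) (BB J x n (M + 1) p)) := by gcongr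
        _ = _ := by ring
        _ ≤ _ := h1
  -- upper bound
  obtain ⟨s₀, hs₀⟩ := nrm_eventually J hx (k := 2 * e + 1) (by omega)
  set cst := 2 * e * (1 + n * s₀) + 1 with hcst
  -- choose M a multiple
  set M := (2 * e + 1) * cst with hM
  set g := cst + n * s₀ with hg
  have hpow : ∀ j ≤ M, x ^ j ∈ J ^ (n * j - g) := by
    intro j hj
    rcases le_total s₀ j with h | h
    · rcases le_total g (n * j) with h1 | h1
      · refine hs₀ j h _ ?_
        obtain ⟨t, ht⟩ := Nat.exists_eq_add_of_le h1
        rw [ht, Nat.add_sub_cancel_left]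
        have : n * (2 * e + 1) * j = (g + t) * (2 * e + 1) := by rw [← ht]; ring
        rw [this]
        nlinarith [Nat.zero_le (n * s₀ * (2 * e + 1))]
      · have : n * j - g = 0 := by omega
        rw [this]; simp
    · have : n * j ≤ n * s₀ := Nat.mul_le_mul_left _ h
      have h2 : n * j - g = 0 := by omega
      rw [h2]; simp
  have hBle : ∀ p, BB J x n (M + 1) p ≤ J ^ (p - g) := by
    intro p
    refine BB_le fun j hj c hc => ?_
    have : x ^ j * c ∈ J ^ ((n * j - g) + (p - n * j)) := by
      rw [pow_add]; exact Ideal.mul_mem_mul (hpow j (by omega)) hc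
    exact Ideal.pow_le_pow_right (by omega) this
  obtain ⟨P, hP⟩ := multichoose_ratio hd (n * M) (A := e * g) (B := M) (by
    rw [hM, hg]; nlinarith)
  set p := P + n * M + g with hp
  have h1 := hlow M p (by omega)
  have h2 := ell_mono (hBle p)
  have h3 : ell (J ^ p) ≤ ell (J ^ (p - g)) + ((e * g * d.multichoose p : ℕ) : ℕ∞) := by
    rw [H.ell_pow, H.ell_pow, ← he, ← Nat.cast_mul, ← Nat.cast_mul, ← Nat.cast_add, Nat.cast_le]
    have : ∑ i ∈ range p, d.multichoose i ≤ ∑ i ∈ range (p - g), d.multichoose i + g * d.multichoose p := by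
      have hpg : p = (p - g) + g := by omega
      conv_lhs => rw [hpg]
      rw [Finset.sum_range_add]
      gcongr
      refine (Finset.sum_le_card_nsmul _ _ (d.multichoose p) ?_).trans ?_
      · intro i hi
        rw [Finset.mem_range] at hi
        exact multichoose_mono hd (by omega)
      · simp
    calc _ ≤ (∑ i ∈ range (p - g), d.multichoose i + g * d.multichoose p) * e := Nat.mul_le_mul_right _ this
      _ = _ := by ring
  have h4 : ell (J ^ (p - g)) + ((M * d.multichoose (p - n * M) : ℕ) : ℕ∞) ≤
      ell (J ^ (p - g)) + ((e * g * d.multichoose p : ℕ) : ℕ∞) :=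
    le_trans (by gcongr) (h1.trans h3)
  have h5 := (ENat.add_le_add_iff_left (hfin _)).1 h4
  rw [Nat.cast_le] at h5
  have h6 := hP (p - n * M) (by omega)
  rw [Nat.sub_add_cancel (by omega)] at h6
  omega

end
end Sally

namespace Sally
section
variable {R : Type*} [CommRing R]

lemma stable_filtration [IsNoetherianRing R] {J : Ideal R} (F : ℕ → Ideal R) (hF : ∀ p, F (p + 1) ≤ F p)
    (hJ : ∀ p, J * F p ≤ F (p + 1)) (c : ℕ) (hc : ∀ p, F p ≤ J ^ (p - c)) :
    ∃ n₀, ∀ n ≥ n₀, F (n + 1) = J * F n := by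
  let F1 : J.Filtration R := ⟨F, hF, hJ⟩
  let F2 : J.Filtration R := ⟨fun p => J ^ (p - c), fun p => Ideal.pow_le_pow_right (by omega),
    fun p => by
      rw [smul_eq_mul, ← pow_succ']; exact Ideal.pow_le_pow_right (by omega)⟩
  have h2 : F2.Stable := ⟨c, fun n hn => by
    change J * J ^ (n - c) = J ^ (n + 1 - c)
    rw [← pow_succ']; congr 1; omega⟩
  obtain ⟨n₀, h⟩ := h2.of_le (F' := F1) (fun p => hc p)
  exact ⟨n₀, fun n hn => (h n hn).symm⟩

lemma stable_pow {J : Ideal R} {F : ℕ → Ideal R} {n₀ : ℕ} (h : ∀ n ≥ n₀, F (n + 1) = J * F n) (n k : ℕ)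
    (hn : n₀ ≤ n) : F (n + k) = J ^ k * F n := by
  induction k with
  | zero => simp
  | succ k ih => rw [← add_assoc, h _ (by omega), ih, ← mul_assoc, pow_succ']

lemma det_trick [IsNoetherianRing R] [Nontrivial R] {A K : Ideal R} {x : R} (h : ∀ y ∈ A, x * y ∈ K * A) :
    ∃ N : ℕ, ∃ c : ℕ → R, (∀ i ∈ Finset.Icc 1 N, c i ∈ K ^ i) ∧
      ∀ y ∈ A, (x ^ N + ∑ i ∈ Finset.Icc 1 N, c i * x ^ (N - i)) * y = 0 := by
  let f : Module.End R A := LinearMap.lsmul R A x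
  have hr : LinearMap.range f ≤ K • ⊤ := by
    rintro _ ⟨y, rfl⟩
    have h1 := h y y.2
    have h2 : (K • (⊤ : Submodule R A)).map A.subtype = K * A := by
      rw [Submodule.map_smul'', Submodule.map_top, Submodule.range_subtype, smul_eq_mul]
    rw [← h2] at h1
    obtain ⟨z, hz, hz'⟩ := h1
    have : f y = z := Subtype.ext hz'.symm
    rw [this]; exact hz
  obtain ⟨p, hp, -, hc, hz⟩ :=
    LinearMap.exists_monic_and_natDegree_eq_and_coeff_mem_pow_and_aeval_eq_zero R f K hr
  refine ⟨p.natDegree, fun i => p.coeff (p.natDegree - i), ?_, ?_⟩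
  · intro i hi
    rw [Finset.mem_Icc] at hi
    have := hc (p.natDegree - i)
    rwa [Nat.sub_sub_self hi.2] at this
  · intro y hy
    have h1 : ∀ q : R[X], ((aeval f q) ⟨y, hy⟩ : A).1 = q.eval x * y := by
      intro q
      have : aeval f q = LinearMap.lsmul R A (q.eval x) := by
        have := Polynomial.aeval_algHom_apply (Algebra.lsmul R R A) x q
        rw [Polynomial.coe_aeval_eq_eval] at this
        exact this
      rw [this]; rfl
    have h2 := h1 p
    rw [hz] at h2
    have h3 : p.eval x = x ^ p.natDegree + ∑ i ∈ Finset.Icc 1 p.natDegree, p.coeff (p.natDegree - i) * x ^ (p.natDegree - i) := by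
      rw [Polynomial.eval_eq_sum_range, Finset.sum_range_succ, add_comm, hp.coeff_natDegree, one_mul]
      congr 1
      refine Finset.sum_nbij' (fun j => p.natDegree - j) (fun i => p.natDegree - i) ?_ ?_ ?_ ?_ ?_
      · intro j hj; simp only [Finset.mem_range, Finset.mem_Icc] at *; omega
      · intro j hj; simp only [Finset.mem_range, Finset.mem_Icc] at *; omega
      · intro j hj; simp only [Finset.mem_range] at *; omega
      · intro j hj; simp only [Finset.mem_Icc] at *; omega
      · intro j hj; simp only [Finset.mem_range] at *
        rw [Nat.sub_sub_self hj.le]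
    rw [← h3, ← h2]; rfl

lemma CIn_X_pow {d : ℕ} {m : Ideal R} (hm : m ≠ ⊤) (i : Fin d) (p : ℕ) :
    ¬ CIn m (MvPolynomial.X i ^ p : MvPolynomial (Fin d) R) := by
  intro h
  have := h (Finsupp.single i p)
  rw [MvPolynomial.X_pow_eq_monomial, MvPolynomial.coeff_monomial, if_pos rfl] at this
  exact hm ((Ideal.eq_top_iff_one _).2 this)

lemma CIn_one {d : ℕ} {m : Ideal R} (hm : m ≠ ⊤) : ¬ CIn m (1 : MvPolynomial (Fin d) R) := by
  intro h
  have := h 0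
  rw [MvPolynomial.coeff_zero_one] at this
  exact hm ((Ideal.eq_top_iff_one _).2 this)

variable {d : ℕ} {a : Fin d → R} {m : Ideal R}

/-- auxiliary filtration -/
def VP (H : QRS a m) (x : R) (n i p : ℕ) : Ideal R where
  carrier := {y | ∃ (M : ℕ) (h : MvPolynomial (Fin d) R), h.IsHomogeneous M ∧ ¬ CIn m h ∧
    h.eval a * y ∈ BB (JJ a) x n i (p + M)}
  zero_mem' := ⟨0, 1, MvPolynomial.isHomogeneous_one _ _, CIn_one H.prime.ne_top, by simp⟩
  add_mem' := by
    rintro y y' ⟨M, h, h1, h2, h3⟩ ⟨M', h', h1', h2', h3'⟩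
    haveI := H.prime
    refine ⟨M + M', h * h', h1.mul h1', fun hc => ?_, ?_⟩
    · rcases hc.mul_mem with hc | hc
      · exact h2 hc
      · exact h2' hc
    · have e : (h * h').eval a * (y + y') = h'.eval a * (h.eval a * y) + h.eval a * (h'.eval a * y') := by
        rw [map_mul]; ring
      rw [e]
      refine Ideal.add_mem _ ?_ ?_
      · have := BB_mul (Ideal.mul_mem_mul (eval_mem_pow a h1') h3)
        rwa [add_assoc] at this
      · have := BB_mul (Ideal.mul_mem_mul (eval_mem_pow a h1) h3')
        rwa [add_assoc, add_comm M' M] at this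
  smul_mem' := by
    rintro r y ⟨M, h, h1, h2, h3⟩
    refine ⟨M, h, h1, h2, ?_⟩
    rw [smul_eq_mul, mul_left_comm]
    exact Ideal.mul_mem_left _ _ h3

theorem integral_of_mem_V [IsLocalRing R] [IsNoetherianRing R] (hd : 1 ≤ d) (H : QRS a (maximalIdeal R))
    {x : R} {n : ℕ} (hx : x ∈ V (JJ a) n) : IsIntegralOverIdeal (JJ a ^ n) x := by
  obtain ⟨i, hi, q, h0, hh0, hm0, hr0⟩ := exists_rel hd H hx
  haveI := H.prime
  obtain ⟨n₀, hst⟩ := stable_filtration (J := JJ a) (VP H x n i) (fun p y => by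
      rintro ⟨M, h, h1, h2, h3⟩
      exact ⟨M, h, h1, h2, BB_anti (by omega) h3⟩)
    (fun p => by
      refine Ideal.mul_le.2 ?_
      rintro r hr y ⟨M, h, h1, h2, h3⟩
      refine ⟨M, h, h1, h2, ?_⟩
      have := BB_mul (M := 1) (Ideal.mul_mem_mul (by rwa [pow_one]) h3)
      rw [mul_left_comm]
      convert this using 2
      omega) (n * i)
    (fun p y => by
      rintro ⟨M, h, h1, h2, h3⟩
      rcases le_total (n * i) p with hp | hp
      · refine H.nzd h1 h2 ?_
        have hle : BB (JJ a) x n i (p + M) ≤ JJ a ^ (M + (p - n * i)) := by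
          refine BB_le fun j hj c hc => Ideal.mul_mem_left _ _ (Ideal.pow_le_pow_right ?_ hc)
          have : n * j ≤ n * i := Nat.mul_le_mul_left _ hj.le
          omega
        exact hle h3
      · rw [Nat.sub_eq_zero_of_le hp]; simp)
  have hpow := stable_pow hst n₀ n le_rfl
  have hstep : ∀ y ∈ VP H x n i n₀, x * y ∈ JJ a ^ n * VP H x n i n₀ := by
    rw [← hpow]
    rintro y ⟨M, h, h1, h2, h3⟩
    refine ⟨q + M, h0 * h, hh0.mul h1, fun hc => ?_, ?_⟩
    · rcases hc.mul_mem with hc | hc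
      · exact hm0 hc
      · exact h2 hc
    have hle : BB (JJ a) x n i (n₀ + M) ≤
        Submodule.comap (LinearMap.mulLeft R (h0.eval a * x)) (BB (JJ a) x n i (n₀ + n + (q + M))) := by
      refine BB_le fun j hj c hc => ?_
      change h0.eval a * x * (x ^ j * c) ∈ BB (JJ a) x n i (n₀ + n + (q + M))
      rcases Nat.lt_or_ge (j + 1) i with hji | hji
      · have e : h0.eval a * x * (x ^ j * c) = x ^ (j + 1) * (h0.eval a * c) := by ring
        rw [e]
        refine mem_BB hji ?_
        have := Ideal.mul_mem_mul (eval_mem_pow a hh0) hc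
        rw [← pow_add] at this
        exact Ideal.pow_le_pow_right (by rw [mul_add, mul_one]; omega) this
      · have hji' : i = j + 1 := by omega
        have e : h0.eval a * x * (x ^ j * c) = c * (h0.eval a * x ^ i) := by rw [hji']; ring
        rw [e]
        have := BB_mul (Ideal.mul_mem_mul hc hr0)
        exact BB_anti (by rw [hji', mul_add, mul_one]; omega) this
    have := hle h3
    have e : (h0 * h).eval a * (x * y) = h0.eval a * x * (h.eval a * y) := by rw [map_mul]; ring
    rw [e]
    exact this
  obtain ⟨N, c, hc, hz⟩ := det_trick hstep
  set Q := x ^ N + ∑ i ∈ Finset.Icc 1 N, c i * x ^ (N - i) with hQ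
  have hone : JJ a ^ n₀ ≤ VP H x n i n₀ := by
    intro y hy
    refine ⟨0, 1, MvPolynomial.isHomogeneous_one _ _, CIn_one H.prime.ne_top, ?_⟩
    have := mem_BB (J := JJ a) (x := x) (n := n) (i := i) (p := n₀ + 0) (j := 0) (by omega) (c := y) (by simpa using hy)
    simpa using this
  have hQ0 : Q = 0 := by
    let i0 : Fin d := ⟨0, by omega⟩
    have hX : (MvPolynomial.X i0 ^ n₀ : MvPolynomial (Fin d) R).IsHomogeneous n₀ := by
      simpa using (MvPolynomial.isHomogeneous_X R i0).pow n₀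
    have h1 := hz _ (hone (eval_mem_pow a hX))
    have h2 : ∀ k, Q ∈ JJ a ^ k := fun k =>
      H.nzd hX (CIn_X_pow H.prime.ne_top i0 n₀) (by rw [mul_comm, h1]; exact zero_mem _)
    have h3 := Ideal.iInf_pow_eq_bot_of_isLocalRing (JJ a)
      (fun h => H.prime.ne_top (top_le_iff.1 (h ▸ H.le)))
    have : Q ∈ (⊥ : Ideal R) := by rw [← h3]; exact Ideal.mem_iInf.2 h2
    simpa using this
  refine ⟨N, ?_, c, hc, hQ0⟩
  rcases Nat.eq_zero_or_pos N with h | h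
  · exfalso
    rw [hQ, h] at hQ0
    simp at hQ0
  · exact h
end
end Sally

namespace Sally
section
variable {R : Type*} [CommRing R] (J : Ideal R)

lemma nrm_sum_lt {ι : Type*} (s : Finset ι) (f : ι → R) {c : ℝ} (hc : 0 < c)
    (h : ∀ i ∈ s, nrm J (f i) < c) : nrm J (∑ i ∈ s, f i) < c := by
  classical
  induction s using Finset.induction_on with
  | empty => simpa [nrm_zero] using hc
  | insert i s hi ih =>
    rw [Finset.sum_insert hi]
    exact (nrm_add J _ _).trans_lt (max_lt (h i (by simp)) (ih fun j hj => h j (by simp [hj])))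

lemma coeff_mul_pairs (f g : MonoidAlgebra R ℝ) (c : ℝ) :
    (f * g).coeff c = ∑ p ∈ f.coeff.support ×ˢ g.coeff.support,
      if p.1 * p.2 = c then f.coeff p.1 * g.coeff p.2 else 0 := by
  classical
  rw [MonoidAlgebra.coeff_mul, Finset.sum_product]
  simp only [Finsupp.sum]

/-- the subring of `R[ℝ]` of elements with `nrm (f c) ≤ c`. -/
def SS : Subring (MonoidAlgebra R ℝ) where
  carrier := {f | ∀ c, f.coeff c ≠ 0 → nrm J (f.coeff c) ≤ c}
  mul_mem' := by
    intro f g hf hg c hc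
    rw [coeff_mul_pairs] at hc ⊢
    have key : ∀ p ∈ f.coeff.support ×ˢ g.coeff.support,
        p.1 * p.2 = c → 0 ≤ c ∧ nrm J (f.coeff p.1 * g.coeff p.2) ≤ c := by
      intro p hp he
      rw [Finset.mem_product, Finsupp.mem_support_iff, Finsupp.mem_support_iff] at hp
      have h1 := hf _ hp.1
      have h2 := hg _ hp.2
      have h3 := nrm_nonneg J (f.coeff p.1)
      have h4 := nrm_nonneg J (g.coeff p.2)
      rw [← he]
      exact ⟨mul_nonneg (h3.trans h1) (h4.trans h2),
        (nrm_mul J _ _).trans (mul_le_mul h1 h2 h4 (h3.trans h1))⟩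
    have hc0 : 0 ≤ c := by
      by_contra hneg
      apply hc
      refine Finset.sum_eq_zero fun p hp => ?_
      rw [if_neg]
      intro he
      exact hneg (key p hp he).1
    refine nrm_sum J _ _ hc0 fun p hp => ?_
    split_ifs with he
    · exact (key p hp he).2
    · simpa [nrm_zero] using hc0
  one_mem' := by
    intro c hc
    rw [MonoidAlgebra.one_def, MonoidAlgebra.coeff_single, Finsupp.single_apply] at *
    split_ifs at * with h
    · rw [← h]; exact nrm_le_one J _
    · simp at hc
  add_mem' := by
    intro f g hf hg c hc
    rw [MonoidAlgebra.coeff_add, Finsupp.add_apply] at *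
    by_cases h1 : f.coeff c = 0
    · rw [h1, zero_add] at hc ⊢; exact hg c hc
    by_cases h2 : g.coeff c = 0
    · rw [h2, add_zero] at hc ⊢; exact hf c h1
    exact (nrm_add J _ _).trans (max_le (hf c h1) (hg c h2))
  zero_mem' := by intro c hc; simp at hc
  neg_mem' := by
    intro f hf c hc
    have : (-f).coeff c = - f.coeff c := rfl
    rw [this] at *
    rw [nrm_neg]
    exact hf c (by simpa using hc)

lemma mem_SS {f : MonoidAlgebra R ℝ} : f ∈ SS J ↔ ∀ c, f.coeff c ≠ 0 → nrm J (f.coeff c) ≤ c := Iff.rfl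

variable {J}
lemma SS_le {f : MonoidAlgebra R ℝ} (hf : f ∈ SS J) {c : ℝ} (hc : 0 ≤ c) : nrm J (f.coeff c) ≤ c := by
  by_cases h : f.coeff c = 0
  · rw [h, nrm_zero]; exact hc
  · exact hf c h

lemma SS_mul_lt {f g : MonoidAlgebra R ℝ} (hf : f ∈ SS J) (hg : g ∈ SS J) {c : ℝ} (hc : 0 < c)
    (h : ∀ x y, 0 < x → 0 < y → x * y = c → nrm J (f.coeff x * g.coeff y) < c) :
    nrm J ((f * g).coeff c) < c := by
  rw [coeff_mul_pairs]
  refine nrm_sum_lt J _ _ hc fun p hp => ?_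
  split_ifs with he
  · rw [Finset.mem_product, Finsupp.mem_support_iff, Finsupp.mem_support_iff] at hp
    have h1 := hf _ hp.1
    have h2 := hg _ hp.2
    have h3 := nrm_nonneg J (f.coeff p.1)
    have h4 := nrm_nonneg J (g.coeff p.2)
    have h5 : p.1 ≠ 0 := by rintro h0; rw [h0] at he; simp at he; linarith
    have h6 : p.2 ≠ 0 := by rintro h0; rw [h0] at he; simp at he; linarith
    exact h _ _ (lt_of_le_of_ne (h3.trans h1) h5.symm) (lt_of_le_of_ne (h4.trans h2) h6.symm) he
  · rw [nrm_zero]; exact hc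

lemma SS_lead {f g : MonoidAlgebra R ℝ} (hf : f ∈ SS J) (hg : g ∈ SS J) {c c' : ℝ} (hc : 0 < c)
    (hc' : 0 < c') (h1 : ∀ x, c < x → nrm J (f.coeff x) < x) (h2 : ∀ x, c' < x → nrm J (g.coeff x) < x)
    (h : nrm J (f.coeff c * g.coeff c') = c * c') : nrm J ((f * g).coeff (c * c')) = c * c' := by
  classical
  have hcc : 0 < c * c' := mul_pos hc hc'
  have hfc : f.coeff c ≠ 0 := by
    intro h0; rw [h0, zero_mul, nrm_zero] at h; linarith
  have hgc : g.coeff c' ≠ 0 := by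
    intro h0; rw [h0, mul_zero, nrm_zero] at h; linarith
  rw [coeff_mul_pairs, ← Finset.add_sum_erase _ _ (a := (c, c'))
    (by simp [hfc, hgc])]
  rw [if_pos rfl]
  dsimp only
  rw [nrm_add_lt, h]
  rw [h]
  refine nrm_sum_lt J _ _ hcc fun p hp => ?_
  split_ifs with he
  · rw [Finset.mem_erase, Finset.mem_product, Finsupp.mem_support_iff, Finsupp.mem_support_iff] at hp
    have g1 := hf _ hp.2.1
    have g2 := hg _ hp.2.2
    have g3 := nrm_nonneg J (f.coeff p.1)
    have g4 := nrm_nonneg J (g.coeff p.2)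
    have g5 : p.1 ≠ 0 := by rintro h0; rw [h0] at he; simp at he; aesop
    have g6 : p.2 ≠ 0 := by rintro h0; rw [h0] at he; simp at he; aesop
    have p1 : 0 < p.1 := lt_of_le_of_ne (g3.trans g1) g5.symm
    have p2 : 0 < p.2 := lt_of_le_of_ne (g4.trans g2) g6.symm
    refine (nrm_mul J _ _).trans_lt ?_
    rw [← he]
    rcases lt_trichotomy p.1 c with hl | hl | hl
    · have : c' < p.2 := by
        by_contra hcon
        push Not at hcon
        nlinarith
      exact (mul_le_mul_of_nonneg_right g1 g4).trans_lt (mul_lt_mul_of_pos_left (h2 _ this) p1)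
    · exfalso
      apply hp.1
      have : p.2 = c' := by
        rw [hl] at he; exact mul_left_cancel₀ hc.ne' he
      exact Prod.ext hl this
    · exact (mul_le_mul_of_nonneg_left g2 g3).trans_lt (mul_lt_mul_of_pos_right (h1 _ hl) p2)
  · rw [nrm_zero]; exact hcc

variable (J) in
/-- the ideal of the associated graded ring relation. -/
def NN : Ideal (SS J) where
  carrier := {f | ∀ c, 0 < c → nrm J (f.1.coeff c) < c}
  add_mem' := fun hf hg c hc => (nrm_add J _ _).trans_lt (max_lt (hf c hc) (hg c hc))
  zero_mem' := by intro c hc; simpa [nrm_zero] using hc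
  smul_mem' := by
    intro f g hg c hc
    refine SS_mul_lt f.2 g.2 hc fun x y hx hy he => ?_
    refine (nrm_mul J _ _).trans_lt ?_
    rw [← he]
    exact mul_lt_mul_of_le_of_lt_of_nonneg_of_pos (SS_le f.2 hx.le) (hg y hy) (nrm_nonneg J _) hx

variable (J) in
/-- the associated graded ring of the norm filtration. -/
abbrev EE := SS J ⧸ NN J

lemma mem_NN {f : SS J} : f ∈ NN J ↔ ∀ c, 0 < c → nrm J (f.1.coeff c) < c := Iff.rfl

/-- for elements not in `NN`, there is a leading coefficient. -/
lemma exists_lead {f : SS J} (hf : f ∉ NN J) : ∃ c, 0 < c ∧ nrm J (f.1.coeff c) = c ∧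
    ∀ x, c < x → nrm J (f.1.coeff x) < x := by
  classical
  let s := f.1.coeff.support.filter (fun c => 0 < c ∧ nrm J (f.1.coeff c) = c)
  have hs : s.Nonempty := by
    rw [mem_NN] at hf
    push Not at hf
    obtain ⟨c, hc, h⟩ := hf
    refine ⟨c, ?_⟩
    have : nrm J (f.1.coeff c) = c := le_antisymm (SS_le f.2 hc.le) h
    refine Finset.mem_filter.2 ⟨?_, hc, this⟩
    rw [Finsupp.mem_support_iff]
    intro h0; rw [h0, nrm_zero] at this; linarith
  have hm := Finset.max'_mem s hs
  have hm2 := (Finset.mem_filter.1 hm).2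
  refine ⟨s.max' hs, hm2.1, hm2.2, fun x hx => ?_⟩
  have hx0 : 0 < x := hm2.1.trans hx
  refine lt_of_le_of_ne (SS_le f.2 hx0.le) fun he => ?_
  have : x ∈ s := by
    refine Finset.mem_filter.2 ⟨?_, hx0, he⟩
    rw [Finsupp.mem_support_iff]
    intro h0; rw [h0, nrm_zero] at he; linarith
  exact absurd (Finset.le_max' s x this) (not_le.2 hx)

lemma EE_sq {x : EE J} (h : x * x = 0) : x = 0 := by
  obtain ⟨f, rfl⟩ := Ideal.Quotient.mk_surjective x
  rw [← map_mul, Ideal.Quotient.eq_zero_iff_mem] at h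
  rw [Ideal.Quotient.eq_zero_iff_mem]
  by_contra hf
  obtain ⟨c, hc, h1, h2⟩ := exists_lead hf
  have := SS_lead f.2 f.2 hc hc h2 h2 (by rw [← pow_two, nrm_pow J _ (by norm_num), h1, pow_two])
  have h3 := (mem_NN.1 h) (c * c) (mul_pos hc hc)
  rw [Subring.coe_mul] at h3
  linarith

instance : IsReduced (EE J) := by
  refine ⟨fun x hx => ?_⟩
  obtain ⟨n, hn⟩ := hx
  have : ∀ k, x ^ (2 ^ k) = 0 → x = 0 := by
    intro k
    induction k with
    | zero => simp
    | succ k ih => intro h; rw [pow_succ, pow_mul, pow_two] at h; exact ih (EE_sq h)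
  exact this n (pow_eq_zero_of_le Nat.lt_two_pow_self.le hn)
end
end Sally

namespace Sally
section
variable {R : Type*} [CommRing R] {J : Ideal R}

/-- homogeneous element of `SS`. -/
noncomputable def hs (c : ℝ) (x : R) (h : nrm J x ≤ c) : SS J :=
  ⟨MonoidAlgebra.single c x, by
    intro y hy
    rw [MonoidAlgebra.coeff_single, Finsupp.single_apply] at *
    split_ifs at * with h1
    · rwa [← h1]
    · simp at hy⟩

lemma hs_mem_NN {c : ℝ} (hc : 0 < c) {x : R} (h : nrm J x ≤ c) : hs c x h ∈ NN J ↔ nrm J x < c := by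
  rw [mem_NN]
  constructor
  · intro h1
    have := h1 c hc
    simpa [hs] using this
  · intro h1 y hy
    simp only [hs, MonoidAlgebra.coeff_single, Finsupp.single_apply]
    split_ifs with h2
    · rwa [← h2]
    · rwa [nrm_zero]

variable (J) in
noncomputable def cR : R →+* SS J where
  toFun x := hs 1 x (nrm_le_one J x)
  map_one' := rfl
  map_mul' x y := by
    apply Subtype.ext
    change MonoidAlgebra.single 1 (x * y) = MonoidAlgebra.single 1 x * MonoidAlgebra.single 1 y
    rw [MonoidAlgebra.single_mul_single, mul_one]
  map_zero' := by
    apply Subtype.ext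
    exact MonoidAlgebra.single_zero _
  map_add' x y := by
    apply Subtype.ext
    exact MonoidAlgebra.single_add _ _ _

variable {d : ℕ} {a : Fin d → R}

lemma nrm_a_le (a : Fin d → R) (i : Fin d) : nrm (JJ a) (a i) ≤ 1/2 := by
  simpa using nrm_le (JJ a) (x := a i) (n := 1) (by rw [pow_one]; exact Ideal.subset_span (Set.mem_range_self i))

variable (a) in
noncomputable def psi : MvPolynomial (Fin d) R →+* SS (JJ a) :=
  MvPolynomial.eval₂Hom (cR (JJ a)) (fun i => hs (1/2) (a i) (nrm_a_le a i))

lemma psi_coe (p : MvPolynomial (Fin d) R) {M : ℕ} (hp : p.IsHomogeneous M) :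
    (psi a p : MonoidAlgebra R ℝ) = MonoidAlgebra.single ((1/2 : ℝ) ^ M) (p.eval a) := by
  have key : ∀ (s : Fin d →₀ ℕ) (r : R), s.degree = M → (psi a (MvPolynomial.monomial s r) : MonoidAlgebra R ℝ)
      = MonoidAlgebra.single ((1/2 : ℝ) ^ M) ((MvPolynomial.monomial s r).eval a) := by
    intro s r hsM
    rw [psi, MvPolynomial.eval₂Hom_monomial, MvPolynomial.eval_monomial, Subring.coe_mul, Finsupp.prod_fintype _ _ (by simp),
      Finsupp.prod_fintype _ _ (by simp)]
    have : ∀ t : Finset (Fin d), ((∏ i ∈ t, (hs (J := JJ a) (1/2) (a i) (nrm_a_le a i)) ^ s i : SS (JJ a)) : MonoidAlgebra R ℝ)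
        = MonoidAlgebra.single ((1/2 : ℝ) ^ (∑ i ∈ t, s i)) (∏ i ∈ t, a i ^ s i) := by
      intro t
      induction t using Finset.induction_on with
      | empty => simp [MonoidAlgebra.one_def]
      | insert i t hi ih =>
        rw [Finset.prod_insert hi, Finset.sum_insert hi, Finset.prod_insert hi, Subring.coe_mul, ih,
          Subring.coe_pow]
        have : ((hs (J := JJ a) (1/2) (a i) (nrm_a_le a i)).1 : MonoidAlgebra R ℝ) ^ s i
          = MonoidAlgebra.single ((1/2 : ℝ) ^ (s i)) (a i ^ s i) := MonoidAlgebra.single_pow _ _ _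
        rw [this, MonoidAlgebra.single_mul_single, pow_add]
    rw [this]
    have h2 : ((cR (JJ a) r : SS (JJ a)) : MonoidAlgebra R ℝ) = MonoidAlgebra.single 1 r := rfl
    rw [h2, MonoidAlgebra.single_mul_single, one_mul]
    congr 2
    rw [← hsM, Finsupp.degree_eq_sum]
  conv_lhs => rw [p.as_sum]
  conv_rhs => rw [p.as_sum]
  rw [map_sum, map_sum, AddSubmonoidClass.coe_finsetSum]
  refine Eq.trans ?_ (map_sum (MonoidAlgebra.singleAddHom (R := R) ((1/2 : ℝ) ^ M)) _ _).symm
  refine Finset.sum_congr rfl fun s hs => ?_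
  exact key s _ (by
    have := hp (MvPolynomial.mem_support_iff.1 hs)
    rw [← this, Finsupp.degree_eq_weight_one]; rfl)

lemma psi_coeff (p : MvPolynomial (Fin d) R) (c : ℝ) :
    (psi a p : MonoidAlgebra R ℝ).coeff c = ∑ M ∈ Finset.range (p.totalDegree + 1),
      if (1/2 : ℝ) ^ M = c then (MvPolynomial.homogeneousComponent M p).eval a else 0 := by
  conv_lhs => rw [← MvPolynomial.sum_homogeneousComponent p]
  rw [map_sum, AddSubmonoidClass.coe_finsetSum, MonoidAlgebra.coeff_sum, Finsupp.finsetSum_apply]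
  refine Finset.sum_congr rfl fun M _ => ?_
  rw [psi_coe _ (MvPolynomial.homogeneousComponent_isHomogeneous M p), MonoidAlgebra.coeff_single,
    Finsupp.single_apply]

lemma half_pow_inj {M N : ℕ} (h : (1/2 : ℝ) ^ M = (1/2 : ℝ) ^ N) : M = N :=
  pow_right_injective₀ (by norm_num) (by norm_num) h

lemma psi_coeff_pow (p : MvPolynomial (Fin d) R) (M : ℕ) :
    (psi a p : MonoidAlgebra R ℝ).coeff ((1/2 : ℝ) ^ M) = (MvPolynomial.homogeneousComponent M p).eval a := by
  rw [psi_coeff]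
  by_cases hM : M ∈ Finset.range (p.totalDegree + 1)
  · rw [Finset.sum_eq_single M, if_pos rfl]
    · intro b _ hb
      rw [if_neg]
      intro h; exact hb (half_pow_inj h)
    · intro h; exact absurd hM h
  · rw [Finset.sum_eq_zero, MvPolynomial.homogeneousComponent_eq_zero, map_zero]
    · rw [Finset.mem_range] at hM; omega
    · intro b hb
      rw [if_neg]
      intro h; rw [half_pow_inj h] at hb; exact hM hb

lemma psi_coeff_ne (p : MvPolynomial (Fin d) R) {c : ℝ} (h : ∀ M : ℕ, (1/2 : ℝ) ^ M ≠ c) :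
    (psi a p : MonoidAlgebra R ℝ).coeff c = 0 := by
  rw [psi_coeff]
  exact Finset.sum_eq_zero fun M _ => if_neg (h M)

section
variable {m : Ideal R}

lemma QRS.nrm_lt_one (H : QRS a m) {x : R} (hx : x ∈ m) : nrm (JJ a) x < 1 := by
  obtain ⟨c, hc⟩ := H.pow_le
  have h1 : x ^ (c + 1) ∈ JJ a := hc (Ideal.pow_le_pow_right (Nat.le_succ c) (Ideal.pow_mem_pow hx _))
  have h2 := nrm_le (JJ a) (x := x ^ (c + 1)) (n := 1) (by simpa using h1)
  rw [nrm_pow _ _ (by omega)] at h2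
  by_contra h
  push Not at h
  have := one_le_pow₀ h (n := c + 1)
  norm_num at h2
  linarith

lemma QRS.nrm_form_lt (H : QRS a m) {h : MvPolynomial (Fin d) R} {M : ℕ} (hh : h.IsHomogeneous M)
    (hm : CIn m h) : nrm (JJ a) (h.eval a) < (1/2 : ℝ) ^ M := by
  have := eval_mem_mul a hh hm
  refine Submodule.mul_induction_on this ?_ ?_
  · intro x hx y hy
    have h1 := H.nrm_lt_one hx
    have h2 := nrm_le (JJ a) hy
    refine (nrm_mul _ _ _).trans_lt ?_
    calc nrm (JJ a) x * nrm (JJ a) y ≤ nrm (JJ a) x * (1/2 : ℝ) ^ M :=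
          mul_le_mul_of_nonneg_left h2 (nrm_nonneg _ _)
      _ < 1 * (1/2 : ℝ) ^ M := mul_lt_mul_of_pos_right h1 (by positivity)
      _ = _ := one_mul _
  · intro x y hx hy
    exact (nrm_add _ _ _).trans_lt (max_lt hx hy)

lemma psi_mem_NN (H : QRS a m) {p : MvPolynomial (Fin d) R} (hp : CIn m p) : psi a p ∈ NN (JJ a) := by
  rw [mem_NN]
  intro c hc
  by_cases h : ∃ M : ℕ, (1/2 : ℝ) ^ M = c
  · obtain ⟨M, rfl⟩ := h
    rw [psi_coeff_pow]
    refine H.nrm_form_lt (MvPolynomial.homogeneousComponent_isHomogeneous M p) ?_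
    intro s
    rw [MvPolynomial.coeff_homogeneousComponent]
    split_ifs
    · exact hp s
    · exact m.zero_mem
  · push Not at h
    rw [psi_coeff_ne p h, nrm_zero]; exact hc

lemma psi_torsion (H : QRS a m) {p : MvPolynomial (Fin d) R} (hp : ¬ CIn m p) {f : SS (JJ a)}
    (h : psi a p * f ∈ NN (JJ a)) : f ∈ NN (JJ a) := by
  classical
  have hex : ∃ M, ¬ CIn m (MvPolynomial.homogeneousComponent M p) := by
    by_contra hcon
    push Not at hcon
    apply hp
    intro s
    have := hcon s.degree s
    rwa [MvPolynomial.coeff_homogeneousComponent, if_pos rfl] at this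
  let M := Nat.find hex
  have hM := Nat.find_spec hex
  by_contra hf
  obtain ⟨c, hc, h1, h2⟩ := exists_lead hf
  have hl := SS_lead (J := JJ a) (psi a p).2 f.2 (c := (1/2 : ℝ) ^ M) (c' := c) (by positivity) hc ?_ h2 ?_
  · have h3 := (mem_NN.1 h) _ (mul_pos (by positivity : (0:ℝ) < (1/2 : ℝ) ^ M) hc)
    rw [Subring.coe_mul, hl] at h3
    exact lt_irrefl _ h3
  · intro x hx
    have hx0 : 0 < x := lt_trans (by positivity) hx
    by_cases h : ∃ M : ℕ, (1/2 : ℝ) ^ M = x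
    · obtain ⟨M', rfl⟩ := h
      rw [psi_coeff_pow]
      refine H.nrm_form_lt (MvPolynomial.homogeneousComponent_isHomogeneous M' p) ?_
      have : M' < M := by
        by_contra hcon
        push Not at hcon
        exact absurd (pow_le_pow_of_le_one (by norm_num : (0:ℝ) ≤ 1/2) (by norm_num) hcon) (not_le.2 hx)
      by_contra hc2
      exact Nat.find_min hex this hc2
    · push Not at h
      rw [psi_coeff_ne p h, nrm_zero]; exact hx0
  · rw [psi_coeff_pow, H.nrm_form (MvPolynomial.homogeneousComponent_isHomogeneous M p) hM, h1]
end
end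
end Sally

namespace Sally
set_option linter.unusedSectionVars false

section
variable {R : Type*} [CommRing R] (J : Ideal R)

def Vlt (c : ℝ) (hc : 0 < c) : Ideal R where
  carrier := {x | nrm J x < c}
  add_mem' := fun hx hy => (nrm_add J _ _).trans_lt (max_lt hx hy)
  zero_mem' := by simpa [nrm_zero] using hc
  smul_mem' := fun r x hx => by
    refine (nrm_mul J r x).trans_lt ?_
    have := nrm_le_one J r
    have h2 := nrm_nonneg J x
    simp only [Set.mem_ofPred_eq] at hx
    nlinarith

lemma mem_Vlt {c : ℝ} (hc : 0 < c) {x : R} : x ∈ Vlt J c hc ↔ nrm J x < c := Iff.rfl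
lemma mem_Vc {c : ℝ} (hc : 0 ≤ c) {x : R} : x ∈ Vc J c hc ↔ nrm J x ≤ c := Iff.rfl

lemma Vlt_le {c : ℝ} (hc : 0 < c) : Vlt J c hc ≤ Vc J c hc.le := fun x h => (mem_Vc J hc.le).2 ((mem_Vlt J hc).1 h).le

lemma levels (n : ℝ → ℕ∞) (T : Finset ℝ)
    (hT : ∀ t ∈ T, ∃ h : 0 < t, n t ≤ qlen (Vc J t h.le) (Vlt J t h)) :
    ∀ c (hc : 0 ≤ c), (∀ t ∈ T, c < t) → ∑ t ∈ T, n t ≤ ell (Vc J c hc) := by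
  classical
  induction T using Finset.induction_on_min with
  | empty => intro c hc _; simp
  | insert t T ht ih =>
    intro c hc hcT
    obtain ⟨h0, h1⟩ := hT t (Finset.mem_insert_self t T)
    have hn : t ∉ T := fun h => lt_irrefl _ (ht t h)
    rw [Finset.sum_insert hn]
    have h2 := ih (fun s hs => hT s (Finset.mem_insert_of_mem hs)) t h0.le ht
    have h3 : ell (Vlt J t h0) ≤ ell (Vc J c hc) :=
      ell_mono fun x hx => lt_of_le_of_lt hx (hcT t (Finset.mem_insert_self t T))
    rw [ell_eq_add (Vlt_le J h0)] at h3
    refine le_trans ?_ h3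
    rw [add_comm]
    exact add_le_add h2 h1
end

section
variable {R : Type*} [CommRing R] [IsLocalRing R] {d : ℕ} {a : Fin d → R}

lemma mk_cR_zero (H : QRS a (maximalIdeal R)) (x : R) (hx : x ∈ maximalIdeal R) :
    (Ideal.Quotient.mk (NN (JJ a))).comp (cR (JJ a)) x = 0 := by
  rw [RingHom.comp_apply, Ideal.Quotient.eq_zero_iff_mem]
  exact (hs_mem_NN (J := JJ a) one_pos (nrm_le_one _ x)).2 (H.nrm_lt_one hx)

noncomputable def phi0 (H : QRS a (maximalIdeal R)) : ResidueField R →+* EE (JJ a) :=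
  Ideal.Quotient.lift (maximalIdeal R)
      ((Ideal.Quotient.mk (NN (JJ a))).comp (cR (JJ a))) (mk_cR_zero H)

lemma phi0_residue (H : QRS a (maximalIdeal R)) (r : R) :
    phi0 H (residue R r) = Ideal.Quotient.mk (NN (JJ a)) (cR (JJ a) r) :=
  Ideal.Quotient.lift_mk _ _ _

noncomputable def phi (H : QRS a (maximalIdeal R)) :
    MvPolynomial (Fin d) (ResidueField R) →+* EE (JJ a) :=
  MvPolynomial.eval₂Hom (phi0 H)
    (fun i => Ideal.Quotient.mk _ (hs (1/2) (a i) (nrm_a_le a i)))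

lemma phi_map (H : QRS a (maximalIdeal R)) (p : MvPolynomial (Fin d) R) :
    phi H (MvPolynomial.map (residue R) p) = Ideal.Quotient.mk _ (psi a p) := by
  have : (phi H).comp (MvPolynomial.map (residue R)) =
      (Ideal.Quotient.mk (NN (JJ a))).comp (psi a) := by
    apply MvPolynomial.ringHom_ext
    · intro r
      rw [RingHom.comp_apply, MvPolynomial.map_C, RingHom.comp_apply, phi, psi, MvPolynomial.eval₂Hom_C,
        MvPolynomial.eval₂Hom_C]
      exact phi0_residue H r
    · intro i
      rw [RingHom.comp_apply, MvPolynomial.map_X, RingHom.comp_apply, phi, psi, MvPolynomial.eval₂Hom_X',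
        MvPolynomial.eval₂Hom_X']
  exact RingHom.congr_fun this p

lemma map_residue_surj (p : MvPolynomial (Fin d) (ResidueField R)) :
    ∃ q : MvPolynomial (Fin d) R, MvPolynomial.map (residue R) q = p :=
  MvPolynomial.map_surjective _ residue_surjective p

lemma map_residue_zero (p : MvPolynomial (Fin d) R) :
    MvPolynomial.map (residue R) p = 0 ↔ CIn (maximalIdeal R) p := CIn.map_eq.symm

lemma phi_torsion (H : QRS a (maximalIdeal R)) {p : MvPolynomial (Fin d) (ResidueField R)}
    {z : EE (JJ a)} (h : phi H p * z = 0) : p = 0 ∨ z = 0 := by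
  obtain ⟨q, rfl⟩ := map_residue_surj p
  obtain ⟨f, rfl⟩ := Ideal.Quotient.mk_surjective z
  rw [phi_map, ← map_mul, Ideal.Quotient.eq_zero_iff_mem] at h
  rw [map_residue_zero, Ideal.Quotient.eq_zero_iff_mem]
  by_cases hq : CIn (maximalIdeal R) q
  · exact Or.inl hq
  · exact Or.inr (psi_torsion H hq h)

/-- class of a homogeneous element. -/
noncomputable def hc (J : Ideal R) (c : ℝ) (x : R) (h : nrm J x ≤ c) : EE J := Ideal.Quotient.mk _ (hs c x h)

lemma hc_eq_zero {J : Ideal R} {c : ℝ} (hc0 : 0 < c) {x : R} (h : nrm J x ≤ c) :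
    hc J c x h = 0 ↔ nrm J x < c := by
  rw [hc, Ideal.Quotient.eq_zero_iff_mem, hs_mem_NN hc0]

lemma hc_congr {J : Ideal R} {c c' : ℝ} {x x' : R} (h : nrm J x ≤ c) (e1 : c = c') (e2 : x = x') :
    hc J c x h = hc J c' x' (e1 ▸ e2 ▸ h) := by subst e1 e2; rfl

lemma hc_mul {J : Ideal R} {c c' : ℝ} {x x' : R} (h : nrm J x ≤ c) (h' : nrm J x' ≤ c') (hh) :
    hc J c x h * hc J c' x' h' = hc J (c * c') (x * x') hh := by
  rw [hc, hc, hc, ← map_mul]; congr 1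
  apply Subtype.ext
  exact MonoidAlgebra.single_mul_single ..

lemma hc_sum {ι : Type*} {J : Ideal R} {c : ℝ} (s : Finset ι) (x : ι → R) (h : ∀ i, nrm J (x i) ≤ c) (hh) :
    ∑ i ∈ s, hc J c (x i) (h i) = hc J c (∑ i ∈ s, x i) hh := by
  simp only [hc]
  rw [← map_sum]; congr 1
  apply Subtype.ext
  rw [AddSubmonoidClass.coe_finsetSum]
  exact (map_sum (MonoidAlgebra.singleAddHom (R := R) c) _ _).symm

lemma form_nrm {p : MvPolynomial (Fin d) R} {M : ℕ} (hp : p.IsHomogeneous M) {y : R} {c : ℝ}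
    (h : nrm (JJ a) y ≤ c) : nrm (JJ a) (p.eval a * y) ≤ (1/2) ^ M * c := by
  refine (nrm_mul _ _ _).trans (mul_le_mul (nrm_le _ (eval_mem_pow a hp)) h (nrm_nonneg _ _) (by positivity))

lemma phi_form (H : QRS a (maximalIdeal R)) {p : MvPolynomial (Fin d) R} {M : ℕ} (hp : p.IsHomogeneous M) :
    phi H (MvPolynomial.map (residue R) p) = hc (JJ a) ((1/2)^M) (p.eval a) (nrm_le _ (eval_mem_pow a hp)) := by
  rw [phi_map, hc]; congr 1
  apply Subtype.ext
  exact psi_coe p hp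

lemma phi_form_mul (H : QRS a (maximalIdeal R)) {p : MvPolynomial (Fin d) R} {M : ℕ} (hp : p.IsHomogeneous M)
    {y : R} {c : ℝ} (h : nrm (JJ a) y ≤ c) :
    phi H (MvPolynomial.map (residue R) p) * hc (JJ a) c y h = hc (JJ a) ((1/2)^M * c) (p.eval a * y) (form_nrm hp h) := by
  rw [phi_form H hp, hc_mul]

open Classical in
lemma count (hd : 1 ≤ d) (H : QRS a (maximalIdeal R)) {ι : Type*} [Fintype ι] (y : ι → R) (c : ι → ℝ)
    (hc0 : ∀ j, 0 < c j) (hy : ∀ j, nrm (JJ a) (y j) ≤ c j)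
    (hind : ∀ p : ι → MvPolynomial (Fin d) (ResidueField R),
      ∑ j, phi H (p j) * hc (JJ a) (c j) (y j) (hy j) = 0 → ∀ j, p j = 0)
    {e₀ : ℕ} (he : ell (JJ a) = e₀) : Fintype.card ι ≤ e₀ := by
  by_contra hcon
  push Not at hcon
  -- index set
  have key : ∀ P : ℕ, ∀ c' (hc' : 0 ≤ c'), (∀ j, ∀ p < P, c' < (1/2) ^ p * c j) →
      (((∑ p ∈ range P, d.multichoose p) * Fintype.card ι : ℕ) : ℕ∞) ≤ ell (Vc (JJ a) c' hc') := by
    intro P c' hc' hlt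
    let X := (Σ p : Fin P, Mon d p) × ι
    let lev : X → ℝ := fun x => (1/2) ^ (x.1.1 : ℕ) * c x.2
    let T : Finset ℝ := univ.image lev
    let n : ℝ → ℕ∞ := fun t => ((Finset.univ.filter (fun x => lev x = t)).card : ℕ)
    have hcard : (((∑ p ∈ range P, d.multichoose p) * Fintype.card ι : ℕ) : ℕ∞) = ∑ t ∈ T, n t := by
      have := Finset.card_eq_sum_card_image lev (univ : Finset X)
      simp only [n, T]
      rw [← Nat.cast_sum, ← this, Finset.card_univ, Fintype.card_prod, Fintype.card_sigma]
      congr 2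
      rw [Finset.sum_range]
      exact Finset.sum_congr rfl fun i _ => (card_Mon _ _).symm
    rw [hcard]
    refine levels (JJ a) n T ?_ c' hc' ?_
    · intro t ht
      obtain ⟨x0, -, rfl⟩ := Finset.mem_image.1 ht
      have ht0 : 0 < lev x0 := mul_pos (by positivity) (hc0 _)
      refine ⟨ht0, ?_⟩
      set t := lev x0
      have hz : ∀ x : {x // lev x = t}, nrm (JJ a) (mon a x.1.1.2 * y x.1.2) ≤ t := by
        intro x
        have := form_nrm (a := a) (MvPolynomial.isHomogeneous_monomial (1:R) x.1.1.2.degree_exp) (hy x.1.2)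
        exact this.trans (le_of_eq x.2)
      have := le_qlen (A := Vc (JJ a) t ht0.le) (B := Vlt (JJ a) t ht0) (K := maximalIdeal R)
        (ι := {x // lev x = t}) (fun x => mon a x.1.1.2 * y x.1.2) hz ?_
      · rw [ell_maximalIdeal, mul_one, Fintype.card_subtype] at this
        exact this
      · intro r hr
        rw [mem_Vlt] at hr
        let q : ι → MvPolynomial (Fin d) R := fun j => ∑ x : {x // lev x = t},
          if x.1.2 = j then MvPolynomial.monomial x.1.1.2.exp (r x) else 0
        have hrz : ∀ x : {x // lev x = t}, nrm (JJ a) (r x * (mon a x.1.1.2 * y x.1.2)) ≤ t := fun x =>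
          (Vc (JJ a) t ht0.le).mul_mem_left _ (hz x)
        have h0 : ∑ j, phi H (MvPolynomial.map (residue R) (q j)) * hc (JJ a) (c j) (y j) (hy j) = 0 := by
          have : ∑ j, phi H (MvPolynomial.map (residue R) (q j)) * hc (JJ a) (c j) (y j) (hy j)
            = ∑ x : {x // lev x = t}, hc (JJ a) t (r x * (mon a x.1.1.2 * y x.1.2)) (hrz x) := by
            simp only [q, map_sum, Finset.sum_mul]
            rw [Finset.sum_comm]
            refine Finset.sum_congr rfl fun x _ => ?_
            rw [Finset.sum_eq_single x.1.2]
            · rw [if_pos rfl, phi_form_mul H (MvPolynomial.isHomogeneous_monomial _ x.1.1.2.degree_exp)]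
              refine hc_congr _ x.2 ?_
              simp [mon, MvPolynomial.eval_monomial, mul_assoc]
            · intro j _ hj
              rw [if_neg (Ne.symm hj)]; simp
            · simp
          rw [this, hc_sum, hc_eq_zero ht0]
          · exact hr
          · exact hr.le
        have h1 := hind _ h0
        intro x
        have h2 := (map_residue_zero _).1 (h1 x.1.2) x.1.1.2.exp
        have h3 : (q x.1.2).coeff x.1.1.2.exp = r x := by
          simp only [q]
          rw [MvPolynomial.coeff_sum, Finset.sum_eq_single x]
          · simp
          · intro x' _ hx'
            split_ifs with h
            · rw [MvPolynomial.coeff_monomial, if_neg]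
              intro he
              apply hx'
              apply Subtype.ext
              obtain ⟨⟨⟨p, s⟩, j⟩, hl⟩ := x
              obtain ⟨⟨⟨p', s'⟩, j'⟩, hl'⟩ := x'
              simp only at h he
              subst h
              have hpp : p' = p := by
                have := congrArg Finsupp.degree he
                rw [s.degree_exp, s'.degree_exp] at this
                exact Fin.ext this
              subst hpp
              rw [Mon.exp_injective he]
            · simp
          · simp
        rwa [h3] at h2
    · intro t ht
      obtain ⟨x0, -, rfl⟩ := Finset.mem_image.1 ht
      exact hlt _ _ x0.1.1.2
  -- choose D
  have hD : ∃ D : ℕ, ∀ j, (1/2 : ℝ) ^ D < c j := by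
    have : ∀ j, ∃ D : ℕ, (1/2 : ℝ) ^ D < c j := fun j => exists_pow_lt_of_lt_one (hc0 j) (by norm_num)
    choose D hD using this
    refine ⟨∑ j, D j, fun j => lt_of_le_of_lt (pow_le_pow_of_le_one (by norm_num) (by norm_num) ?_) (hD j)⟩
    exact Finset.single_le_sum (f := D) (fun _ _ => Nat.zero_le _) (Finset.mem_univ j)
  obtain ⟨D, hD⟩ := hD
  obtain ⟨P, hP⟩ := multichoose_ratio (d := d + 1) (by omega) (D) hcon
  have h1 := hP P le_rfl
  have h2 := key (P + 1) ((1/2) ^ (P + D + 1)) (by positivity) (by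
    intro j p hp
    have h3 : (1/2 : ℝ) ^ (P + D + 1) ≤ (1/2)^p * (1/2)^D := by
      rw [← pow_add]
      exact pow_le_pow_of_le_one (by norm_num) (by norm_num) (by omega)
    refine h3.trans_lt ?_
    exact mul_lt_mul_of_pos_left (hD j) (by positivity))
  have h4 : ell (Vc (JJ a) ((1/2) ^ (P + D + 1)) (by positivity)) ≤ ell (JJ a ^ (P + D + 1)) :=
    ell_mono (pow_le_V (JJ a) _)
  have h5 := h2.trans h4
  rw [H.ell_pow, he, sum_multichoose, sum_multichoose] at h5
  have h6 : (d + 1).multichoose P * Fintype.card ι ≤ (d+1).multichoose (P + D) * e₀ := by exact_mod_cast h5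
  nlinarith
end
end Sally

namespace Sally
set_option linter.unusedSectionVars false

section
variable {B K Ω : Type*} [CommRing B] [Field K] [CommRing Ω] [Algebra K Ω]

/-- `y` is integral over (the image of) `f`. -/
def II (f : B →+* K) (y : Ω) : Prop := ((algebraMap K Ω).comp f).IsIntegralElem y

lemma II.add {f : B →+* K} {x y : Ω} (hx : II f x) (hy : II f y) : II f (x + y) :=
  RingHom.IsIntegralElem.add _ hx hy
lemma II.neg {f : B →+* K} {x : Ω} (hx : II f x) : II f (-x) :=
  RingHom.IsIntegralElem.neg _ hx
lemma II.mul {f : B →+* K} {x y : Ω} (hx : II f x) (hy : II f y) : II f (x * y) :=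
  RingHom.IsIntegralElem.mul _ hx hy
lemma II.map {f : B →+* K} (b : B) : II f (algebraMap K Ω (f b)) :=
  RingHom.isIntegralElem_map ((algebraMap K Ω).comp f) (x := b)
lemma II.smul {f : B →+* K} (b : B) {x : Ω} (hx : II f x) : II f (f b • x) := by
  rw [Algebra.smul_def]; exact (II.map b).mul hx
lemma II.zero {f : B →+* K} : II f (0 : Ω) := by simpa using II.map (Ω := Ω) (f := f) 0
lemma II.sum {ι : Type*} {f : B →+* K} (s : Finset ι) (x : ι → Ω) (h : ∀ i ∈ s, II f (x i)) :
    II f (∑ i ∈ s, x i) := by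
  classical
  induction s using Finset.induction_on with
  | empty => simpa using II.zero
  | insert i s hi ih =>
    rw [Finset.sum_insert hi]
    exact (h i (Finset.mem_insert_self _ _)).add (ih fun j hj => h j (Finset.mem_insert_of_mem hj))
lemma II.pow {f : B →+* K} {x : Ω} (hx : II f x) (n : ℕ) : II f (x ^ n) := by
  induction n with
  | zero => simpa using II.map (Ω := Ω) (f := f) 1
  | succ n ih => rw [pow_succ]; exact ih.mul hx

/-- coefficients of the minimal polynomial, rescaled. -/
lemma II.minpoly_coeff [Module.Finite K Ω] {f : B →+* K} {y : Ω} {u : K} (hu : u ≠ 0) (h : II f (u • y)) (i : ℕ) :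
    f.IsIntegralElem ((minpoly K y).coeff i * u ^ ((minpoly K y).natDegree - i)) := by
  obtain ⟨p, hp, hpe⟩ := h
  rw [← Polynomial.eval₂_map, ← Polynomial.aeval_def] at hpe
  have h1 : aeval y ((p.map f).scaleRoots u⁻¹) = 0 := by
    have := scaleRoots_aeval_eq_zero (r := u⁻¹) hpe
    rwa [← Algebra.smul_def, smul_smul, inv_mul_cancel₀ hu, one_smul] at this
  have h2 := scaleRoots_dvd _ _ (r := u) (minpoly.dvd K y h1)
  rw [← scaleRoots_mul, inv_mul_cancel₀ hu, scaleRoots_one] at h2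
  let _ := f.toAlgebra
  have hm : ((minpoly K y).scaleRoots u).Monic :=
    (monic_scaleRoots_iff u).2 (minpoly.monic (Algebra.IsIntegral.isIntegral y))
  have h3 := integralClosure.mem_lifts_of_monic_of_dvd_map K hp hm h2
  rw [lifts_iff_coeff_lifts] at h3
  obtain ⟨⟨z, hz⟩, hz'⟩ := h3 i
  rw [coeff_scaleRoots] at hz'
  rw [← hz']
  exact hz

lemma nilp_of_minpoly [Module.Finite K Ω] [IsReduced Ω] {y : Ω}
    (h : ∀ i < (minpoly K y).natDegree, (minpoly K y).coeff i = 0) : y = 0 := by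
  have hm : (minpoly K y).Monic := minpoly.monic (Algebra.IsIntegral.isIntegral y)
  have h1 : minpoly K y = X ^ (minpoly K y).natDegree := by
    ext i
    rw [coeff_X_pow]
    split_ifs with hi
    · rw [hi]; exact hm
    · rcases lt_or_gt_of_ne hi with h2 | h2
      · exact h i h2
      · exact coeff_eq_zero_of_natDegree_lt h2
  have h2 := minpoly.aeval K y
  rw [h1] at h2
  simp only [map_pow, aeval_X] at h2
  exact IsReduced.eq_zero y ⟨_, h2⟩
end

section
variable {F K Ω : Type*} [Field F] [Field K] [CommRing Ω] [Algebra F K] [Algebra K Ω]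

/-- polynomials in `τ`. -/
noncomputable abbrev pp (F : Type*) {K : Type*} [Field F] [Field K] [Algebra F K] (τ : K) : F[X] →+* K := (aeval τ : F[X] →ₐ[F] K)

lemma isFr [Algebra F[X] K] (hinj : ∀ q : F[X], q ≠ 0 → algebraMap F[X] K q ≠ 0)
      (htr : Function.Injective (algebraMap F[X] K))
      (hK : ∀ x : K, ∃ p q : F[X], q ≠ 0 ∧ x * algebraMap F[X] K q = algebraMap F[X] K p) : IsFractionRing F[X] K := by
    refine ⟨?_, ?_, ?_⟩
    · rintro ⟨q, hq⟩
      exact isUnit_iff_ne_zero.2 (hinj q (nonZeroDivisors.ne_zero hq))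
    · intro x
      obtain ⟨p, q, hq, h⟩ := hK x
      exact ⟨(p, ⟨q, mem_nonZeroDivisors_of_ne_zero hq⟩), h⟩
    · intro x y hxy
      exact ⟨1, by rw [htr hxy]⟩

lemma pp_integral {τ : K} (htr : Function.Injective (pp F τ))
    (hK : ∀ x : K, ∃ p q : F[X], q ≠ 0 ∧ x * pp F τ q = pp F τ p) {x : K} (hx : (pp F τ).IsIntegralElem x) :
    ∃ p, pp F τ p = x := by
  let _ := (pp F τ).toAlgebra
  have hma : ∀ p, algebraMap F[X] K p = pp F τ p := fun _ => rfl
  have : IsFractionRing F[X] K := by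
    have hinj : ∀ q, q ≠ 0 → algebraMap F[X] K q ≠ 0 := fun q hq h0 =>
      hq (htr (by rw [map_zero]; exact h0))
    exact isFr hinj htr hK
  exact IsIntegrallyClosed.isIntegral_iff.1 hx
/-- polynomials in `1/τ`, cleared. -/
lemma pp_inv (τ : K) (hτ : τ ≠ 0) (p : F[X]) : ∃ q : F[X], pp F τ⁻¹ p * τ ^ p.natDegree = pp F τ q ∧ q.natDegree ≤ p.natDegree := by
  refine ⟨∑ i ∈ range (p.natDegree + 1), C (p.coeff i) * X ^ (p.natDegree - i), ?_, ?_⟩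
  · change aeval τ⁻¹ p * _ = aeval τ _
    rw [aeval_eq_sum_range, Finset.sum_mul, map_sum]
    refine Finset.sum_congr rfl fun i hi => ?_
    have hi' : i ≤ p.natDegree := by have := Finset.mem_range.1 hi; omega
    rw [map_mul, aeval_C, map_pow, aeval_X, Algebra.smul_def, mul_assoc]
    congr 1
    rw [inv_pow, ← pow_sub_mul_pow τ hi']
    field_simp
  · refine natDegree_sum_le_of_forall_le _ _ fun i _ => ?_
    exact (natDegree_C_mul_X_pow_le _ _).trans (Nat.sub_le _ _)

lemma no_pole {τ : K} (htr : Function.Injective (pp F τ)) {p q : F[X]} {n : ℕ} (hn : 1 ≤ n)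
    (h : pp F τ p * τ ^ n = pp F τ⁻¹ q) : p = 0 := by
  have hτ : τ ≠ 0 := by
    rintro rfl
    have : (X : F[X]) = 0 := htr (by simp)
    exact X_ne_zero this
  obtain ⟨q', h1, h2⟩ := pp_inv τ hτ q
  rw [← h] at h1
  have h3 : p * X ^ (n + q.natDegree) = q' := htr (by
    rw [← h1, map_mul, map_pow, pow_add, mul_assoc]; simp)
  by_contra hp
  have := natDegree_mul_X_pow (n + q.natDegree) hp
  rw [h3] at this
  omega

lemma pp_ne {τ : K} (htr : Function.Injective (pp F τ)) : τ ≠ 0 := by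
  rintro rfl
  have : (X : F[X]) = 0 := htr (by simp)
  exact X_ne_zero this

lemma pp_inv_inj {τ : K} (htr : Function.Injective (pp F τ)) : Function.Injective (pp F τ⁻¹) := by
  have h1 : Transcendental F τ := transcendental_iff_injective.2 htr
  refine transcendental_iff_injective.1 fun h => h1 ?_
  simpa using h.inv

lemma pp_inv_frac {τ : K} (htr : Function.Injective (pp F τ))
    (hK : ∀ x : K, ∃ p q : F[X], q ≠ 0 ∧ x * pp F τ q = pp F τ p) (x : K) :
    ∃ p q : F[X], q ≠ 0 ∧ x * pp F τ⁻¹ q = pp F τ⁻¹ p := by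
  obtain ⟨p, q, hq, h⟩ := hK x
  have hτ := pp_ne htr
  obtain ⟨p', hp', -⟩ := pp_inv τ⁻¹ (inv_ne_zero hτ) p
  obtain ⟨q', hq', -⟩ := pp_inv τ⁻¹ (inv_ne_zero hτ) q
  rw [inv_inv] at hp' hq'
  refine ⟨p' * X ^ q.natDegree, q' * X ^ p.natDegree, ?_, ?_⟩
  · intro h0
    have h1 : q' = 0 := by simpa using h0
    rw [h1, map_zero] at hq'
    have h2 : pp F τ q = 0 := by
      rcases mul_eq_zero.1 hq' with h3 | h3
      · exact h3
      · exact absurd h3 (pow_ne_zero _ (inv_ne_zero hτ))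
    exact hq (htr (by rw [h2, map_zero]))
  · rw [map_mul, map_mul, ← hp', ← hq', ← h]
    simp only [map_pow, RingHom.coe_coe, aeval_X]
    ring

variable (F Ω) in
/-- the filtration by pole order. -/
def XX (τ : K) (n : ℕ) : Set Ω := {y | II (pp F τ) y ∧ II (pp F τ⁻¹) ((τ * τ⁻¹ ^ n) • y)}

lemma XX_zero [Module.Finite K Ω] [IsReduced Ω] {τ : K} (htr : Function.Injective (pp F τ))
    (hK : ∀ x : K, ∃ p q : F[X], q ≠ 0 ∧ x * pp F τ q = pp F τ p)
    {y : Ω} (hy : y ∈ XX F Ω τ 0) : y = 0 := by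
  have hτ := pp_ne htr
  apply nilp_of_minpoly (K := K)
  intro i hi
  obtain ⟨h1, h2⟩ := hy
  have h3 := II.minpoly_coeff (one_ne_zero (α := K)) (y := y) (f := pp F τ) (by simpa using h1) i
  have h4 := II.minpoly_coeff hτ (y := y) (f := pp F τ⁻¹) (by simpa using h2) i
  rw [one_pow, mul_one] at h3
  obtain ⟨p, hp⟩ := pp_integral htr hK h3
  obtain ⟨q, hq⟩ := pp_integral (pp_inv_inj htr) (pp_inv_frac htr hK) h4
  rw [← hp] at hq ⊢
  rw [no_pole htr (Nat.sub_pos_of_lt hi) hq.symm, map_zero]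

end
end Sally

namespace Sally
set_option linter.unusedSectionVars false
section
variable {F K Ω : Type*} [Field F] [Field K] [CommRing Ω] [Algebra F K] [Algebra K Ω]

lemma XX_add {τ : K} {n : ℕ} {x y : Ω} (hx : x ∈ XX F Ω τ n) (hy : y ∈ XX F Ω τ n) : x + y ∈ XX F Ω τ n :=
  ⟨hx.1.add hy.1, by rw [smul_add]; exact hx.2.add hy.2⟩

lemma XX_smul {τ : K} {n : ℕ} {x : Ω} (c : F) (hx : x ∈ XX F Ω τ n) : algebraMap F K c • x ∈ XX F Ω τ n := by
  constructor
  · simpa using hx.1.smul (C c)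
  · rw [smul_comm]; simpa using hx.2.smul (C c)

lemma XX_zero_mem {τ : K} {n : ℕ} : (0 : Ω) ∈ XX F Ω τ n := ⟨II.zero, by rw [smul_zero]; exact II.zero⟩

lemma XX_sum {ι : Type*} {τ : K} {n : ℕ} (s : Finset ι) (x : ι → Ω) (h : ∀ i ∈ s, x i ∈ XX F Ω τ n) :
    ∑ i ∈ s, x i ∈ XX F Ω τ n := by
  classical
  induction s using Finset.induction_on with
  | empty => simpa using XX_zero_mem
  | insert i s hi ih =>
    rw [Finset.sum_insert hi]
    exact XX_add (h i (Finset.mem_insert_self _ _)) (ih fun j hj => h j (Finset.mem_insert_of_mem hj))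

lemma XX_tau {τ : K} (hτ : τ ≠ 0) {n : ℕ} {x : Ω} (m : ℕ) (hx : x ∈ XX F Ω τ n) : τ ^ m • x ∈ XX F Ω τ (n + m) := by
  constructor
  · simpa using hx.1.smul (X ^ m)
  · rw [smul_smul]
    have : τ * τ⁻¹ ^ (n + m) * τ ^ m = τ * τ⁻¹ ^ n := by
      rw [pow_add, mul_assoc, mul_assoc, ← mul_pow, inv_mul_cancel₀ hτ, one_pow, mul_one]
    rw [this]; exact hx.2

lemma XX_div {τ : K} (hτ : τ ≠ 0) {n m : ℕ} {x : Ω} (h : II (pp F τ) x) (hx : τ ^ m • x ∈ XX F Ω τ (n + m)) :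
    x ∈ XX F Ω τ n := by
  refine ⟨h, ?_⟩
  have := hx.2
  rw [smul_smul] at this
  have h2 : τ * τ⁻¹ ^ (n + m) * τ ^ m = τ * τ⁻¹ ^ n := by
    rw [pow_add, mul_assoc, mul_assoc, ← mul_pow, inv_mul_cancel₀ hτ, one_pow, mul_one]
  rwa [h2] at this

lemma XX_mono {τ : K} {n m : ℕ} (h : n ≤ m) {x : Ω} (hx : x ∈ XX F Ω τ n) : x ∈ XX F Ω τ m := by
  refine ⟨hx.1, ?_⟩
  have := hx.2.smul (X ^ (m - n))
  rw [smul_smul] at this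
  have h2 : pp F τ⁻¹ (X ^ (m - n)) * (τ * τ⁻¹ ^ n) = τ * τ⁻¹ ^ m := by
    simp only [map_pow, RingHom.coe_coe, aeval_X]
    rw [← pow_sub_mul_pow τ⁻¹ h]; ring
  rwa [h2] at this

lemma XX_exhaust {τ : K} (hτ : τ ≠ 0) {y : Ω} (h : II (pp F τ) y) : ∃ n, y ∈ XX F Ω τ n := by
  obtain ⟨p, hp, hpe⟩ := h
  let n := ∑ i ∈ range (p.natDegree + 1), (p.coeff i).natDegree
  have hn : ∀ i, (p.coeff i).natDegree ≤ n := by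
    intro i
    by_cases hi : i ∈ range (p.natDegree + 1)
    · exact Finset.single_le_sum (f := fun i => (p.coeff i).natDegree) (fun _ _ => Nat.zero_le _) hi
    · rw [coeff_eq_zero_of_natDegree_lt (by simpa using hi)]; simp
  refine ⟨n + 1, ⟨p, hp, hpe⟩, ?_⟩
  have e1 : τ * τ⁻¹ ^ (n + 1) = τ⁻¹ ^ n := by rw [pow_succ]; field_simp
  rw [e1]
  rw [← Polynomial.eval₂_map, ← Polynomial.aeval_def] at hpe
  have h1 := scaleRoots_aeval_eq_zero (r := τ⁻¹ ^ n) hpe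
  rw [← Algebra.smul_def] at h1
  have hpm : (p.map (pp F τ)).Monic := hp.map _
  have hm : ((p.map (pp F τ)).scaleRoots (τ⁻¹ ^ n)).Monic := (monic_scaleRoots_iff _).2 hpm
  have hl : (p.map (pp F τ)).scaleRoots (τ⁻¹ ^ n) ∈ lifts (pp F τ⁻¹) := by
    rw [lifts_iff_coeff_lifts]
    intro i
    rw [coeff_scaleRoots, hp.natDegree_map, coeff_map]
    by_cases hi : i < p.natDegree
    · obtain ⟨q, hq, -⟩ := pp_inv (F := F) τ⁻¹ (inv_ne_zero hτ) (p.coeff i)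
      rw [inv_inv] at hq
      refine ⟨q * X ^ (n * (p.natDegree - i) - (p.coeff i).natDegree), ?_⟩
      have hle : (p.coeff i).natDegree ≤ n * (p.natDegree - i) :=
        (hn i).trans (Nat.le_mul_of_pos_right n (by omega))
      rw [map_mul, ← hq, map_pow]
      simp only [RingHom.coe_coe, aeval_X]
      rw [mul_assoc, ← pow_add, Nat.add_sub_cancel' hle, pow_mul]
    · by_cases hi2 : i = p.natDegree
      · refine ⟨1, ?_⟩
        rw [hi2, hp.coeff_natDegree]; simp
      · refine ⟨0, ?_⟩
        rw [coeff_eq_zero_of_natDegree_lt (by omega)]; simp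
  obtain ⟨q, hq, -, hqm⟩ := lifts_and_natDegree_eq_and_monic hl hm
  refine ⟨q, hqm, ?_⟩
  rw [← Polynomial.eval₂_map, hq]
  exact h1

lemma dep [Module.Finite K Ω] {τ : K} (htr : Function.Injective (pp F τ))
    (hK : ∀ x : K, ∃ p q : F[X], q ≠ 0 ∧ x * pp F τ q = pp F τ p) {ι : Type*} [Fintype ι]
    (hc : Module.finrank K Ω < Fintype.card ι) {N : ℕ} (z : ι → Ω) (hz : ∀ i, z i ∈ XX F Ω τ (N + 1)) :
    ∃ c : ι → F, (∃ i, c i ≠ 0) ∧ ∑ i, algebraMap F K (c i) • z i ∈ XX F Ω τ N := by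
  classical
  have hτ := pp_ne htr
  have h1 : ¬ LinearIndependent K z := fun h => absurd h.fintype_card_le_finrank (by omega)
  obtain ⟨g, hg, i0, hi0⟩ := Fintype.not_linearIndependent_iff.1 h1
  choose p q hq hpq using fun i => hK (g i)
  -- common denominators
  let Q := ∏ i, q i
  have hQ : pp F τ Q ≠ 0 := by
    intro h
    have : Q = 0 := htr (by rw [h, map_zero])
    exact (Finset.prod_ne_zero_iff.2 fun i _ => hq i) this
  have h2 : ∀ i, ∃ r : F[X], pp F τ r = g i * pp F τ Q := by
    intro i
    refine ⟨p i * ∏ j ∈ univ.erase i, q j, ?_⟩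
    rw [map_mul, ← hpq, mul_assoc, ← map_mul, Finset.mul_prod_erase _ _ (Finset.mem_univ i)]
  choose r hr using h2
  have hsum : ∑ i, pp F τ (r i) • z i = 0 := by
    have := congrArg (fun w => pp F τ Q • w) hg
    simp only [smul_zero, Finset.smul_sum, smul_smul] at this
    rw [← this]
    exact Finset.sum_congr rfl fun i _ => by rw [hr, mul_comm]
  have hr0 : r i0 ≠ 0 := by
    intro h
    have := hr i0
    rw [h, map_zero] at this
    exact (mul_ne_zero hi0 hQ) this.symm
  -- the max degree
  obtain ⟨i1, hi1⟩ := Finset.exists_max_image (univ.filter fun i => r i ≠ 0) (fun i => (r i).natDegree)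
    ⟨i0, by simpa using hr0⟩
  have hi1r : r i1 ≠ 0 := by simpa using hi1.1
  set D := (r i1).natDegree with hD
  have hdeg : ∀ i, (r i).natDegree ≤ D := by
    intro i
    by_cases hi : r i = 0
    · simp [hi]
    · exact hi1.2 i (by simpa using hi)
  refine ⟨fun i => (r i).coeff D, ⟨i1, by simpa [hD] using hi1r⟩, ?_⟩
  have hsplit : ∀ i, ∃ s : F[X], pp F τ (r i) * τ⁻¹ ^ D = algebraMap F K ((r i).coeff D) + τ⁻¹ * pp F τ⁻¹ s := by
    intro i
    refine ⟨∑ k ∈ range D, C ((r i).coeff k) * X ^ (D - 1 - k), ?_⟩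
    have e1 : pp F τ (r i) = ∑ k ∈ range (D + 1), algebraMap F K ((r i).coeff k) * τ ^ k := by
      change aeval τ (r i) = _
      rw [aeval_eq_sum_range' (n := D + 1) (Nat.lt_succ_of_le (hdeg i))]
      exact Finset.sum_congr rfl fun k _ => by rw [Algebra.smul_def]
    rw [e1, Finset.sum_range_succ, add_mul, add_comm]
    congr 1
    · rw [mul_assoc, ← mul_pow, mul_inv_cancel₀ hτ, one_pow, mul_one]
    · rw [map_sum, Finset.sum_mul, Finset.mul_sum]
      refine Finset.sum_congr rfl fun k hk => ?_
      have hk' : k + 1 + (D - 1 - k) = D := by have := Finset.mem_range.1 hk; omega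
      rw [map_mul, map_pow]
      simp only [RingHom.coe_coe, aeval_X, aeval_C]
      conv_lhs => rw [← hk']
      rw [pow_add, pow_succ τ⁻¹ k]
      have e4 : τ ^ k * τ⁻¹ ^ k = 1 := by rw [← mul_pow, mul_inv_cancel₀ hτ, one_pow]
      linear_combination (algebraMap F K ((r i).coeff k) * τ⁻¹ * τ⁻¹ ^ (D - 1 - k)) * e4
  choose s hs using hsplit
  refine ⟨?_, ?_⟩
  · exact II.sum _ _ fun i _ => (XX_smul _ (hz i)).1
  · have e2 : ∑ i, algebraMap F K ((r i).coeff D) • z i = - (τ⁻¹ • ∑ i, pp F τ⁻¹ (s i) • z i) := by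
      rw [eq_neg_iff_add_eq_zero, Finset.smul_sum, ← Finset.sum_add_distrib]
      have : ∑ i, (pp F τ (r i) * τ⁻¹ ^ D) • z i = 0 := by
        have := congrArg (fun w => τ⁻¹ ^ D • w) hsum
        simp only [smul_zero, Finset.smul_sum, smul_smul] at this
        rw [← this]
        exact Finset.sum_congr rfl fun i _ => by rw [mul_comm]
      rw [← this]
      refine Finset.sum_congr rfl fun i _ => ?_
      rw [hs, add_smul, smul_smul]
    rw [e2, smul_neg, smul_smul]
    refine II.neg ?_
    rw [Finset.smul_sum]
    refine II.sum _ _ fun i _ => ?_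
    rw [smul_comm]
    have e3 : τ * τ⁻¹ ^ N * τ⁻¹ = τ * τ⁻¹ ^ (N + 1) := by rw [pow_succ]; ring
    rw [e3]
    exact (hz i).2.smul (s i)

/-- the subring of polynomials in `τ`. -/
noncomputable abbrev PR (F : Type*) {K : Type*} [Field F] [Field K] [Algebra F K] (τ : K) : Subring K := (pp F τ).range

theorem N1 [Module.Finite K Ω] [IsReduced Ω] {τ : K} (htr : Function.Injective (pp F τ))
    (hK : ∀ x : K, ∃ p q : F[X], q ≠ 0 ∧ x * pp F τ q = pp F τ p) :
    ∃ S : Finset Ω, ∀ y : Ω, II (pp F τ) y → y ∈ Submodule.span (PR F τ) (S : Set Ω) := by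
  classical
  by_contra hcon
  push Not at hcon
  have hτ := pp_ne htr
  have h1 : ∀ S : Finset Ω, ∃ n w, w ∈ XX F Ω τ (n + 1) ∧ w ∉ Submodule.span (PR F τ) (S : Set Ω) ∧
      ∀ x ∈ XX F Ω τ n, x ∈ Submodule.span (PR F τ) (S : Set Ω) := by
    intro S
    obtain ⟨y, hy, hyS⟩ := hcon S
    obtain ⟨n0, hn0⟩ := XX_exhaust hτ hy
    have hex : ∃ n, ∃ w ∈ XX F Ω τ n, w ∉ Submodule.span (PR F τ) (S : Set Ω) := ⟨n0, y, hn0, hyS⟩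
    obtain ⟨w, hw, hwS⟩ := Nat.find_spec hex
    have hpos : Nat.find hex ≠ 0 := by
      intro h0
      rw [h0] at hw
      rw [XX_zero htr hK hw] at hwS
      exact hwS (Submodule.zero_mem _)
    obtain ⟨n, hn⟩ := Nat.exists_eq_succ_of_ne_zero hpos
    refine ⟨n, w, by rw [hn] at hw; exact hw, hwS, fun x hx => ?_⟩
    by_contra hxS
    exact Nat.find_min hex (m := n) (by omega) ⟨x, hx, hxS⟩
  choose lev w hw hwS hlow using h1
  let T : ℕ → Finset Ω := fun s => Nat.rec ∅ (fun _ S => insert (w S) S) s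
  have hT : ∀ s, T (s + 1) = insert (w (T s)) (T s) := fun s => rfl
  have hTm : ∀ {s t}, s ≤ t → T s ⊆ T t := by
    intro s t hst
    induction hst with
    | refl => exact subset_rfl
    | step _ ih => exact ih.trans (by rw [hT]; exact Finset.subset_insert _ _)
  have hmem : ∀ {s t}, s < t → w (T s) ∈ T t := by
    intro s t hst
    exact hTm (Nat.succ_le_of_lt hst) (by rw [hT]; exact Finset.mem_insert_self _ _)
  have hlev : ∀ {s t}, s ≤ t → lev (T s) ≤ lev (T t) := by
    intro s t hst
    by_contra hlt
    push Not at hlt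
    have := hlow (T s) (w (T t)) (XX_mono (by omega) (hw (T t)))
    exact hwS (T t) (Submodule.span_mono (by exact_mod_cast hTm hst) this)
  let r := Module.finrank K Ω
  let N := lev (T r)
  let z : Fin (r + 1) → Ω := fun i => τ ^ (N - lev (T i)) • w (T i)
  have hle : ∀ i : Fin (r + 1), lev (T i) ≤ N := fun i => hlev (by omega)
  have hz : ∀ i, z i ∈ XX F Ω τ (N + 1) := by
    intro i
    have := XX_tau hτ (N - lev (T i)) (hw (T i))
    have e : lev (T i) + 1 + (N - lev (T i)) = N + 1 := by have := hle i; omega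
    rwa [e] at this
  obtain ⟨c, hc, hsum⟩ := dep htr hK (by simp [r]) z hz
  obtain ⟨i0, hi0⟩ := Finset.exists_max_image (univ.filter fun i => c i ≠ 0) (fun i => i)
    (by obtain ⟨i, hi⟩ := hc; exact ⟨i, by simpa using hi⟩)
  have hci0 : c i0 ≠ 0 := by simpa using hi0.1
  -- the element v
  let v : Ω := ∑ i ∈ univ.filter (fun i => i ≤ i0), (algebraMap F K (c i) * τ ^ (lev (T i0) - lev (T i))) • w (T i)
  have hv1 : τ ^ (N - lev (T i0)) • v = ∑ i, algebraMap F K (c i) • z i := by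
    rw [← Finset.sum_subset (Finset.filter_subset (fun i => i ≤ i0) univ), Finset.smul_sum]
    · refine Finset.sum_congr rfl fun i hi => ?_
      have hii : i ≤ i0 := by simpa using hi
      have h3 : lev (T i) ≤ lev (T i0) := hlev hii
      have h4 := hle i0
      rw [smul_smul, smul_smul]
      congr 1
      have e : N - lev (T i) = (N - lev (T i0)) + (lev (T i0) - lev (T i)) := by omega
      rw [e, pow_add]; ring
    · intro i _ hi
      have : c i = 0 := by
        by_contra hne
        exact hi (by simpa using hi0.2 i (by simpa using hne))
      rw [this, map_zero, zero_smul]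
  have hvP : II (pp F τ) v := by
    refine II.sum _ _ fun i _ => ?_
    have := (hw (T i)).1.smul (C (c i) * X ^ (lev (T i0) - lev (T i)))
    simpa using this
  have hvX : v ∈ XX F Ω τ (lev (T i0)) := by
    refine XX_div hτ (m := N - lev (T i0)) hvP ?_
    have e : lev (T i0) + (N - lev (T i0)) = N := by have := hle i0; omega
    rw [e, hv1]; exact hsum
  have hvS := hlow _ v hvX
  -- w (T i0) in the span
  apply hwS (T i0)
  have hsm : ∀ (p : F[X]) (x : Ω), x ∈ Submodule.span (PR F τ) (SetLike.coe (T i0.val)) →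
      pp F τ p • x ∈ Submodule.span (PR F τ) (SetLike.coe (T i0.val)) := by
    intro p x hx
    exact Submodule.smul_mem _ (⟨pp F τ p, p, rfl⟩ : PR F τ) hx
  have hv2 : v = algebraMap F K (c i0) • w (T i0) + ∑ i ∈ univ.filter (fun i => i < i0),
      (algebraMap F K (c i) * τ ^ (lev (T i0) - lev (T i))) • w (T i) := by
    have e : univ.filter (fun i => i ≤ i0) = insert i0 (univ.filter (fun i => i < i0)) := by
      ext i; simp [le_iff_eq_or_lt]
    simp only [v]
    rw [e, Finset.sum_insert (by simp)]
    simp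
  have hrest : ∑ i ∈ univ.filter (fun i => i < i0),
      (algebraMap F K (c i) * τ ^ (lev (T i0) - lev (T i))) • w (T i) ∈ Submodule.span (PR F τ) (SetLike.coe (T i0.val)) := by
    refine Submodule.sum_mem _ fun i hi => ?_
    have hii : i < i0 := by simpa using hi
    have := hsm (C (c i) * X ^ (lev (T i0) - lev (T i))) (w (T i)) (Submodule.subset_span (hmem hii))
    simpa using this
  have h5 := Submodule.sub_mem _ hvS hrest
  rw [hv2, add_sub_cancel_right] at h5
  have h6 := hsm (C (c i0)⁻¹) _ h5
  rw [smul_smul] at h6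
  have h7 : pp F τ (C (c i0)⁻¹) * algebraMap F K (c i0) = 1 := by
    simp only [RingHom.coe_coe, aeval_C]
    rw [← map_mul, inv_mul_cancel₀ hci0, map_one]
  rwa [h7, one_smul] at h6
end
end Sally

namespace Sally
set_option linter.unusedSectionVars false
section
variable {k K Ω : Type*} {d : ℕ} [Field k] [Field K] [Algebra (MvPolynomial (Fin d) k) K]
  [IsFractionRing (MvPolynomial (Fin d) k) K] [CommRing Ω] [Algebra K Ω]

/-- fractions with denominator not involving the variable `j`. -/
def WW (k : Type*) (K : Type*) {d : ℕ} [Field k] [Field K] [Algebra (MvPolynomial (Fin d) k) K] (j : Fin d) :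
    Subring K where
  carrier := {x | ∃ b ∈ MvPolynomial.supported k {j}ᶜ, b ≠ 0 ∧ ∃ a : MvPolynomial (Fin d) k,
    algebraMap _ K b * x = algebraMap _ K a}
  mul_mem' := by
    rintro x y ⟨b, hb, hb0, a, h⟩ ⟨b', hb', hb0', a', h'⟩
    refine ⟨b * b', mul_mem hb hb', mul_ne_zero hb0 hb0', a * a', ?_⟩
    rw [map_mul, map_mul, ← h, ← h']; ring
  one_mem' := ⟨1, one_mem _, one_ne_zero, 1, by simp⟩
  add_mem' := by
    rintro x y ⟨b, hb, hb0, a, h⟩ ⟨b', hb', hb0', a', h'⟩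
    refine ⟨b * b', mul_mem hb hb', mul_ne_zero hb0 hb0', b' * a + b * a', ?_⟩
    rw [map_mul, map_add, map_mul, map_mul, ← h, ← h']; ring
  zero_mem' := ⟨1, one_mem _, one_ne_zero, 0, by simp⟩
  neg_mem' := by
    rintro x ⟨b, hb, hb0, a, h⟩
    exact ⟨b, hb, hb0, -a, by rw [map_neg, ← h]; ring⟩

lemma algebraMap_mem_WW (j : Fin d) (a : MvPolynomial (Fin d) k) : algebraMap _ K a ∈ WW k K j :=
  ⟨1, one_mem _, one_ne_zero, a, by simp⟩

lemma WW_inter {x : K} (h : ∀ j : Fin d, x ∈ WW k K j) : ∃ a : MvPolynomial (Fin d) k, algebraMap _ K a = x := by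
  let A := MvPolynomial (Fin d) k
  have hden0 : ((IsFractionRing.den A x : A)) ≠ 0 := nonZeroDivisors.coe_ne_zero _
  have hdvd : ∀ j, ∃ b ∈ MvPolynomial.supported k ({j}ᶜ : Set (Fin d)), b ≠ 0 ∧ (IsFractionRing.den A x : A) ∣ b := by
    intro j
    obtain ⟨b, hb, hb0, a, hab⟩ := h j
    refine ⟨b, hb, hb0, ?_⟩
    refine IsRelPrime.dvd_of_dvd_mul_right (IsFractionRing.num_den_reduced A x).symm ⟨a, ?_⟩
    apply IsFractionRing.injective A K
    rw [map_mul, map_mul, ← hab]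
    have h3 := IsFractionRing.mk'_num_den' A x
    have h4 : algebraMap A K (IsFractionRing.den A x : A) ≠ 0 := by
      rw [Ne, map_eq_zero_iff _ (IsFractionRing.injective A K)]; exact hden0
    rw [div_eq_iff h4] at h3
    rw [h3]; ring
  have hu : IsUnit (IsFractionRing.den A x : A) := by
    have : (IsFractionRing.den A x : A).vars = ∅ := by
      ext j
      simp only [Finset.notMem_empty, iff_false]
      obtain ⟨b, hb, hb0, c, hc⟩ := hdvd j
      rw [MvPolynomial.mem_vars_iff_degreeOf_ne_zero, not_not]
      have hbj : b.degreeOf j = 0 := by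
        by_contra hne
        have := MvPolynomial.mem_supported.1 hb (by exact_mod_cast MvPolynomial.mem_vars_iff_degreeOf_ne_zero.2 hne)
        simp at this
      rw [hc, MvPolynomial.degreeOf_mul_eq hden0 (by rintro rfl; simp at hc; exact hb0 hc)] at hbj
      omega
    rw [MvPolynomial.vars_eq_empty_iff_eq_C] at this
    rw [this]
    have h5 : MvPolynomial.coeff 0 (IsFractionRing.den A x : A) ≠ 0 := by
      intro h0; rw [h0, map_zero] at this; exact hden0 this
    exact (isUnit_iff_ne_zero.2 h5).map (MvPolynomial.C)
  exact IsFractionRing.isInteger_of_isUnit_den hu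

lemma N1j [Module.Finite K Ω] [IsReduced Ω] (j : Fin d) : ∃ S : Finset Ω, ∀ y : Ω,
    II (algebraMap (MvPolynomial (Fin d) k) K) y → y ∈ Submodule.span (WW k K j) (S : Set Ω) := by
  let A := MvPolynomial (Fin d) k
  let Aj := MvPolynomial.supported k ({j}ᶜ : Set (Fin d))
  let F := FractionRing Aj
  have hinj : Function.Injective (algebraMap A K) := IsFractionRing.injective A K
  let g : Aj →+* K := (algebraMap A K).comp (algebraMap Aj A)
  have hg : Function.Injective g := hinj.comp Subtype.val_injective
  let _ : Algebra F K := (IsFractionRing.lift hg).toAlgebra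
  have hst : IsScalarTower Aj F K := IsScalarTower.of_algebraMap_eq fun x => by
    change g x = IsFractionRing.lift hg (algebraMap Aj F x)
    rw [IsFractionRing.lift_algebraMap]
  let τ : K := algebraMap A K (MvPolynomial.X j)
  have htr0 : Transcendental Aj τ := by
    have h1 : Transcendental Aj (MvPolynomial.X j : A) := (MvPolynomial.algebraicIndependent_X (Fin d) k).transcendental_adjoin (s := {j}ᶜ) (i := j) (by simp)
    rintro ⟨p, hp, hpe⟩
    refine h1 ⟨p, hp, ?_⟩
    apply hinj
    rw [map_zero, ← hpe]
    exact (Polynomial.aeval_algebraMap_apply K (MvPolynomial.X j : A) p).symm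
  have htr : Function.Injective (pp F τ) := by
    have : Transcendental F τ := fun h => htr0 ((IsFractionRing.isAlgebraic_iff Aj F K).2 h)
    exact transcendental_iff_injective.1 this
  have hAr : ∀ a : A, ∃ p : F[X], pp F τ p = algebraMap A K a := by
    intro a
    suffices h : a ∈ (pp F τ).range.comap (algebraMap A K) by exact h
    have hF : ∀ b ∈ Aj, b ∈ (pp F τ).range.comap (algebraMap A K) := by
      intro b hb
      refine ⟨C (algebraMap Aj F ⟨b, hb⟩), ?_⟩
      change aeval τ _ = _
      rw [aeval_C, ← IsScalarTower.algebraMap_apply]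
      rfl
    induction a using MvPolynomial.induction_on with
    | C c => exact hF _ (Aj.algebraMap_mem c)
    | add p q hp hq => exact add_mem hp hq
    | mul_X p i hp =>
      refine mul_mem hp ?_
      by_cases hi : i = j
      · subst hi
        exact ⟨X, by change aeval τ X = _; rw [aeval_X]⟩
      · refine hF _ (MvPolynomial.X_mem_supported.2 ?_)
        simpa using hi
  have hK : ∀ x : K, ∃ p q : F[X], q ≠ 0 ∧ x * pp F τ q = pp F τ p := by
    intro x
    obtain ⟨a, b, hb, rfl⟩ := IsFractionRing.div_surjective (A := A) x
    obtain ⟨p, hp⟩ := hAr a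
    obtain ⟨q, hq⟩ := hAr b
    have hb0 : algebraMap A K b ≠ 0 := by
      rw [Ne, map_eq_zero_iff _ hinj]; exact nonZeroDivisors.ne_zero hb
    refine ⟨p, q, ?_, ?_⟩
    · rintro rfl
      rw [map_zero] at hq; exact hb0 hq.symm
    · rw [hp, hq, div_mul_cancel₀ _ hb0]
  obtain ⟨S, hS⟩ := N1 (Ω := Ω) htr hK
  have hFW : ∀ f : F, algebraMap F K f ∈ WW k K j := by
    intro f
    obtain ⟨a, b, hb, rfl⟩ := IsFractionRing.div_surjective (A := Aj) f
    have hb0 : b ≠ 0 := nonZeroDivisors.ne_zero hb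
    refine ⟨b, b.2, fun h => hb0 (Subtype.ext h), a, ?_⟩
    rw [map_div₀, ← IsScalarTower.algebraMap_apply, ← IsScalarTower.algebraMap_apply]
    have h2 : algebraMap Aj K b ≠ 0 := by
      intro h; exact hb0 (hg (by rw [map_zero]; exact h))
    change algebraMap Aj K b * _ = algebraMap Aj K a
    rw [mul_div_cancel₀ _ h2]
  have hPW : PR F τ ≤ WW k K j := by
    rintro _ ⟨p, rfl⟩
    induction p using Polynomial.induction_on' with
    | add p q hp hq => rw [map_add]; exact add_mem hp hq
    | monomial n c =>
      change aeval τ _ ∈ _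
      rw [aeval_monomial]
      exact mul_mem (hFW c) (pow_mem (algebraMap_mem_WW j _) n)
  refine ⟨S, fun y hy => ?_⟩
  have h1 : II (pp F τ) y := by
    obtain ⟨p, hp, hpe⟩ := hy
    have hl : p.map (algebraMap A K) ∈ lifts (pp F τ) := by
      rw [lifts_iff_coeff_lifts]
      intro i
      rw [coeff_map]
      obtain ⟨q, hq⟩ := hAr (p.coeff i)
      exact ⟨q, hq⟩
    obtain ⟨q, hq, -, hqm⟩ := lifts_and_natDegree_eq_and_monic hl (hp.map _)
    refine ⟨q, hqm, ?_⟩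
    rw [← Polynomial.eval₂_map, hq, Polynomial.eval₂_map]
    exact hpe
  have h2 := hS y h1
  refine Submodule.span_induction (p := fun y _ => y ∈ Submodule.span (WW k K j) (S : Set Ω)) ?_ ?_ ?_ ?_ h2
  · intro x hx; exact Submodule.subset_span hx
  · exact Submodule.zero_mem _
  · intro x y _ _ hx hy; exact Submodule.add_mem _ hx hy
  · intro c x _ hx
    exact Submodule.smul_mem _ (⟨c.1, hPW c.2⟩ : WW k K j) hx

/-- finiteness of normalisation over a polynomial ring. -/
lemma N2a [Module.Finite K Ω] [IsReduced Ω] [Algebra (MvPolynomial (Fin d) k) Ω] [IsScalarTower (MvPolynomial (Fin d) k) K Ω]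
    (E : Submodule (MvPolynomial (Fin d) k) Ω) (hE : ∀ y ∈ E, II (algebraMap (MvPolynomial (Fin d) k) K) y) :
    E.FG := by
  classical
  let A := MvPolynomial (Fin d) k
  have hinj : Function.Injective (algebraMap A K) := IsFractionRing.injective A K
  choose S hS using fun j : Fin d => N1j (k := k) (K := K) (Ω := Ω) j
  let b := Module.finBasis K Ω
  let r := Module.finrank K Ω
  -- common denominators
  obtain ⟨h, hh⟩ := IsLocalization.exist_integer_multiples_of_finset (nonZeroDivisors A)
    ((univ.biUnion S).biUnion fun s => univ.image fun i => b.repr s i)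
  have hcoord : ∀ j, ∀ s ∈ S j, ∀ i, algebraMap A K h * b.repr s i ∈ WW k K j := by
    intro j s hs i
    obtain ⟨a, ha⟩ := hh (b.repr s i) (by
      simp only [Finset.mem_biUnion, Finset.mem_image, Finset.mem_univ, true_and]
      exact ⟨s, ⟨j, hs⟩, i, rfl⟩)
    rw [Algebra.smul_def] at ha
    rw [← ha]; exact algebraMap_mem_WW j a
  have hy : ∀ y ∈ E, ∀ i, ∃ a : A, algebraMap A K a = algebraMap A K h * b.repr y i := by
    intro y hy i
    refine WW_inter fun j => ?_
    have := hS j y (hE y hy)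
    refine Submodule.span_induction (p := fun y _ => algebraMap A K h * b.repr y i ∈ WW k K j) ?_ ?_ ?_ ?_ this
    · intro x hx; exact hcoord j x hx i
    · simp
    · intro x y _ _ hx hy
      rw [map_add, Finsupp.add_apply, mul_add]; exact add_mem hx hy
    · intro c x _ hx
      have : b.repr (c • x) i = (c : K) * b.repr x i := by
        have : c • x = (c : K) • x := rfl
        rw [this, map_smul, Finsupp.smul_apply, smul_eq_mul]
      rw [this, mul_left_comm]
      exact mul_mem c.2 hx
  choose f hf using fun (y : E) i => hy y y.2 i
  let φ : E →ₗ[A] (Fin r → A) :=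
    { toFun := fun y i => f y i
      map_add' := by
        intro x y; ext1 i; apply hinj
        simp only [Pi.add_apply, map_add, hf, Submodule.coe_add, Finsupp.add_apply, mul_add]
      map_smul' := by
        intro c x; ext1 i; apply hinj
        simp only [Pi.smul_apply, hf, Submodule.coe_smul, RingHom.id_apply, smul_eq_mul, map_mul]
        rw [← algebraMap_smul K c (x : Ω), map_smul, Finsupp.smul_apply, smul_eq_mul]; ring }
  have hφ : Function.Injective φ := by
    rw [← LinearMap.ker_eq_bot, LinearMap.ker_eq_bot']
    intro y hy0
    apply Subtype.ext
    apply b.repr.injective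
    ext i
    have h1 : f y i = 0 := congrFun hy0 i
    have h2 := hf y i
    rw [h1, map_zero] at h2
    have h3 : algebraMap A K h ≠ 0 := by
      rw [Ne, map_eq_zero_iff _ hinj]; exact nonZeroDivisors.coe_ne_zero _
    simpa [h3] using h2.symm
  exact Module.Finite.iff_fg.1 (Module.Finite.of_injective φ hφ)
end
end Sally

namespace Sally
set_option linter.unusedSectionVars false
section
variable {R : Type*} [CommRing R] {J : Ideal R}

/-- projection to a graded piece. -/
noncomputable def proj (J : Ideal R) (C : ℝ) (hC : 0 < C) : EE J →+ EE J :=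
  QuotientAddGroup.lift (NN J).toAddSubgroup
    { toFun := fun f => Ideal.Quotient.mk (NN J) (hs C (f.1.coeff C) (SS_le f.2 hC.le))
      map_zero' := by
        rw [Ideal.Quotient.eq_zero_iff_mem, hs_mem_NN hC]
        simpa [nrm_zero] using hC
      map_add' := by
        intro f g
        rw [← map_add]; congr 1
        apply Subtype.ext
        change MonoidAlgebra.single _ _ = MonoidAlgebra.single _ _ + MonoidAlgebra.single _ _
        rw [← MonoidAlgebra.single_add]; rfl }
    (by
      intro f hf
      change Ideal.Quotient.mk (NN J) _ = 0
      rw [Ideal.Quotient.eq_zero_iff_mem, hs_mem_NN hC]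
      exact hf C hC)

lemma proj_mk {C : ℝ} (hC : 0 < C) (f : SS J) : proj J C hC (Ideal.Quotient.mk _ f) =
    Ideal.Quotient.mk (NN J) (hs C (f.1.coeff C) (SS_le f.2 hC.le)) := rfl

lemma hc_zero {c : ℝ} (hc0 : 0 < c) (h : nrm J (0 : R) ≤ c) : hc J c 0 h = 0 := by
  rw [hc, Ideal.Quotient.eq_zero_iff_mem, hs_mem_NN hc0, nrm_zero]; exact hc0

lemma hc_add {c : ℝ} {x y : R} (h : nrm J x ≤ c) (h' : nrm J y ≤ c) (hh : nrm J (x + y) ≤ c) :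
    hc J c x h + hc J c y h' = hc J c (x + y) hh := by
  rw [hc, hc, hc, ← map_add]; congr 1
  apply Subtype.ext
  exact (MonoidAlgebra.single_add ..).symm

open Classical in
lemma proj_hc {C : ℝ} (hC : 0 < C) {c : ℝ} {x : R} (h : nrm J x ≤ c) :
    proj J C hC (hc J c x h) = if c = C then hc J c x h else 0 := by
  rw [hc, proj_mk]
  have e : (hs c x h).1.coeff C = if c = C then x else 0 := by
    change (MonoidAlgebra.single c x).coeff C = _
    rw [MonoidAlgebra.coeff_single, Finsupp.single_apply]
  split_ifs with h1
  · subst h1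
    rw [if_pos rfl] at e
    congr 1
    apply Subtype.ext
    change MonoidAlgebra.single _ _ = MonoidAlgebra.single _ _
    rw [e]
  · rw [if_neg h1] at e
    rw [Ideal.Quotient.eq_zero_iff_mem, hs_mem_NN hC, e, nrm_zero]
    exact hC

lemma EE_hc (z : EE J) : ∃ (s : Finset ℝ) (y : ℝ → R) (h : ∀ c, 0 < c → nrm J (y c) ≤ c),
    z = ∑ c ∈ s, if h0 : 0 < c then hc J c (y c) (h c h0) else 0 := by
  classical
  obtain ⟨f, rfl⟩ := Ideal.Quotient.mk_surjective z
  refine ⟨f.1.coeff.support, fun c => f.1.coeff c, fun c hc => SS_le f.2 hc.le, ?_⟩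
  have : f = ∑ c ∈ f.1.coeff.support, if h0 : 0 ≤ c then hs c (f.1.coeff c) (SS_le f.2 h0) else 0 := by
    apply Subtype.ext
    rw [AddSubmonoidClass.coe_finsetSum]
    conv_lhs => rw [← MonoidAlgebra.sum_coeff_single f.1]
    refine Finset.sum_congr rfl fun c hc => ?_
    have hc0 : 0 ≤ c := (nrm_nonneg _ _).trans (f.2 c (by simpa using hc))
    rw [dif_pos hc0]; rfl
  conv_lhs => rw [this]
  rw [map_sum]
  refine Finset.sum_congr rfl fun c hcs => ?_
  have hc0 : 0 ≤ c := (nrm_nonneg _ _).trans (f.2 c (by simpa using hcs))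
  rw [dif_pos hc0]
  split_ifs with h
  · rfl
  · have : c = 0 := le_antisymm (not_lt.1 h) hc0
    subst this
    rw [Ideal.Quotient.eq_zero_iff_mem, mem_NN]
    intro x hx
    change nrm J ((MonoidAlgebra.single 0 _).coeff x) < x
    rw [MonoidAlgebra.coeff_single, Finsupp.single_apply, if_neg hx.ne, nrm_zero]
    exact hx
end
section
variable {R : Type*} [CommRing R] [IsLocalRing R] {d : ℕ} {a : Fin d → R}

lemma homog_lift (p : MvPolynomial (Fin d) (ResidueField R)) (M : ℕ) (hp : p.IsHomogeneous M) :
    ∃ q : MvPolynomial (Fin d) R, q.IsHomogeneous M ∧ MvPolynomial.map (residue R) q = p := by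
  obtain ⟨q, rfl⟩ := map_residue_surj p
  refine ⟨MvPolynomial.homogeneousComponent M q, MvPolynomial.homogeneousComponent_isHomogeneous _ _, ?_⟩
  ext s
  simp only [MvPolynomial.coeff_map, MvPolynomial.coeff_homogeneousComponent]
  split_ifs with h1
  · rfl
  · rw [map_zero, ← MvPolynomial.coeff_map]
    exact (hp.coeff_eq_zero h1).symm

open Classical in
lemma proj_phi (H : QRS a (maximalIdeal R)) {C : ℝ} (hC : 0 < C) (p : MvPolynomial (Fin d) (ResidueField R))
    {c : ℝ} {y : R} (h : nrm (JJ a) y ≤ c) :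
    proj (JJ a) C hC (phi H p * hc (JJ a) c y h) = ∑ M ∈ range (p.totalDegree + 1),
      if (1/2) ^ M * c = C then phi H (MvPolynomial.homogeneousComponent M p) * hc (JJ a) c y h else 0 := by
  conv_lhs => rw [← MvPolynomial.sum_homogeneousComponent p]
  rw [map_sum, Finset.sum_mul, map_sum]
  refine Finset.sum_congr rfl fun M _ => ?_
  obtain ⟨q, hq, hqe⟩ := homog_lift _ M (MvPolynomial.homogeneousComponent_isHomogeneous M p)
  rw [← hqe, phi_form_mul H hq, proj_hc]

lemma rational_nrm (hd : 1 ≤ d) (H : QRS a (maximalIdeal R)) {e₀ : ℕ} (he : ell (JJ a) = e₀) (y : R)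
    (hy : 0 < nrm (JJ a) y) : ∃ q n : ℕ, 1 ≤ q ∧ nrm (JJ a) y ^ q = (1/2) ^ n := by
  classical
  set c := nrm (JJ a) y with hc'
  have hc1 : c ≤ 1 := nrm_le_one _ y
  by_contra hcon
  push Not at hcon
  have hne : ∀ i j : ℕ, ∀ M N : ℕ, i < j → (1/2 : ℝ) ^ M * c ^ i ≠ (1/2) ^ N * c ^ j := by
    intro i j M N hij h
    have h1 : (1/2 : ℝ) ^ M = (1/2) ^ N * c ^ (j - i) := by
      have : c ^ j = c ^ (j - i) * c ^ i := by rw [← pow_add]; congr 1; omega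
      rw [this, ← mul_assoc] at h
      exact mul_right_cancel₀ (pow_pos hy i).ne' h
    have hMN : N ≤ M := by
      by_contra hlt
      have h2 : (1/2 : ℝ) ^ N < (1/2) ^ M := pow_lt_pow_right_of_lt_one₀ (by norm_num) (by norm_num) (by omega)
      have h3 : (1/2 : ℝ) ^ N * c ^ (j - i) ≤ (1/2) ^ N * 1 := by gcongr; exact pow_le_one₀ hy.le hc1
      linarith
    refine hcon (j - i) (M - N) (by omega) ?_
    have : (1/2 : ℝ) ^ M = (1/2) ^ N * (1/2) ^ (M - N) := by rw [← pow_add]; congr 1; omega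
    rw [this] at h1
    exact (mul_left_cancel₀ (by positivity) h1).symm
  have := count hd H (ι := Fin (e₀ + 1)) (fun i => y ^ (i.1 + 1)) (fun i => c ^ (i.1 + 1))
    (fun i => pow_pos hy _) (fun i => (nrm_pow _ y (by omega)).le) ?_ he
  · simp at this
  intro p hp j
  by_contra hpj
  obtain ⟨M, hM⟩ : ∃ M, MvPolynomial.homogeneousComponent M (p j) ≠ 0 := by
    by_contra hall
    push Not at hall
    apply hpj
    rw [← MvPolynomial.sum_homogeneousComponent (p j)]
    exact Finset.sum_eq_zero fun M _ => hall M
  have hMr : M ∈ range ((p j).totalDegree + 1) := by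
    rw [Finset.mem_range]
    by_contra hlt
    exact hM (MvPolynomial.homogeneousComponent_eq_zero M _ (by omega))
  have hC : 0 < (1/2 : ℝ) ^ M * c ^ (j.1 + 1) := by positivity
  have h1 := congrArg (proj (JJ a) _ hC) hp
  rw [map_zero, map_sum, Finset.sum_eq_single j, proj_phi, Finset.sum_eq_single M, if_pos rfl] at h1
  · rcases phi_torsion H h1 with h2 | h2
    · exact hM h2
    · rw [hc_eq_zero (pow_pos hy _), nrm_pow _ y (by omega)] at h2
      exact lt_irrefl _ h2
  · intro N _ hN
    rw [if_neg]
    intro h2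
    exact hN (half_pow_inj (mul_right_cancel₀ (pow_pos hy _).ne' h2))
  · intro h; exact absurd hMr h
  · intro i _ hij
    rw [proj_phi]
    refine Finset.sum_eq_zero fun N _ => if_neg ?_
    intro h2
    rcases lt_trichotomy i.1 j.1 with h3 | h3 | h3
    · exact hne _ _ _ _ (by omega) h2
    · exact hij (Fin.ext h3)
    · exact hne _ _ _ _ (by omega) h2.symm
  · intro h; exact absurd (Finset.mem_univ _) h

lemma hc_one {J : Ideal R} (h : nrm J (1 : R) ≤ 1) : hc J 1 1 h = 1 := by
  rw [hc, ← map_one (Ideal.Quotient.mk (NN J))]; rfl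

lemma hc_pow {J : Ideal R} {c : ℝ} {x : R} (h : nrm J x ≤ c) (n : ℕ) (hh : nrm J (x ^ n) ≤ c ^ n) :
    hc J c x h ^ n = hc J (c ^ n) (x ^ n) hh := by
  have h0 := (nrm_nonneg J x).trans h
  induction n with
  | zero => rw [pow_zero]; exact (hc_one (nrm_le_one J 1)).symm.trans (hc_congr _ (by simp) (by simp))
  | succ n ih =>
    have h2 : nrm J (x ^ n) ≤ c ^ n := by
      rcases Nat.eq_zero_or_pos n with rfl | hn
      · simpa using nrm_le_one J 1
      · rw [nrm_pow _ _ hn]; exact pow_le_pow_left₀ (nrm_nonneg _ _) h n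
    rw [pow_succ, ih h2, hc_mul _ _ (by rw [← pow_succ, ← pow_succ]; exact hh)]
    exact hc_congr _ (pow_succ ..).symm (pow_succ ..).symm

lemma hc_rel [IsNoetherianRing R] (hd : 1 ≤ d) (H : QRS a (maximalIdeal R)) {n : ℕ} {x : R}
    (h : nrm (JJ a) x ≤ (1/2) ^ n) : ∃ (N : ℕ) (q : ℕ → MvPolynomial (Fin d) (ResidueField R)),
      (∀ i ∈ Icc 1 N, (q i).IsHomogeneous (n * i)) ∧
      hc (JJ a) ((1/2)^n) x h ^ N + ∑ i ∈ Icc 1 N, phi H (q i) * hc (JJ a) ((1/2)^n) x h ^ (N - i) = 0 := by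
  obtain ⟨N, hN, b, hb, he⟩ := integral_of_mem_V hd H (x := x) (n := n) ((mem_V _).2 h)
  have hb' : ∀ i ∈ Icc 1 N, ∃ q : MvPolynomial (Fin d) R, q.IsHomogeneous (n * i) ∧ q.eval a = b i := by
    intro i hi
    have := hb i hi
    rw [← pow_mul] at this
    exact (mem_JJ_pow a).1 this
  choose! q hq hqe using hb'
  have hxp : ∀ i, nrm (JJ a) (x ^ i) ≤ ((1/2) ^ n) ^ i := by
    intro i
    rcases Nat.eq_zero_or_pos i with rfl | hi
    · simpa using nrm_le_one _ 1
    · rw [nrm_pow _ _ hi]; exact pow_le_pow_left₀ (nrm_nonneg _ _) h i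
  refine ⟨N, fun i => MvPolynomial.map (residue R) (q i), fun i hi => (hq i hi).map _, ?_⟩
  have hterm : ∀ i ∈ Icc 1 N, nrm (JJ a) (b i * x ^ (N - i)) ≤ ((1/2) ^ n) ^ N := by
    intro i hi
    have hi' := Finset.mem_Icc.1 hi
    rw [← hqe i hi]
    refine (form_nrm (hq i hi) (hxp (N - i))).trans (le_of_eq ?_)
    rw [pow_mul, ← pow_add]; congr 1; omega
  rw [hc_pow h N (hxp N)]
  have e1 : ∀ i ∈ Icc 1 N, phi H (MvPolynomial.map (residue R) (q i)) * hc (JJ a) ((1/2)^n) x h ^ (N - i) =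
      if hi : i ∈ Icc 1 N then hc (JJ a) (((1/2)^n)^N) (b i * x ^ (N - i)) (hterm i hi) else 0 := by
    intro i hi
    have hi' := Finset.mem_Icc.1 hi
    rw [dif_pos hi, hc_pow h _ (hxp _), phi_form_mul H (hq i hi)]
    refine hc_congr _ ?_ (by rw [hqe i hi])
    rw [pow_mul, ← pow_add]; congr 1; omega
  rw [Finset.sum_congr rfl e1, Finset.sum_dite_of_true (fun i hi => hi)]
  have hs1 := hc_sum (J := JJ a) (c := ((1/2)^n)^N) univ (fun i : Icc 1 N => b i * x ^ (N - i.1))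
    (fun i => hterm i i.2) (nrm_sum _ _ _ (by positivity) fun i _ => hterm i i.2)
  rw [← Finset.attach_eq_univ] at hs1
  rw [Finset.univ_eq_attach, hs1]
  have hs2 : ∑ i ∈ (Icc 1 N).attach, b i * x ^ (N - i.1) = ∑ i ∈ Icc 1 N, b i * x ^ (N - i) :=
    Finset.sum_attach (Icc 1 N) (fun i => b i * x ^ (N - i))
  have hs3 : x ^ N + ∑ i ∈ (Icc 1 N).attach, b i * x ^ (N - i.1) = 0 := by rw [hs2]; exact he
  have hs4 : ∑ i ∈ (Icc 1 N).attach, b i * x ^ (N - i.1) = - x ^ N := by linear_combination hs3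
  rw [hc_congr _ rfl hs4, hc_add _ _ (by rw [add_neg_cancel, nrm_zero]; positivity),
    hc_congr _ rfl (add_neg_cancel _)]
  exact hc_zero (by positivity) _


lemma hc_integral [IsNoetherianRing R] (hd : 1 ≤ d) (H : QRS a (maximalIdeal R)) {n : ℕ} {x : R}
    (h : nrm (JJ a) x ≤ (1/2) ^ n) : (phi H).IsIntegralElem (hc (JJ a) ((1/2)^n) x h) := by
  obtain ⟨N, q, hq, he⟩ := hc_rel hd H h
  refine ⟨X ^ N + ∑ i ∈ Icc 1 N, C (q i) * X ^ (N - i), ?_, ?_⟩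
  · apply monic_X_pow_add
    refine (degree_sum_le _ _).trans_lt ?_
    rw [Finset.sup_lt_iff (by exact WithBot.bot_lt_coe _)]
    intro i hi
    refine (degree_C_mul_X_pow_le _ _).trans_lt ?_
    have := Finset.mem_Icc.1 hi
    exact_mod_cast (by omega : N - i < N)
  · rw [eval₂_add, eval₂_pow, eval₂_X, eval₂_finsetSum]
    simp only [eval₂_mul, eval₂_C, eval₂_pow, eval₂_X]
    exact he

lemma EE_integral [IsNoetherianRing R] (hd : 1 ≤ d) (H : QRS a (maximalIdeal R)) {e₀ : ℕ} (he : ell (JJ a) = e₀)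
    (z : EE (JJ a)) : (phi H).IsIntegralElem z := by
  have key : ∀ (c : ℝ) (y : R) (h : nrm (JJ a) y ≤ c), 0 < c → (phi H).IsIntegralElem (hc (JJ a) c y h) := by
    intro c y h h0
    rcases h.lt_or_eq with h1 | h1
    · rw [(hc_eq_zero h0 h).2 h1]; exact RingHom.isIntegralElem_zero _
    · obtain ⟨q, n, hq, hqn⟩ := rational_nrm hd H he y (by rw [h1]; exact h0)
      rw [h1] at hqn
      have h2 : nrm (JJ a) (y ^ q) ≤ (1/2) ^ n := by rw [nrm_pow _ _ hq, h1, hqn]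
      have h3 := hc_integral hd H h2
      have h4 : hc (JJ a) c y h ^ q = hc (JJ a) ((1/2)^n) (y^q) h2 := by
        rw [hc_pow h q (by rw [hqn]; exact h2)]; exact hc_congr _ hqn rfl
      rw [← h4] at h3
      let _ := (phi H).toAlgebra
      exact IsIntegral.of_pow hq h3
  obtain ⟨s, y, h, rfl⟩ := EE_hc z
  classical
  let _ := (phi H).toAlgebra
  refine IsIntegral.sum _ fun c _ => ?_
  split_ifs with h0
  · exact key _ _ _ h0
  · exact isIntegral_zero

end
end Sally

namespace Sally
set_option linter.unusedSectionVars false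
section
variable {R : Type*} [CommRing R] [IsLocalRing R] {d : ℕ} {a : Fin d → R}

/-- polynomial ring over the residue field. -/
abbrev AA (R : Type*) [CommRing R] [IsLocalRing R] (d : ℕ) := MvPolynomial (Fin d) (ResidueField R)
/-- its fraction field. -/
def KK (R : Type*) [CommRing R] [IsLocalRing R] (d : ℕ) : Type _ := FractionRing (AA R d)
noncomputable instance : Field (KK R d) := inferInstanceAs (Field (FractionRing (AA R d)))
noncomputable instance : Algebra (AA R d) (KK R d) := inferInstanceAs (Algebra (AA R d) (FractionRing (AA R d)))
instance : IsFractionRing (AA R d) (KK R d) := inferInstanceAs (IsFractionRing (AA R d) (FractionRing (AA R d)))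

/-- denominators. -/
noncomputable def den (H : QRS a (maximalIdeal R)) : Submonoid (EE (JJ a)) :=
  (nonZeroDivisors (AA R d)).map (phi H)

/-- total localisation. -/
def Om (H : QRS a (maximalIdeal R)) : Type _ := Localization (den H)
noncomputable instance (H : QRS a (maximalIdeal R)) : CommRing (Om H) := inferInstanceAs (CommRing (Localization (den H)))
noncomputable instance (H : QRS a (maximalIdeal R)) : Algebra (EE (JJ a)) (Om H) :=
  inferInstanceAs (Algebra (EE (JJ a)) (Localization (den H)))
instance (H : QRS a (maximalIdeal R)) : IsLocalization (den H) (Om H) :=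
  inferInstanceAs (IsLocalization (den H) (Localization (den H)))

noncomputable def KtoOm (H : QRS a (maximalIdeal R)) : KK R d →+* Om H :=
  IsLocalization.lift (M := nonZeroDivisors (AA R d)) (g := (algebraMap (EE (JJ a)) (Om H)).comp (phi H))
    (fun p => IsLocalization.map_units (Om H) (⟨phi H p, Submonoid.mem_map_of_mem _ p.2⟩ : den H))

noncomputable instance (H : QRS a (maximalIdeal R)) : Algebra (KK R d) (Om H) := (KtoOm H).toAlgebra

lemma KtoOm_alg (H : QRS a (maximalIdeal R)) (p : AA R d) :
    algebraMap (KK R d) (Om H) (algebraMap (AA R d) (KK R d) p) = algebraMap (EE (JJ a)) (Om H) (phi H p) :=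
  IsLocalization.lift_eq _ p

lemma den_le (H : QRS a (maximalIdeal R)) : den H ≤ nonZeroDivisors (EE (JJ a)) := by
  rintro _ ⟨p, hp, rfl⟩
  have hp0 : p ≠ 0 := nonZeroDivisors.ne_zero hp
  rw [mem_nonZeroDivisors_iff]
  constructor
  · intro z hz; exact (phi_torsion H hz).resolve_left hp0
  · intro z hz; rw [mul_comm] at hz; exact (phi_torsion H hz).resolve_left hp0

lemma emb_inj (H : QRS a (maximalIdeal R)) : Function.Injective (algebraMap (EE (JJ a)) (Om H)) :=
  IsLocalization.injective _ (den_le H)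

lemma Om_clear (H : QRS a (maximalIdeal R)) (w : Om H) : ∃ (p : AA R d) (z : EE (JJ a)), p ≠ 0 ∧
    algebraMap (AA R d) (KK R d) p • w = algebraMap (EE (JJ a)) (Om H) z := by
  obtain ⟨z, ⟨q, hq⟩, h⟩ := IsLocalization.exists_mk'_eq (den H) w
  have hq' := hq
  obtain ⟨p, hp, hpq⟩ := hq'
  refine ⟨p, z, nonZeroDivisors.ne_zero hp, ?_⟩
  rw [Algebra.smul_def, KtoOm_alg, hpq, ← h, mul_comm]
  exact IsLocalization.mk'_spec _ _ _

lemma KK_ne {p : AA R d} (hp : p ≠ 0) : algebraMap (AA R d) (KK R d) p ≠ 0 := by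
  rw [Ne, map_eq_zero_iff _ (IsFractionRing.injective _ _)]; exact hp

instance (H : QRS a (maximalIdeal R)) : IsReduced (Om H) := by
  refine ⟨fun w hw => ?_⟩
  obtain ⟨n, hn⟩ := hw
  obtain ⟨p, z, hp, h⟩ := Om_clear H w
  have h1 : (algebraMap (EE (JJ a)) (Om H) z) ^ n = 0 := by rw [← h, _root_.smul_pow, hn, smul_zero]
  rw [← map_pow, map_eq_zero_iff _ (emb_inj H)] at h1
  have h2 : z = 0 := IsReduced.eq_zero z ⟨n, h1⟩
  rw [h2, map_zero] at h
  exact (smul_eq_zero_iff_right (KK_ne hp)).1 h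

lemma Om_finite (hd : 1 ≤ d) (H : QRS a (maximalIdeal R)) {e₀ : ℕ} (he : ell (JJ a) = e₀) :
    Module.Finite (KK R d) (Om H) := by
  classical
  let G : Set (Om H) := {w | ∃ (c : ℝ) (y : R) (h : nrm (JJ a) y ≤ c), 0 < c ∧ w = algebraMap _ (Om H) (hc (JJ a) c y h)}
  have hG : Submodule.span (KK R d) G = ⊤ := by
    rw [eq_top_iff]
    intro w _
    obtain ⟨p, z, hp, h⟩ := Om_clear H w
    have h1 : algebraMap (EE (JJ a)) (Om H) z ∈ Submodule.span (KK R d) G := by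
      obtain ⟨s, y, hy, rfl⟩ := EE_hc z
      rw [map_sum]
      refine Submodule.sum_mem _ fun c _ => ?_
      split_ifs with h0
      · exact Submodule.subset_span ⟨c, y c, hy c h0, h0, rfl⟩
      · rw [map_zero]; exact Submodule.zero_mem _
    have h2 := Submodule.smul_mem _ (algebraMap (AA R d) (KK R d) p)⁻¹ h1
    rwa [← h, smul_smul, inv_mul_cancel₀ (KK_ne hp), one_smul] at h2
  obtain ⟨b, hbG, hbs, hbi⟩ := exists_linearIndependent (KK R d) G
  have hfin : ∀ t : Finset (Om H), (t : Set (Om H)) ⊆ b → t.card ≤ e₀ := by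
    intro t ht
    choose c y h h0 hw using fun w : t => hbG (ht w.2)
    have hti : LinearIndependent (KK R d) (fun w : t => (w : Om H)) :=
      hbi.comp (fun w : t => (⟨w, ht w.2⟩ : b)) (fun x y hxy => Subtype.ext (congrArg (fun u : b => (u : Om H)) hxy))
    have := count hd H (ι := t) y c h0 h ?_ he
    · simpa using this
    intro p hp j
    have h1 := congrArg (algebraMap _ (Om H)) hp
    rw [map_zero, map_sum] at h1
    have h2 := Fintype.linearIndependent_iff.1 hti (fun j => algebraMap (AA R d) (KK R d) (p j)) (by
      rw [← h1]
      refine Finset.sum_congr rfl fun w _ => ?_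
      rw [Algebra.smul_def, KtoOm_alg, map_mul, ← hw]) j
    by_contra hne
    exact KK_ne hne h2
  have hbf : b.Finite := by
    by_contra hinf
    obtain ⟨t, ht, htc⟩ := Set.Infinite.exists_subset_card_eq hinf (e₀ + 1)
    have := hfin t ht
    omega
  rw [hG] at hbs
  exact ⟨⟨hbf.toFinset, by rw [hbf.coe_toFinset]; exact hbs⟩⟩

lemma Om_II [IsNoetherianRing R] (hd : 1 ≤ d) (H : QRS a (maximalIdeal R)) {e₀ : ℕ} (he : ell (JJ a) = e₀) (z : EE (JJ a)) :
    II (algebraMap (AA R d) (KK R d)) (algebraMap _ (Om H) z) := by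
  obtain ⟨p, hp, hpe⟩ := EE_integral hd H he z
  refine ⟨p, hp, ?_⟩
  have h1 : (algebraMap (KK R d) (Om H)).comp (algebraMap (AA R d) (KK R d)) = (algebraMap _ (Om H)).comp (phi H) :=
    RingHom.ext fun q => KtoOm_alg H q
  rw [h1, ← hom_eval₂, hpe, map_zero]

/-- `E` is a finitely generated module with homogeneous generators. -/
theorem EE_fg [IsNoetherianRing R] (hd : 1 ≤ d) (H : QRS a (maximalIdeal R)) {e₀ : ℕ} (he : ell (JJ a) = e₀) :
    ∃ (m : ℕ) (c : Fin m → ℝ) (y : Fin m → R) (h : ∀ j, nrm (JJ a) (y j) ≤ c j), (∀ j, 0 < c j) ∧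
      ∀ z : EE (JJ a), ∃ p : Fin m → AA R d, z = ∑ j, phi H (p j) * hc (JJ a) (c j) (y j) (h j) := by
  classical
  have := Om_finite hd H he
  let _ : Algebra (AA R d) (EE (JJ a)) := (phi H).toAlgebra
  let _ : Algebra (AA R d) (Om H) := ((algebraMap (KK R d) (Om H)).comp (algebraMap (AA R d) (KK R d))).toAlgebra
  have : IsScalarTower (AA R d) (KK R d) (Om H) := IsScalarTower.of_algebraMap_eq fun x => rfl
  let f : EE (JJ a) →ₗ[AA R d] Om H :=
    { toFun := algebraMap _ (Om H)
      map_add' := map_add _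
      map_smul' := by
        intro p z
        rw [Algebra.smul_def, map_mul, RingHom.id_apply, Algebra.smul_def]
        congr 1
        exact (KtoOm_alg H p).symm }
  have hf : Function.Injective f := emb_inj H
  have hfg : (LinearMap.range f).FG := N2a (K := KK R d) _ (by
    rintro _ ⟨z, rfl⟩; exact Om_II hd H he z)
  have hE : (⊤ : Submodule (AA R d) (EE (JJ a))).FG := by
    rw [LinearMap.range_eq_map] at hfg
    exact Submodule.fg_of_fg_map_injective f hf hfg
  obtain ⟨S, hS⟩ := hE
  choose s y h hz using fun z : EE (JJ a) => EE_hc z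
  let ι := {x : EE (JJ a) × ℝ // x ∈ (S ×ˢ (S.biUnion s)) ∧ 0 < x.2}
  have : Finite ι := Set.Finite.to_subtype (s := {x : EE (JJ a) × ℝ | x ∈ (S ×ˢ (S.biUnion s)) ∧ 0 < x.2})
    ((Finset.finite_toSet (S ×ˢ (S.biUnion s))).subset fun x hx => hx.1)
  let _ : Fintype ι := Fintype.ofFinite ι
  let e := Fintype.equivFin ι
  refine ⟨Fintype.card ι, fun j => (e.symm j).1.2, fun j => y (e.symm j).1.1 (e.symm j).1.2,
    fun j => h _ _ (e.symm j).2.2, fun j => (e.symm j).2.2, ?_⟩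
  let g : ι → EE (JJ a) := fun x => hc (JJ a) x.1.2 (y x.1.1 x.1.2) (h _ _ x.2.2)
  have hspan : Submodule.span (AA R d) (Set.range (g ∘ e.symm)) = ⊤ := by
    rw [EquivLike.range_comp g e.symm, eq_top_iff, ← hS, Submodule.span_le]
    intro z hzS
    rw [hz z]
    refine Submodule.sum_mem _ fun c hcs => ?_
    split_ifs with h0
    · refine Submodule.subset_span ⟨⟨(z, c), ?_, h0⟩, rfl⟩
      rw [Finset.mem_product]
      exact ⟨hzS, Finset.mem_biUnion.2 ⟨z, hzS, hcs⟩⟩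
    · exact Submodule.zero_mem _
  intro z
  have hzt : z ∈ Submodule.span (AA R d) (Set.range (g ∘ e.symm)) := by rw [hspan]; trivial
  rw [Submodule.mem_span_range_iff_exists_fun] at hzt
  obtain ⟨p, hp⟩ := hzt
  exact ⟨p, hp.symm⟩
end
end Sally

namespace Sally
set_option linter.unusedSectionVars false
section
variable {R : Type*} [CommRing R] [IsLocalRing R] {d : ℕ} {a : Fin d → R}

theorem P5a [IsNoetherianRing R] (hd : 1 ≤ d) (H : QRS a (maximalIdeal R)) {e₀ : ℕ} (he : ell (JJ a) = e₀) :
    ∃ n₀, ∀ n ≥ n₀, ∀ M, V (JJ a) n ≤ JJ a * V (JJ a) (n - 1) ⊔ V (JJ a) M := by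
  classical
  obtain ⟨m, c, y, h, hc0, hgen⟩ := EE_fg hd H he
  obtain ⟨n₀, hn₀⟩ : ∃ n₀ : ℕ, ∀ j, (1/2 : ℝ) ^ n₀ < c j := by
    choose N hN using fun j => exists_pow_lt_of_lt_one (hc0 j) (by norm_num : (1/2 : ℝ) < 1)
    refine ⟨∑ j, N j, fun j => lt_of_le_of_lt ?_ (hN j)⟩
    exact pow_le_pow_of_le_one (by norm_num) (by norm_num)
      (Finset.single_le_sum (f := N) (fun _ _ => Nat.zero_le _) (Finset.mem_univ j))
  -- one step
  have step : ∀ n ≥ n₀ + 1, ∀ x ∈ V (JJ a) n, 0 < nrm (JJ a) x →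
      (∃ j N, nrm (JJ a) x = (1/2) ^ N * c j) ∧ ∃ w ∈ JJ a * V (JJ a) (n - 1), nrm (JJ a) (x - w) < nrm (JJ a) x := by
    intro n hn x hx hx0
    set C := nrm (JJ a) x with hC
    have hCn : C ≤ (1/2) ^ n := hx
    obtain ⟨p, hp⟩ := hgen (hc (JJ a) C x le_rfl)
    have h1 := congrArg (proj (JJ a) C hx0) hp
    rw [proj_hc, if_pos rfl, map_sum] at h1
    simp only [proj_phi] at h1
    have hlift : ∀ j N, ∃ q : MvPolynomial (Fin d) R, q.IsHomogeneous N ∧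
        MvPolynomial.map (residue R) q = MvPolynomial.homogeneousComponent N (p j) := fun j N =>
      homog_lift _ N (MvPolynomial.homogeneousComponent_isHomogeneous N (p j))
    choose q hq hqe using hlift
    let u : (j : Fin m) × ℕ → R := fun s => if (1/2 : ℝ) ^ s.2 * c s.1 = C then (q s.1 s.2).eval a * y s.1 else 0
    have hu : ∀ s, nrm (JJ a) (u s) ≤ C := by
      intro s
      simp only [u]
      split_ifs with h2
      · rw [← h2]; exact form_nrm (hq _ _) (h _)
      · rw [nrm_zero]; exact hx0.le
    have hterm : ∀ j N, (if (1/2 : ℝ) ^ N * c j = C then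
        phi H (MvPolynomial.homogeneousComponent N (p j)) * hc (JJ a) (c j) (y j) (h j) else 0) =
        hc (JJ a) C (u ⟨j, N⟩) (hu _) := by
      intro j N
      split_ifs with h2
      · rw [← hqe, phi_form_mul H (hq j N)]
        exact hc_congr _ h2 (by simp only [u]; rw [if_pos h2])
      · have : u ⟨j, N⟩ = 0 := by simp only [u]; rw [if_neg h2]
        rw [hc_congr _ rfl this]; exact (hc_zero hx0 _).symm
    simp only [hterm] at h1
    rw [Finset.sum_sigma' univ (fun j => range ((p j).totalDegree + 1)) (fun j N => hc (JJ a) C (u ⟨j, N⟩) (hu _))] at h1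
    have hsumle := nrm_sum (JJ a) (univ.sigma fun j => range ((p j).totalDegree + 1)) u hx0.le (fun s _ => hu s)
    rw [hc_sum _ u hu hsumle] at h1
    set w := ∑ s ∈ univ.sigma (fun j => range ((p j).totalDegree + 1)), u s with hw
    have hwJ : w ∈ JJ a * V (JJ a) (n - 1) := by
      refine Ideal.sum_mem _ fun s _ => ?_
      simp only [u]
      split_ifs with h2
      · have hs : s.2 ≠ 0 := by
          intro h3
          rw [h3, pow_zero, one_mul] at h2
          have := hn₀ s.1
          have h4 : (1/2 : ℝ) ^ n ≤ (1/2) ^ n₀ := pow_le_pow_of_le_one (by norm_num) (by norm_num) (by omega)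
          linarith
        obtain ⟨N, hN⟩ := Nat.exists_eq_succ_of_ne_zero hs
        have h5 : (q s.1 s.2).eval a * y s.1 ∈ JJ a ^ (s.2) * Ideal.span {y s.1} :=
          Ideal.mul_mem_mul (eval_mem_pow a (hq _ _)) (Ideal.mem_span_singleton_self _)
        have h5' : JJ a ^ s.2 * Ideal.span {y s.1} = JJ a * (JJ a ^ N * Ideal.span {y s.1}) := by
          rw [hN, Nat.succ_eq_add_one, pow_succ', mul_assoc]
        rw [h5'] at h5
        refine Ideal.mul_mono_right ?_ h5
        rw [Ideal.mul_le]
        intro r hr z hz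
        obtain ⟨t, rfl⟩ := Ideal.mem_span_singleton'.1 hz
        rw [mem_V]
        have h6 : nrm (JJ a) (r * (t * y s.1)) ≤ (1/2) ^ N * c s.1 := by
          refine (nrm_mul _ _ _).trans (mul_le_mul (nrm_le _ hr) ?_ (nrm_nonneg _ _) (by positivity))
          refine (nrm_mul _ _ _).trans ?_
          have := mul_le_mul (nrm_le_one (JJ a) t) (h s.1) (nrm_nonneg _ _) zero_le_one
          rwa [one_mul] at this
        refine h6.trans ?_
        rw [hN, Nat.succ_eq_add_one, pow_succ] at h2
        have h7 : (1/2 : ℝ) ^ (n - 1) ≥ 2 * (1/2) ^ n := by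
          obtain ⟨n', rfl⟩ := Nat.exists_eq_succ_of_ne_zero (by omega : n ≠ 0)
          simp only [Nat.succ_eq_add_one, Nat.add_sub_cancel, pow_succ]; linarith
        linarith
      · exact Ideal.zero_mem _
    constructor
    · by_contra hno
      push Not at hno
      have : w = 0 := Finset.sum_eq_zero fun s _ => by
        simp only [u]; rw [if_neg]; exact fun h2 => hno _ _ h2.symm
      rw [hc_congr _ rfl this, hc_zero hx0, hc_eq_zero hx0] at h1
      exact lt_irrefl _ h1
    · refine ⟨w, hwJ, ?_⟩
      have h8 : nrm (JJ a) (-w) ≤ C := by rw [nrm_neg]; exact hsumle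
      have h9 : nrm (JJ a) (x + -w) ≤ C := (nrm_add _ _ _).trans (max_le le_rfl h8)
      have h10 : hc (JJ a) C (x + -w) h9 = 0 := by
        rw [← hc_add le_rfl h8, h1, hc_add _ _ (by rw [add_neg_cancel, nrm_zero]; exact hx0.le),
          hc_congr _ rfl (add_neg_cancel w)]
        exact hc_zero hx0 _
      rw [hc_eq_zero hx0] at h10
      rwa [sub_eq_add_neg]
  refine ⟨n₀ + 1, fun n hn M => ?_⟩
  -- finite set of values
  obtain ⟨B, hB⟩ : ∃ B : ℕ, ∀ j, (1/2 : ℝ) ^ B * c j < (1/2) ^ M := by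
    choose N hN using fun j => exists_pow_lt_of_lt_one
      (show (0:ℝ) < (1/2) ^ M / c j from div_pos (by positivity) (hc0 j)) (by norm_num : (1/2 : ℝ) < 1)
    refine ⟨∑ j, N j, fun j => ?_⟩
    have h1 : (1/2 : ℝ) ^ (∑ j, N j) < (1/2) ^ M / c j := lt_of_le_of_lt (pow_le_pow_of_le_one (by norm_num) (by norm_num)
      (Finset.single_le_sum (f := N) (fun _ _ => Nat.zero_le _) (Finset.mem_univ j))) (hN j)
    rwa [lt_div_iff₀ (hc0 j)] at h1
  let S : Finset ℝ := ((univ : Finset (Fin m)) ×ˢ range B).image fun s => (1/2 : ℝ) ^ s.2 * c s.1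
  have main : ∀ k, ∀ x ∈ V (JJ a) n, (S.filter fun s => s ≤ nrm (JJ a) x).card ≤ k →
      x ∈ JJ a * V (JJ a) (n - 1) ⊔ V (JJ a) M := by
    intro k
    induction k with
    | zero =>
      intro x hx hk
      by_cases hM : nrm (JJ a) x ≤ (1/2) ^ M
      · exact Ideal.mem_sup_right hM
      exfalso
      push Not at hM
      obtain ⟨⟨j, N, hN⟩, -⟩ := step n hn x hx (lt_trans (by positivity) hM)
      have hNB : N < B := by
        by_contra hlt
        have h2 : (1/2 : ℝ) ^ N * c j ≤ (1/2) ^ B * c j :=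
          mul_le_mul_of_nonneg_right (pow_le_pow_of_le_one (by norm_num) (by norm_num) (by omega)) (hc0 j).le
        have := hB j
        linarith
      rw [Nat.le_zero, Finset.card_eq_zero] at hk
      have : nrm (JJ a) x ∈ S.filter fun s => s ≤ nrm (JJ a) x := by
        rw [Finset.mem_filter]
        exact ⟨Finset.mem_image.2 ⟨(j, N), by simpa using hNB, hN.symm⟩, le_rfl⟩
      rw [hk] at this
      simp at this
    | succ k ih =>
      intro x hx hk
      by_cases hM : nrm (JJ a) x ≤ (1/2) ^ M
      · exact Ideal.mem_sup_right hM
      push Not at hM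
      obtain ⟨⟨j, N, hN⟩, w, hw, hlt⟩ := step n hn x hx (lt_trans (by positivity) hM)
      have hNB : N < B := by
        by_contra hlt
        have h2 : (1/2 : ℝ) ^ N * c j ≤ (1/2) ^ B * c j :=
          mul_le_mul_of_nonneg_right (pow_le_pow_of_le_one (by norm_num) (by norm_num) (by omega)) (hc0 j).le
        have := hB j
        linarith
      have hmem : nrm (JJ a) x ∈ S.filter fun s => s ≤ nrm (JJ a) x := by
        rw [Finset.mem_filter]
        exact ⟨Finset.mem_image.2 ⟨(j, N), by simpa using hNB, hN.symm⟩, le_rfl⟩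
      have hss : (S.filter fun s => s ≤ nrm (JJ a) (x - w)) ⊂ (S.filter fun s => s ≤ nrm (JJ a) x) := by
        rw [Finset.ssubset_iff_of_subset]
        · exact ⟨_, hmem, by simp only [Finset.mem_filter, not_and, not_le]; exact fun _ => hlt⟩
        · intro s hs
          rw [Finset.mem_filter] at hs ⊢
          exact ⟨hs.1, hs.2.trans hlt.le⟩
      have h3 := ih (x - w) ((mem_V _).2 (hlt.le.trans hx)) (by have := Finset.card_lt_card hss; omega)
      have := Ideal.add_mem _ h3 (Ideal.mem_sup_left hw)
      rwa [sub_add_cancel] at this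
  exact fun x hx => main _ x hx le_rfl
end
end Sally

namespace Sally
set_option linter.unusedSectionVars false
section
variable {R : Type*} [CommRing R]

theorem hat_surj {P : Type*} [CommRing P] (f : P →+* R) (hf : Function.Surjective f) (I : Ideal P)
    (m : Ideal R) (hm : I.map f = m) :
    ∃ F : AdicCompletion I P →+* AdicCompletion m R, Function.Surjective F := by
  classical
  have hle : ∀ n, I ^ n ≤ (m ^ n).comap f := fun n => by
    rw [← Ideal.map_le_iff_le_comap, Ideal.map_pow, hm]
  let g : (n : ℕ) → AdicCompletion I P →+* R ⧸ m ^ n := fun n =>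
    (Ideal.quotientMap (m ^ n) f (hle n)).comp (AdicCompletion.evalₐ I n : AdicCompletion I P →+* P ⧸ I ^ n)
  have hg : ∀ n (x : AdicCompletion.AdicCauchySequence I P),
      g n (AdicCompletion.mk I P x) = Ideal.Quotient.mk _ (f (x n)) := by
    intro n x
    simp only [g, RingHom.coe_comp, Function.comp_apply, RingHom.coe_coe, AdicCompletion.evalₐ_mk]
    rw [Ideal.quotientMap_mk]
  have hcompat : ∀ {k n : ℕ} (hle : k ≤ n), (Ideal.Quotient.factorPow m hle).comp (g n) = g k := by
    intro k n hkn
    ext x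
    induction x using AdicCompletion.induction_on with
    | _ x =>
    rw [RingHom.comp_apply, hg, hg]
    change Ideal.Quotient.mk _ _ = _
    rw [Ideal.Quotient.eq, ← map_sub]
    apply hle k
    have := x.2 hkn
    rw [SModEq.sub_mem, smul_eq_mul, Ideal.mul_top] at this
    rw [← neg_sub]; exact neg_mem this
  refine ⟨AdicCompletion.liftRingHom m g hcompat, fun y => ?_⟩
  induction y using AdicCompletion.induction_on with
  | _ y =>
  have step : ∀ (n : ℕ) (p : P), f p - y n ∈ m ^ n → ∃ q, q - p ∈ I ^ n ∧ f q - y (n+1) ∈ m ^ (n+1) := by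
    intro n p hp
    have h1 : f p - y (n+1) ∈ m ^ n := by
      have := y.2 (Nat.le_succ n)
      rw [SModEq.sub_mem, smul_eq_mul, Ideal.mul_top] at this
      have h2 := add_mem hp this
      rwa [sub_add_sub_cancel] at h2
    have hmn : m ^ n = (I ^ n).map f := by rw [Ideal.map_pow, hm]
    obtain ⟨i, hi, hi'⟩ := (Ideal.mem_map_iff_of_surjective f hf).1 (hmn.le h1)
    exact ⟨p - i, by simpa using hi, by rw [map_sub, hi']; simp⟩
  choose! q hq1 hq2 using step
  let s : ℕ → P := fun n => Nat.rec 0 (fun n p => q n p) n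
  have hs : ∀ n, f (s n) - y n ∈ m ^ n := by
    intro n
    induction n with
    | zero => simp
    | succ n ih => exact hq2 n _ ih
  have hs2 : ∀ n, s (n+1) - s n ∈ I ^ n := fun n => hq1 n _ (hs n)
  refine ⟨AdicCompletion.mk I P (AdicCompletion.AdicCauchySequence.mk I P s (fun n => ?_)), ?_⟩
  · rw [SModEq.sub_mem, smul_eq_mul, Ideal.mul_top, ← neg_sub]; exact neg_mem (hs2 n)
  · apply AdicCompletion.ext_evalₐ
    intro n
    rw [AdicCompletion.evalₐ_liftRingHom, hg, AdicCompletion.evalₐ_mk, Ideal.Quotient.eq]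
    exact hs n

theorem hat_noeth [IsNoetherianRing R] (m : Ideal R) : IsNoetherianRing (AdicCompletion m R) := by
  classical
  obtain ⟨r, g, hg⟩ : ∃ (r : ℕ) (g : Fin r → R), Ideal.span (Set.range g) = m :=
    Submodule.fg_iff_exists_fin_generating_family.1 (IsNoetherian.noetherian m)
  let f : MvPolynomial (Fin r) R →+* R := (MvPolynomial.eval g : MvPolynomial (Fin r) R →+* R)
  have hf : Function.Surjective f := fun x => ⟨MvPolynomial.C x, by simp [f]⟩
  obtain ⟨F, hF⟩ := hat_surj f hf (MvPolynomial.idealOfVars (Fin r) R) m (by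
    rw [MvPolynomial.idealOfVars, Ideal.map_span, ← Set.range_comp, ← hg]
    congr 2; ext i; simp [f])
  have : IsNoetherianRing (AdicCompletion (MvPolynomial.idealOfVars (Fin r) R) (MvPolynomial (Fin r) R)) :=
    isNoetherianRing_of_ringEquiv _ (MvPowerSeries.toAdicCompletionAlgEquiv (Fin r) R).toRingEquiv
  exact isNoetherianRing_of_surjective _ _ F hF


theorem INT {S : Type*} [CommRing S] [IsLocalRing S] [IsNoetherianRing S] (x : S)
    (hx : ∀ n, ∃ c, ∀ s, x ^ s ∈ maximalIdeal S ^ (n * s - c)) : IsNilpotent x := by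
  classical
  by_contra hnil
  obtain ⟨(P : Ideal S), hP, hmax⟩ := set_has_maximal_iff_noetherian.mpr (inferInstance : IsNoetherianRing S)
    {I : Ideal S | Disjoint (I : Set S) (Submonoid.powers x)} ⟨⊥, by
      rw [Set.mem_ofPred_eq, Set.disjoint_left]
      rintro _ h ⟨n, rfl⟩
      exact hnil ⟨n, by simpa using h⟩⟩
  have hmax' : ∀ J : Ideal S, P < J → ∃ k, x ^ k ∈ J := by
    intro J hJ
    by_contra h
    push Not at h
    refine hmax J ?_ hJ
    rw [Set.mem_ofPred_eq, Set.disjoint_left]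
    rintro _ h1 ⟨n, rfl⟩
    exact h n h1
  have hPp : P.IsPrime := Ideal.isPrime_of_maximally_disjoint P (Submonoid.powers x) hP
    (fun J hJ hd => by
      obtain ⟨k, hk⟩ := hmax' J hJ
      exact Set.disjoint_left.1 hd hk ⟨k, rfl⟩)
  have hxP : x ∉ P := fun h => Set.disjoint_left.1 hP h ⟨1, by simp⟩
  obtain ⟨c1, hc1⟩ := hx 1
  have hxm : x ∈ maximalIdeal S := by
    have := hc1 (c1 + 1)
    rw [show 1 * (c1 + 1) - c1 = 1 by omega, pow_one] at this
    exact (maximalIdeal.isMaximal S).isPrime.mem_of_pow_mem _ this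
  -- primes containing `P` properly contain `x`
  have hprime : ∀ Q : Ideal S, Q.IsPrime → P < Q → x ∈ Q := by
    intro Q hQ h
    obtain ⟨k, hk⟩ := hmax' Q h
    exact hQ.mem_of_pow_mem _ hk
  let T := S ⧸ P
  have hPm : P < maximalIdeal S := lt_of_le_of_ne (le_maximalIdeal hPp.ne_top) (fun h => hxP (h ▸ hxm))
  let X : T := Ideal.Quotient.mk P x
  have hX0 : X ≠ 0 := fun h => hxP (Ideal.Quotient.eq_zero_iff_mem.1 h)
  have hTd : IsDomain T := Ideal.Quotient.isDomain P
  have hbp : (⊥ : Ideal T).IsPrime := Ideal.isPrime_bot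
  have hTl : IsLocalRing T := IsLocalRing.of_surjective' (Ideal.Quotient.mk P) Ideal.Quotient.mk_surjective
  have hXp : ∀ Q : Ideal T, Q.IsPrime → Q ≠ ⊥ → X ∈ Q := by
    intro Q hQ h
    have : P ≤ Q.comap (Ideal.Quotient.mk P) := by
      intro y hy; rw [Ideal.mem_comap, Ideal.Quotient.eq_zero_iff_mem.2 hy]; exact Q.zero_mem
    refine hprime (Q.comap (Ideal.Quotient.mk P)) inferInstance (lt_of_le_of_ne this ?_)
    intro h2
    apply h
    rw [eq_bot_iff]
    intro y hy
    obtain ⟨z, rfl⟩ := Ideal.Quotient.mk_surjective y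
    have : z ∈ P := by rw [h2]; exact hy
    simpa using Ideal.Quotient.eq_zero_iff_mem.2 this
  have hXm : X ∈ maximalIdeal T := hXp _ inferInstance (by
    intro h
    have : IsUnit X ∨ X ∈ maximalIdeal T := by
      by_cases hu : IsUnit X
      · exact Or.inl hu
      · exact Or.inr ((mem_maximalIdeal _).2 hu)
    rcases this with hu | hu
    · obtain ⟨y, hy⟩ := hu.exists_right_inv
      obtain ⟨y, rfl⟩ := Ideal.Quotient.mk_surjective y
      have h3 : x * y - 1 ∈ P := by
        rw [← Ideal.Quotient.eq_zero_iff_mem, map_sub, map_mul, map_one]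
        exact sub_eq_zero.2 hy
      have h4 := sub_mem (Ideal.mul_mem_right y _ hxm) (hPm.le h3)
      rw [sub_sub_cancel] at h4
      exact (maximalIdeal.isMaximal S).ne_top ((Ideal.eq_top_iff_one _).2 h4)
    · rw [h] at hu; exact hX0 (by simpa using hu))
  -- the maximal ideal is a minimal prime over `X`
  have hmin : maximalIdeal T ∈ (Ideal.span {X}).minimalPrimes := by
    by_contra hno
    have hfin := Ideal.finite_minimalPrimes_of_isNoetherianRing T (Ideal.span {X})
    have hnot : ¬ ((maximalIdeal T : Set T) ⊆ ⋃ Q ∈ (hfin.toFinset : Set (Ideal T)), (Q : Set T)) := by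
      intro hsub
      rw [Ideal.subset_union_prime (f := fun Q => Q) ⊥ ⊥ (by
        intro Q hQ _ _; exact ((hfin.mem_toFinset).1 hQ).1.1)] at hsub
      obtain ⟨Q, hQ, hle⟩ := hsub
      have hQ' := (hfin.mem_toFinset).1 hQ
      have := hQ'.1.1
      have h5 : Q = maximalIdeal T := le_antisymm (le_maximalIdeal this.ne_top) hle
      exact hno (h5 ▸ hQ')
    rw [Set.not_subset] at hnot
    obtain ⟨y, hy, hyn⟩ := hnot
    simp only [Set.mem_iUnion, not_exists, SetLike.mem_coe, hfin.mem_toFinset] at hyn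
    obtain ⟨Q, hQ, hQm⟩ := Ideal.exists_minimalPrimes_le (I := Ideal.span {y}) (J := maximalIdeal T)
      ((Ideal.span_singleton_le_iff_mem _).2 hy)
    have hQp : Q.IsPrime := hQ.1.1
    have hyQ : y ∈ Q := hQ.1.2 (Ideal.mem_span_singleton_self y)
    have hQ1 := Ideal.height_le_one_of_isPrincipal_of_mem_minimalPrimes _ Q hQ
    have hy0 : y ≠ 0 := by
      rintro rfl
      obtain ⟨Q', hQ', _⟩ := Ideal.exists_minimalPrimes_le (I := Ideal.span {X}) (J := maximalIdeal T)
        ((Ideal.span_singleton_le_iff_mem _).2 hXm)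
      exact hyn Q' hQ' Q'.zero_mem
    have hQ0 : Q ≠ ⊥ := by
      rintro rfl; exact hy0 (by simpa using hyQ)
    obtain ⟨Q', hQ', hle⟩ := Ideal.exists_minimalPrimes_le (I := Ideal.span {X}) (J := Q)
      ((Ideal.span_singleton_le_iff_mem _).2 (hXp Q hQp hQ0))
    have hQ'p : Q'.IsPrime := hQ'.1.1
    have hlt : Q' < Q := lt_of_le_of_ne hle (fun h => hyn Q' hQ' (h ▸ hyQ))
    have hXQ' : X ∈ Q' := hQ'.1.2 (Ideal.mem_span_singleton_self X)
    have hlt0 : (⊥ : Ideal T) < Q' := bot_lt_iff_ne_bot.2 (by rintro rfl; exact hX0 (by simpa using hXQ'))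
    have h1 := Ideal.height_add_one_le_of_lt_of_isPrime hlt
    have h2 := Ideal.height_add_one_le_of_lt_of_isPrime hlt0
    have h3 : ((⊥ : Ideal T).height + 1) + 1 ≤ 1 := le_trans (by gcongr) (h1.trans hQ1)
    have h4 : (1 : ℕ∞) + 1 ≤ 1 := le_trans (by gcongr; exact le_add_self) h3
    exact absurd h4 (by decide)
  have hrad : maximalIdeal T ≤ (Ideal.span {X}).radical := by
    rw [← Ideal.sInf_minimalPrimes]
    refine le_sInf fun Q hQ => ?_
    exact hmin.2 hQ.1 (le_maximalIdeal hQ.1.1.ne_top)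
  obtain ⟨c0, hc0⟩ := Ideal.exists_pow_le_of_le_radical_of_fg hrad (IsNoetherian.noetherian _)
  obtain ⟨c, hc⟩ := hx (c0 + 1)
  set s := c + c0 with hs
  have h1 : X ^ s ∈ maximalIdeal T ^ (c0 * (s + 1)) := by
    have h2 := Ideal.mem_map_of_mem (Ideal.Quotient.mk P) (hc s)
    rw [map_pow, Ideal.map_pow] at h2
    have h3 : (maximalIdeal S).map (Ideal.Quotient.mk P) ≤ maximalIdeal T :=
      le_maximalIdeal (by
        intro h
        have := congrArg (Ideal.comap (Ideal.Quotient.mk P)) h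
        rw [Ideal.comap_map_of_surjective _ Ideal.Quotient.mk_surjective, Ideal.comap_top,
          ← RingHom.ker_eq_comap_bot, Ideal.mk_ker, sup_eq_left.2 hPm.le] at this
        exact (maximalIdeal.isMaximal S).ne_top this)
    refine Ideal.pow_le_pow_right ?_ (Ideal.pow_right_mono h3 _ h2)
    have : (c0 + 1) * s = c0 * (s + 1) + c := by rw [hs]; ring
    omega
  rw [pow_mul] at h1
  have h2 := Ideal.pow_right_mono hc0 _ h1
  rw [Ideal.span_singleton_pow, Ideal.mem_span_singleton] at h2
  obtain ⟨z, hz⟩ := h2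
  have h3 : X ^ s * (X * z - 1) = 0 := by rw [mul_sub, ← mul_assoc, ← pow_succ, ← hz]; ring
  rcases mul_eq_zero.1 h3 with h4 | h4
  · exact hX0 (eq_zero_of_pow_eq_zero h4)
  · exact (mem_maximalIdeal _).1 hXm (IsUnit.of_mul_eq_one z (sub_eq_zero.1 h4))
end
end Sally

namespace Sally
set_option linter.unusedSectionVars false
section
variable {R : Type*} [CommRing R] [IsLocalRing R] [IsNoetherianRing R]

theorem hat_mem_of (x : AdicCompletion (maximalIdeal R) R) (n : ℕ)
    (h : AdicCompletion.evalₐ (maximalIdeal R) n x = 0) :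
    x ∈ maximalIdeal (AdicCompletion (maximalIdeal R) R) ^ n := by
  rw [AdicCompletion.maximalIdeal_eq_map, ← Ideal.map_pow]
  have h1 := AdicCompletion.pow_smul_top_eq_ker_eval (M := R) (n := n) (I := maximalIdeal R)
    (IsNoetherian.noetherian _)
  have h2 : x ∈ (maximalIdeal R ^ n • ⊤ : Submodule R (AdicCompletion (maximalIdeal R) R)) := by
    rw [h1, LinearMap.mem_ker]
    rw [← AdicCompletion.factor_evalₐ_eq_eval _ x (by simp), h, map_zero]
  rw [Ideal.smul_top_eq_map] at h2
  exact h2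

theorem pow_of_mem_V {J : Ideal R} {x : R} {n : ℕ} (h : x ∈ V J (n+1)) : ∃ c, ∀ s, x ^ s ∈ J ^ (n * s - c) := by
  obtain ⟨s₀, hs₀⟩ := nrm_eventually J h (k := 1) le_rfl
  refine ⟨n * s₀, fun s => ?_⟩
  rcases le_or_gt s₀ s with hs | hs
  · refine hs₀ s hs _ ?_
    have : n * s - n * s₀ ≤ n * s := Nat.sub_le _ _
    nlinarith
  · have : n * s - n * s₀ = 0 := Nat.sub_eq_zero_of_le (Nat.mul_le_mul_left _ hs.le)
    rw [this]; simp

theorem chevalley (hR : IsReduced (AdicCompletion (maximalIdeal R) R)) {J : Ideal R} (hJ : J ≤ maximalIdeal R)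
    (t : ℕ) : ∃ M, V J M ≤ maximalIdeal R ^ t := by
  classical
  by_contra hno
  push Not at hno
  set m := maximalIdeal R with hm
  -- stabilization
  have hstab : ∀ k, ∃ N, ∀ M ≥ N, V J N ⊔ m ^ k ≤ V J M ⊔ m ^ k := by
    intro k
    have hart : IsArtinianRing (R ⧸ m ^ k) := by
      rcases Nat.eq_zero_or_pos k with rfl | hk
      · have : Subsingleton (R ⧸ m ^ 0) := by rw [pow_zero, Ideal.one_eq_top]; exact Ideal.Quotient.subsingleton_iff.2 rfl
        infer_instance
      · exact IsLocalRing.quotient_artinian_of_mem_minimalPrimes_of_isLocalRing (m ^ k) ⟨⟨inferInstance, Ideal.pow_le_self hk.ne'⟩,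
          fun Q hQ _ => hQ.1.le_of_pow_le hQ.2⟩
    let f : ℕ →o (Ideal (R ⧸ m ^ k))ᵒᵈ := ⟨fun M => OrderDual.toDual ((V J M).map (Ideal.Quotient.mk (m ^ k))),
      fun i j h => Ideal.map_mono (V_anti J h)⟩
    obtain ⟨N, hN⟩ := IsArtinian.monotone_stabilizes f
    refine ⟨N, fun M hM => ?_⟩
    have h1 : (V J N).map (Ideal.Quotient.mk (m ^ k)) = (V J M).map (Ideal.Quotient.mk (m ^ k)) := hN M hM
    have h2 := congrArg (Ideal.comap (Ideal.Quotient.mk (m ^ k))) h1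
    rw [Ideal.comap_map_of_surjective _ Ideal.Quotient.mk_surjective, ← RingHom.ker_eq_comap_bot, Ideal.mk_ker,
      Ideal.comap_map_of_surjective _ Ideal.Quotient.mk_surjective, ← RingHom.ker_eq_comap_bot, Ideal.mk_ker] at h2
    exact h2.le
  choose N0 hN0 using hstab
  let N : ℕ → ℕ := fun k => k + ∑ i ∈ Finset.range (t + k + 1), N0 i
  have hNN : ∀ k, N0 (t + k) ≤ N k := fun k =>
    (Finset.single_le_sum (f := N0) (fun _ _ => Nat.zero_le _) (Finset.mem_range.2 (by omega : t + k < t + k + 1))).trans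
      (Nat.le_add_left _ _)
  have hNm : ∀ k, N k ≤ N (k+1) := by
    intro k
    simp only [N]
    rw [show t + (k+1) + 1 = (t + k + 1) + 1 by ring, Finset.sum_range_succ _ (t+k+1)]
    omega
  have step : ∀ k x, x ∈ V J (N k) → ∃ y, y ∈ V J (N (k+1)) ∧ y - x ∈ m ^ (t + k) := by
    intro k x hx
    have h1 : x ∈ V J (N (k+1)) ⊔ m ^ (t + k) :=
      hN0 (t+k) _ ((hNN k).trans (hNm k)) (Ideal.mem_sup_left (V_anti J (hNN k) hx))
    obtain ⟨y, hy, z, hz, rfl⟩ := Submodule.mem_sup.1 h1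
    exact ⟨y, hy, by rw [sub_add_cancel_left]; exact neg_mem hz⟩
  obtain ⟨x0, hx0, hx0'⟩ := SetLike.not_le_iff_exists.1 (hno (N 0))
  choose! q hq1 hq2 using step
  let y : ℕ → R := fun n => Nat.rec x0 (fun n p => q n p) n
  have hy : ∀ k, y k ∈ V J (N k) := by
    intro k
    induction k with
    | zero => exact hx0
    | succ k ih => exact hq1 k _ ih
  have hy2 : ∀ k, y (k+1) - y k ∈ m ^ (t + k) := fun k => hq2 k _ (hy k)
  have hy3 : ∀ k, y k - x0 ∈ m ^ t := by
    intro k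
    induction k with
    | zero => simp [y]
    | succ k ih =>
      have := add_mem (Ideal.pow_le_pow_right (Nat.le_add_right t k) (hy2 k)) ih
      rwa [sub_add_sub_cancel] at this
  let X := AdicCompletion.mk m R (AdicCompletion.AdicCauchySequence.mk m R y (fun n => by
    rw [SModEq.sub_mem, smul_eq_mul, Ideal.mul_top, ← neg_sub]
    exact neg_mem (Ideal.pow_le_pow_right (Nat.le_add_left n t) (hy2 n))))
  have hXe : ∀ n, AdicCompletion.evalₐ m n X = Ideal.Quotient.mk (m ^ n) (y n) := fun n => by
    rw [AdicCompletion.evalₐ_mk]; rfl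
  have hX0 : X ≠ 0 := by
    intro h
    have h1 := hXe t
    rw [h, map_zero] at h1
    have h2 : y t ∈ m ^ t := Ideal.Quotient.eq_zero_iff_mem.1 h1.symm
    have h3 := sub_mem h2 (hy3 t)
    rw [sub_sub_cancel] at h3
    exact hx0' h3
  have hnoe := hat_noeth (R := R) m
  refine hX0 ((INT X fun n => ?_).eq_zero)
  obtain ⟨c, hc⟩ := pow_of_mem_V (V_anti J (show n + 1 ≤ N (n+1) by simp only [N]; omega) (hy (n+1)))
  refine ⟨c, fun s => ?_⟩
  set mh := maximalIdeal (AdicCompletion m R) with hmh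
  let Y : AdicCompletion m R := algebraMap R _ (y (n+1))
  have hmm : ∀ k, ∀ z ∈ m ^ k, algebraMap R (AdicCompletion m R) z ∈ mh ^ k := by
    intro k z hz
    rw [hmh, AdicCompletion.maximalIdeal_eq_map, ← Ideal.map_pow]
    exact Ideal.mem_map_of_mem _ hz
  have hZ : X - Y ∈ mh ^ (n+1) := by
    apply hat_mem_of
    rw [map_sub, hXe, sub_eq_zero]
    exact ((AdicCompletion.evalₐ m (n+1)).commutes (y (n+1))).symm
  have hXY : X = Y + (X - Y) := by ring
  rw [hXY, add_pow]
  refine Ideal.sum_mem _ fun i hi => Ideal.mul_mem_right _ _ ?_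
  have hi' : i ≤ s := Nat.lt_succ_iff.1 (Finset.mem_range.1 hi)
  have h1 : Y ^ i ∈ mh ^ (n * i - c) := by
    have := hmm _ _ (Ideal.pow_right_mono hJ _ (hc i))
    rwa [map_pow] at this
  have h2 : (X - Y) ^ (s - i) ∈ mh ^ ((n+1) * (s - i)) := by
    rw [pow_mul]; exact Ideal.pow_mem_pow hZ _
  have h3 := Ideal.mul_mem_mul h1 h2
  rw [← pow_add] at h3
  refine Ideal.pow_le_pow_right ?_ h3
  obtain ⟨j, rfl⟩ := Nat.exists_eq_add_of_le hi'
  rw [Nat.add_sub_cancel_left]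
  have : n * (i + j) = n * i + n * j := by ring
  have : (n+1) * j = n * j + j := by ring
  omega

theorem krull_closure (B : Ideal R) (x : R) (h : ∀ t, x ∈ B ⊔ maximalIdeal R ^ t) : x ∈ B := by
  rw [← Ideal.Quotient.eq_zero_iff_mem]
  refine IsHausdorff.haus (inferInstance : IsHausdorff (maximalIdeal R) (R ⧸ B)) _ fun t => ?_
  rw [SModEq.zero]
  obtain ⟨b, hb, w, hw, rfl⟩ := Submodule.mem_sup.1 (h t)
  rw [map_add, Ideal.Quotient.eq_zero_iff_mem.2 hb, zero_add]
  have : Ideal.Quotient.mk B w = w • (1 : R ⧸ B) := by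
    rw [Algebra.smul_def, mul_one]; rfl
  rw [this]
  exact Submodule.smul_mem_smul hw trivial

variable {d : ℕ} {a : Fin d → R}

/-- the filtration `V` is eventually stable. -/
theorem P5b (hR : IsReduced (AdicCompletion (maximalIdeal R) R)) (hd : 1 ≤ d) (H : QRS a (maximalIdeal R))
    {e₀ : ℕ} (he : ell (JJ a) = e₀) :
    ∃ n₀, ∀ n ≥ n₀, V (JJ a) (n + 1) = JJ a * V (JJ a) n := by
  obtain ⟨n₀, h⟩ := P5a hd H he
  refine ⟨n₀, fun n hn => le_antisymm ?_ ?_⟩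
  · intro x hx
    have h1 : ∀ t, x ∈ JJ a * V (JJ a) n ⊔ maximalIdeal R ^ t := by
      intro t
      obtain ⟨M, hM⟩ := chevalley hR H.le t
      exact sup_le_sup_left hM _ (h (n+1) (by omega) M hx)
    exact krull_closure _ x h1
  · refine (Ideal.mul_mono_left ?_).trans (b := V (JJ a) 1 * V (JJ a) n) ((V_mul _).trans (by rw [add_comm]))
    simpa using pow_le_V (JJ a) 1

end
end Sally

namespace Sally
set_option linter.unusedSectionVars false
section
variable {k K : Type*} {d : ℕ} [Field k] [Field K] [Algebra (MvPolynomial (Fin d) k) K]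
  [IsFractionRing (MvPolynomial (Fin d) k) K]

/-- substitution `T_j ↦ T_j / T_i`. -/
noncomputable def fz (k : Type*) (K : Type*) {d : ℕ} [Field k] [Field K] [Algebra (MvPolynomial (Fin d) k) K]
    (i : Fin d) : MvPolynomial (Fin d) k →+* K :=
  MvPolynomial.eval₂Hom ((algebraMap (MvPolynomial (Fin d) k) K).comp MvPolynomial.C)
    (fun j => algebraMap (MvPolynomial (Fin d) k) K (MvPolynomial.X j) / algebraMap (MvPolynomial (Fin d) k) K (MvPolynomial.X i))

lemma algX_ne (i : Fin d) : algebraMap (MvPolynomial (Fin d) k) K (MvPolynomial.X i) ≠ 0 := by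
  rw [Ne, map_eq_zero_iff _ (IsFractionRing.injective _ _)]; exact MvPolynomial.X_ne_zero i

lemma fz_mul (i : Fin d) (p : MvPolynomial (Fin d) k) (M : ℕ) (hM : p.totalDegree ≤ M) :
    fz k K i p * algebraMap (MvPolynomial (Fin d) k) K (MvPolynomial.X i) ^ M =
      algebraMap (MvPolynomial (Fin d) k) K (∑ s ∈ p.support, MvPolynomial.monomial s (p.coeff s) *
        MvPolynomial.X i ^ (M - s.degree)) := by
  have hy := algX_ne (k := k) (K := K) i
  rw [fz, MvPolynomial.coe_eval₂Hom, MvPolynomial.eval₂_eq', Finset.sum_mul, map_sum]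
  refine Finset.sum_congr rfl fun s hs => ?_
  have hs' : s.degree ≤ M := by
    refine le_trans ?_ hM
    exact (MvPolynomial.le_totalDegree hs)
  rw [map_mul, map_pow, MvPolynomial.monomial_eq, map_mul, Finsupp.prod_fintype _ _ (fun _ => pow_zero _), map_prod]
  simp only [map_pow, div_pow, Finset.prod_div_distrib, Finset.prod_pow_eq_pow_sum]
  have e : ∑ j, s j = s.degree := (Finsupp.degree_eq_sum s).symm
  rw [e]
  have : algebraMap (MvPolynomial (Fin d) k) K (MvPolynomial.X i) ^ M =
    algebraMap (MvPolynomial (Fin d) k) K (MvPolynomial.X i) ^ (M - s.degree) *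
      algebraMap (MvPolynomial (Fin d) k) K (MvPolynomial.X i) ^ s.degree := by
    rw [← pow_add]; congr 1; omega
  rw [this, RingHom.comp_apply]
  field_simp

lemma fz_homog (i : Fin d) (p : MvPolynomial (Fin d) k) (M : ℕ) (hM : p.IsHomogeneous M) :
    fz k K i p * algebraMap (MvPolynomial (Fin d) k) K (MvPolynomial.X i) ^ M =
      algebraMap (MvPolynomial (Fin d) k) K p := by
  rw [fz_mul i p M hM.totalDegree_le]
  congr 1
  conv_rhs => rw [p.as_sum]
  refine Finset.sum_congr rfl fun s hs => ?_
  have : s.degree = M := by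
    have := hM (MvPolynomial.mem_support_iff.1 hs)
    rwa [Finsupp.degree_eq_weight_one]
  rw [this]; simp

lemma fz_clear (i : Fin d) (p : MvPolynomial (Fin d) k) (M : ℕ) (hM : p.totalDegree ≤ M) :
    ∃ q : MvPolynomial (Fin d) k, q.totalDegree ≤ M ∧
    fz k K i p * algebraMap (MvPolynomial (Fin d) k) K (MvPolynomial.X i) ^ M =
      algebraMap (MvPolynomial (Fin d) k) K q := by
  refine ⟨_, ?_, fz_mul i p M hM⟩
  apply MvPolynomial.totalDegree_finsetSum_le
  intro s hs
  refine (MvPolynomial.totalDegree_mul _ _).trans ?_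
  have h1 := MvPolynomial.totalDegree_monomial_le s (p.coeff s)
  rw [MvPolynomial.totalDegree_X_pow]
  have hs' : s.degree ≤ M := (MvPolynomial.le_totalDegree hs).trans hM
  have h2 : (s.sum fun _ => id) = s.degree := rfl
  omega

lemma fz_not_int (i : Fin d) (p : MvPolynomial (Fin d) k)
    (h : (fz k K i).IsIntegralElem (algebraMap (MvPolynomial (Fin d) k) K p)) : p.totalDegree = 0 := by
  classical
  by_contra hD
  have hp0 : p ≠ 0 := by rintro rfl; simp at hD
  obtain ⟨P, hP, he⟩ := h
  set r := P.natDegree with hr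
  let M := ∑ l ∈ range (r+1), (P.coeff l).totalDegree
  have hM : ∀ l ∈ range (r+1), (P.coeff l).totalDegree ≤ M := fun l hl =>
    Finset.single_le_sum (f := fun l => (P.coeff l).totalDegree) (fun _ _ => Nat.zero_le _) hl
  have hcl : ∀ l ∈ range (r+1), _ := fun l hl => fz_clear (K := K) i (P.coeff l) M (hM l hl)
  choose! q hq1 hq2 using hcl
  rw [eval₂_eq_sum_range, Finset.sum_range_succ, ← hr] at he
  have hlead : P.coeff r = 1 := hP
  have h1 : algebraMap (MvPolynomial (Fin d) k) K (∑ l ∈ range r, q l * p ^ l + MvPolynomial.X i ^ M * p ^ r) = 0 := by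
    rw [map_add, map_sum]
    have := congrArg (fun z => z * algebraMap (MvPolynomial (Fin d) k) K (MvPolynomial.X i) ^ M) he
    simp only [zero_mul, add_mul, Finset.sum_mul, hlead, map_one, one_mul] at this
    rw [← this]
    congr 1
    · refine Finset.sum_congr rfl fun l hl => ?_
      rw [map_mul, ← hq2 l (by simp at hl ⊢; omega), map_pow]; ring
    · rw [map_mul, map_pow, map_pow]; ring
  rw [map_eq_zero_iff _ (IsFractionRing.injective _ _), add_eq_zero_iff_eq_neg] at h1
  have h2 := congrArg MvPolynomial.totalDegree h1
  have hX : (MvPolynomial.X i : MvPolynomial (Fin d) k) ^ M ≠ 0 := pow_ne_zero _ (MvPolynomial.X_ne_zero i)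
  have hpw : ∀ l, (p ^ l).totalDegree = l * p.totalDegree := by
    intro l
    induction l with
    | zero => simp
    | succ l ih => rw [pow_succ, MvPolynomial.totalDegree_mul_of_isDomain (pow_ne_zero _ hp0) hp0, ih]; ring
  rw [MvPolynomial.totalDegree_neg, MvPolynomial.totalDegree_mul_of_isDomain hX (pow_ne_zero _ hp0),
    MvPolynomial.totalDegree_X_pow, hpw] at h2
  rcases Nat.eq_zero_or_pos r with hr0 | hr0
  · rw [hr0] at h1; simp at h1
  have h3 : (∑ l ∈ range r, q l * p ^ l).totalDegree ≤ M + (r - 1) * p.totalDegree := by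
    apply MvPolynomial.totalDegree_finsetSum_le
    intro l hl
    refine (MvPolynomial.totalDegree_mul _ _).trans ?_
    rw [hpw]
    have hl' := Finset.mem_range.1 hl
    exact add_le_add (hq1 l (by simp; omega)) (Nat.mul_le_mul_right _ (by omega))
  rw [h2] at h3
  have : r * p.totalDegree = (r-1) * p.totalDegree + p.totalDegree := by
    obtain ⟨r', hr'⟩ := Nat.exists_eq_succ_of_ne_zero hr0.ne'
    rw [hr']; simp [Nat.succ_mul]
  omega

lemma alg_of_two {i j : Fin d} (hij : i ≠ j) (s : ℕ) (x : K)
    (hi : ∃ p : MvPolynomial (Fin d) k, x * algebraMap (MvPolynomial (Fin d) k) K (MvPolynomial.X i) ^ s = algebraMap _ K p)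
    (hj : ∃ p : MvPolynomial (Fin d) k, x * algebraMap (MvPolynomial (Fin d) k) K (MvPolynomial.X j) ^ s = algebraMap _ K p) :
    ∃ p : MvPolynomial (Fin d) k, x = algebraMap _ K p := by
  obtain ⟨p, hp⟩ := hi
  obtain ⟨q, hq⟩ := hj
  have h1 : MvPolynomial.X i ^ s * q = MvPolynomial.X j ^ s * p := by
    apply IsFractionRing.injective (MvPolynomial (Fin d) k) K
    rw [map_mul, map_mul, ← hp, ← hq, map_pow, map_pow]; ring
  have hnd : ¬ (MvPolynomial.X i : MvPolynomial (Fin d) k) ∣ MvPolynomial.X j ^ s := by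
    intro h
    have := (MvPolynomial.X_prime).dvd_of_dvd_pow h
    rw [MvPolynomial.X_dvd_X] at this
    exact hij (by simpa using this)
  obtain ⟨w, hw⟩ := (MvPolynomial.X_prime (R := k) (i := i)).pow_dvd_of_dvd_mul_left s hnd (Dvd.intro _ h1)
  refine ⟨w, ?_⟩
  have hy := pow_ne_zero s (algX_ne (k := k) (K := K) i)
  apply mul_right_cancel₀ hy
  rw [hp, hw, map_mul, map_pow]; ring

end
section
variable {R : Type*} [CommRing R] [IsLocalRing R] [IsNoetherianRing R] {d : ℕ} {a : Fin d → R}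

/-- Key: no extra elements on a punctured spectrum. -/
lemma P6E (hd : 1 ≤ d) (H : QRS a (maximalIdeal R)) {e₀ : ℕ} (he : ell (JJ a) = e₀) {i j : Fin d} (hij : i ≠ j)
    {N ρ : ℕ} (hN : ρ < N) {b : R} (hb : nrm (JJ a) b ≤ (1/2) ^ ρ) (γ : EE (JJ a))
    (h : phi H (MvPolynomial.X i ^ N) * γ = phi H (MvPolynomial.X j ^ N) * hc (JJ a) ((1/2)^ρ) b hb) :
    hc (JJ a) ((1/2)^ρ) b hb = 0 := by
  classical
  set β := hc (JJ a) ((1/2)^ρ) b hb with hβ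
  have hfin := Om_finite hd H he
  set A := AA R d
  set K := KK R d
  let T : Fin d → K := fun l => algebraMap A K (MvPolynomial.X l)
  have hT : ∀ l, T l ≠ 0 := fun l => KK_ne (MvPolynomial.X_ne_zero l)
  let em : EE (JJ a) →+* Om H := algebraMap _ _
  have hemT : ∀ l n z, em (phi H (MvPolynomial.X l ^ n) * z) = T l ^ n • em z := by
    intro l n z
    rw [map_mul, ← KtoOm_alg, Algebra.smul_def, map_pow]
  let Z : Om H := (T i ^ N)⁻¹ • em β
  have hZi : T i ^ N • Z = em β := smul_inv_smul₀ (pow_ne_zero _ (hT i)) _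
  have hZj : T j ^ N • Z = em γ := by
    have h1 : T i ^ N • em γ = T j ^ N • em β := by rw [← hemT, ← hemT, h]
    simp only [Z]
    rw [smul_comm, ← h1, inv_smul_smul₀ (pow_ne_zero _ (hT i))]
  have hZ0 : Z = 0 := by
    apply nilp_of_minpoly (K := K)
    intro l hl
    set D := (minpoly K Z).natDegree
    have hintegral : ∀ x : K, (algebraMap A K).IsIntegralElem x → ∃ p, x = algebraMap A K p := by
      intro x hx
      obtain ⟨p, hp⟩ := (IsIntegrallyClosed.isIntegral_iff (R := A) (K := K)).1 hx
      exact ⟨p, hp.symm⟩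
    have h1 := hintegral _ (II.minpoly_coeff (pow_ne_zero N (hT i)) (by rw [hZi]; exact Om_II hd H he β) l)
    have h2 := hintegral _ (II.minpoly_coeff (pow_ne_zero N (hT j)) (by rw [hZj]; exact Om_II hd H he γ) l)
    rw [← pow_mul] at h1 h2
    obtain ⟨p, hp⟩ := alg_of_two hij _ _ h1 h2
    have h3 : II (fz (ResidueField R) K i) (T i ^ (N - ρ) • Z) := by
      obtain ⟨n, q, hq, hrel⟩ := hc_rel hd H hb
      refine ⟨X ^ n + ∑ i ∈ Icc 1 n, C (q i) * X ^ (n - i), ?_, ?_⟩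
      · apply monic_X_pow_add
        refine (degree_sum_le _ _).trans_lt ?_
        rw [Finset.sup_lt_iff (by exact WithBot.bot_lt_coe _)]
        intro i hi
        refine (degree_C_mul_X_pow_le _ _).trans_lt ?_
        have := Finset.mem_Icc.1 hi
        exact_mod_cast (by omega : n - i < n)
      · rw [eval₂_add, eval₂_pow, eval₂_X, eval₂_finsetSum]
        simp only [eval₂_mul, eval₂_C, eval₂_pow, eval₂_X]
        obtain ⟨W, hW⟩ : ∃ W, W = T i ^ (N - ρ) • Z := ⟨_, rfl⟩
        rw [← hW]
        have hWβ : T i ^ ρ • W = em β := by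
          rw [hW, smul_smul, ← pow_add, show ρ + (N - ρ) = N by omega, hZi]
        have h4 := congrArg em hrel
        rw [map_zero, map_add, map_pow, map_sum] at h4
        have h5 : T i ^ (ρ * n) • (W ^ n + ∑ l ∈ Icc 1 n,
            ((algebraMap K (Om H)).comp (fz (ResidueField R) K i)) (q l) * W ^ (n - l)) = 0 := by
          rw [← h4, smul_add, Finset.smul_sum, ← hβ, ← hWβ]
          congr 1
          · rw [_root_.smul_pow, ← pow_mul]
          · refine Finset.sum_congr rfl fun l hl => ?_
            have hl' := Finset.mem_Icc.1 hl
            rw [map_mul, map_pow, ← hWβ, ← KtoOm_alg, ← fz_homog i (q l) _ (hq l hl), _root_.smul_pow,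
              RingHom.comp_apply, map_mul, Algebra.smul_def, Algebra.smul_def]
            have : ρ * n = ρ * l + ρ * (n - l) := by rw [← mul_add]; congr 1; omega
            rw [this, pow_add, map_mul, ← pow_mul]
            simp only [T]
            ring
        have h6 := congrArg (fun z => (T i ^ (ρ * n))⁻¹ • z) h5
        simpa only [smul_zero, inv_smul_smul₀ (pow_ne_zero _ (hT i))] using h6
    have h4 := II.minpoly_coeff (pow_ne_zero (N - ρ) (hT i)) h3 l
    rw [← pow_mul, hp] at h4
    have h5 : algebraMap A K p * T i ^ ((N - ρ) * (D - l)) = algebraMap A K (p * MvPolynomial.X i ^ ((N - ρ) * (D - l))) := by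
      rw [map_mul, map_pow]
    rw [h5] at h4
    have h6 := fz_not_int i _ h4
    by_contra hne
    have hp0 : p ≠ 0 := by rintro rfl; exact hne (by rw [hp, map_zero])
    rw [MvPolynomial.totalDegree_mul_of_isDomain hp0 (pow_ne_zero _ (MvPolynomial.X_ne_zero i)),
      MvPolynomial.totalDegree_X_pow] at h6
    have : 0 < (N - ρ) * (D - l) := Nat.mul_pos (by omega) (by omega)
    omega
  apply emb_inj H
  rw [map_zero]
  change em β = 0
  rw [← hZi, hZ0, smul_zero]

lemma nrm_sub_le (J : Ideal R) (x y : R) : nrm J (x - y) ≤ max (nrm J x) (nrm J y) := by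
  rw [sub_eq_add_neg]; refine (nrm_add J _ _).trans ?_; rw [nrm_neg]

theorem P6 (hd : 1 ≤ d) (H : QRS a (maximalIdeal R)) {e₀ : ℕ} (he : ell (JJ a) = e₀) {i j : Fin d} (hij : i ≠ j)
    {N : ℕ} {b b' : R} (h : a i ^ N * b' - a j ^ N * b ∈ V (JJ a) (2 * N)) : b ∈ V (JJ a) N := by
  rw [mem_V]
  by_contra hb
  push Not at hb
  set c := nrm (JJ a) b with hcdef
  have hc0 : 0 < c := lt_trans (by positivity) hb
  have hm : (maximalIdeal R) ≠ ⊤ := H.prime.ne_top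
  have hXh : ∀ l : Fin d, (MvPolynomial.X l ^ N : MvPolynomial (Fin d) R).IsHomogeneous N := fun l => by
    simpa using (MvPolynomial.isHomogeneous_X R l).pow N
  have hf : ∀ (l : Fin d) y, nrm (JJ a) (a l ^ N * y) = (1/2) ^ N * nrm (JJ a) y := by
    intro l y
    simpa using H.nrm_form (hXh l) (CIn_X_pow hm l N) y
  have h2N : (1/2 : ℝ) ^ (2 * N) < (1/2) ^ N * c := by
    rw [two_mul, pow_add]; exact mul_lt_mul_of_pos_left hb (by positivity)
  rw [mem_V] at h
  have hb' : nrm (JJ a) b' ≤ c := by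
    have h1 := nrm_add (JJ a) (a i ^ N * b' - a j ^ N * b) (a j ^ N * b)
    rw [sub_add_cancel, hf, hf] at h1
    have h2 : (1/2) ^ N * nrm (JJ a) b' ≤ (1/2) ^ N * c := h1.trans (max_le (h.trans h2N.le) le_rfl)
    exact le_of_mul_le_mul_left h2 (by positivity)
  obtain ⟨q, ρ, hq, hqρ⟩ := rational_nrm hd H he b hc0
  rw [← hcdef] at hqρ
  have hρ : ρ < N * q := by
    have h1 : ((1/2 : ℝ) ^ N) ^ q < c ^ q := pow_lt_pow_left₀ hb (by positivity) (by omega)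
    rw [hqρ, ← pow_mul] at h1
    exact (pow_lt_pow_iff_right_of_lt_one₀ (by norm_num) (by norm_num)).1 h1
  have hmap : ∀ l : Fin d, (MvPolynomial.X l ^ N : MvPolynomial (Fin d) (ResidueField R)) =
      MvPolynomial.map (residue R) (MvPolynomial.X l ^ N) := fun l => by simp
  have hev : ∀ l : Fin d, (MvPolynomial.X l ^ N : MvPolynomial (Fin d) R).eval a = a l ^ N := fun l => by simp
  -- relation in `EE`
  have hrel : phi H (MvPolynomial.X i ^ N) * hc (JJ a) c b' hb' = phi H (MvPolynomial.X j ^ N) * hc (JJ a) c b le_rfl := by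
    rw [hmap, hmap, phi_form_mul H (hXh i), phi_form_mul H (hXh j), hc_congr _ rfl (congrArg (· * b') (hev i)),
      hc_congr _ rfl (congrArg (· * b) (hev j))]
    have h3 : nrm (JJ a) (a i ^ N * b' - a j ^ N * b) ≤ (1/2) ^ N * c := h.trans h2N.le
    have h4 := hc_add (J := JJ a) (c := (1/2) ^ N * c) h3 (y := a j ^ N * b) (by rw [hf])
      (by rw [sub_add_cancel, hf]; gcongr)
    rw [(hc_eq_zero (by positivity) h3).2 (lt_of_le_of_lt h h2N), zero_add] at h4
    rw [h4]
    exact hc_congr _ rfl (by ring)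
  have hpw : hc (JJ a) c b le_rfl ^ q = hc (JJ a) ((1/2) ^ ρ) (b ^ q) (by rw [nrm_pow _ _ hq, ← hqρ]) := by
    rw [hc_pow _ q (by rw [nrm_pow _ _ hq])]
    exact hc_congr _ hqρ rfl
  have hz := P6E hd H he hij hρ (b := b ^ q) (by rw [nrm_pow _ _ hq, ← hqρ]) (hc (JJ a) c b' hb' ^ q) (by
    rw [← hpw, pow_mul, pow_mul, map_pow (phi H) _ q, map_pow (phi H) _ q, ← mul_pow, ← mul_pow, hrel])
  rw [hc_eq_zero (by positivity), nrm_pow _ _ hq, ← hqρ] at hz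
  exact lt_irrefl _ hz

end
end Sally

namespace Sally
set_option linter.unusedSectionVars false
section
variable {R : Type*} [CommRing R]

lemma length_range_add_ker {M N : Type*} [AddCommGroup M] [Module R M] [AddCommGroup N] [Module R N]
    (f : M →ₗ[R] N) : Module.length R M = Module.length R (LinearMap.ker f) + Module.length R (LinearMap.range f) :=
  Module.length_eq_add_of_exact (LinearMap.ker f).subtype f.rangeRestrict (Submodule.injective_subtype _)
    (LinearMap.surjective_rangeRestrict f) (by
      rw [LinearMap.exact_iff, LinearMap.ker_rangeRestrict, Submodule.range_subtype])

lemma koszul_len {A B C : Ideal R} (x : Fin 3 → R) (h1 : ∀ i, ∀ b ∈ B, x i * b ∈ C)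
    (h2 : ∀ i j, i ≠ j → ∀ b b', x i * b' - x j * b ∈ B → b ∈ A) :
    ell C + 3 * ell A ≤ ell (C ⊔ Ideal.span (Set.range x)) + 3 * ell B := by
  let g1 : (Fin 3 → R ⧸ B) →ₗ[R] (R ⧸ C) :=
    ∑ i, (Submodule.mapQ B C (LinearMap.lsmul R R (x i)) (fun b hb => h1 i b hb)).comp (LinearMap.proj i)
  let g2 : (Fin 3 → R) →ₗ[R] (Fin 3 → R ⧸ B) := LinearMap.pi fun i =>
    B.mkQ.comp (x (i + 1) • LinearMap.proj (i + 2) - x (i + 2) • LinearMap.proj (i + 1))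
  have hg2 : ∀ b i, g2 b i = Ideal.Quotient.mk B (x (i + 1) * b (i + 2) - x (i + 2) * b (i + 1)) := fun b i => rfl
  have hg1 : ∀ v : Fin 3 → R, g1 (fun i => Ideal.Quotient.mk B (v i)) = Ideal.Quotient.mk C (∑ i, x i * v i) := by
    intro v
    simp only [g1, LinearMap.sum_apply, LinearMap.comp_apply, LinearMap.proj_apply, map_sum]
    rfl
  have hle : LinearMap.range g2 ≤ LinearMap.ker g1 := by
    rintro _ ⟨b, rfl⟩
    rw [LinearMap.mem_ker]
    have : g2 b = fun i => Ideal.Quotient.mk B (x (i + 1) * b (i + 2) - x (i + 2) * b (i + 1)) := funext (hg2 b)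
    rw [this, hg1, Fin.sum_univ_three]
    simp only [Fin.isValue, zero_add, show (1:Fin 3) + 1 = 2 from rfl, show (1:Fin 3) + 2 = 0 from rfl,
      show (2:Fin 3) + 1 = 0 from rfl, show (2:Fin 3) + 2 = 1 from rfl]
    rw [show x 0 * (x 1 * b 2 - x 2 * b 1) + x 1 * (x 2 * b 0 - x 0 * b 2) + x 2 * (x 0 * b 1 - x 1 * b 0) = 0 by ring,
      map_zero]
  have hA : 3 * ell A ≤ Module.length R (LinearMap.range g2) := by
    have e1 : Module.length R (Fin 3 → R ⧸ A) = 3 * ell A := by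
      rw [Module.length_pi]; simp
    rw [← e1, ← (LinearMap.quotKerEquivRange g2).length_eq]
    let p : (Fin 3 → R) →ₗ[R] (Fin 3 → R ⧸ A) := LinearMap.pi fun i => A.mkQ.comp (LinearMap.proj i)
    have hp : LinearMap.ker g2 ≤ LinearMap.ker p := by
      intro b hb
      rw [LinearMap.mem_ker] at hb ⊢
      funext i
      change Ideal.Quotient.mk A (b i) = 0
      rw [Ideal.Quotient.eq_zero_iff_mem]
      have h3 := congrFun hb (i + 2)
      rw [hg2, Pi.zero_apply, Ideal.Quotient.eq_zero_iff_mem] at h3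
      refine h2 (i + 2 + 1) (i + 2 + 2) ?_ (b i) (b (i + 2 + 2)) ?_
      · simp [add_assoc]
      · have : i + 2 + 1 = i := by rw [add_assoc]; exact add_zero i
        rwa [this] at h3 ⊢
    refine Module.length_le_of_surjective (Submodule.liftQ _ p hp) ?_
    intro v
    choose w hw using fun i => Ideal.Quotient.mk_surjective (v i)
    exact ⟨Submodule.Quotient.mk w, funext hw⟩
  have hK : Module.length R ((R ⧸ C) ⧸ LinearMap.range g1) ≤ ell (C ⊔ Ideal.span (Set.range x)) := by
    let p : R →ₗ[R] ((R ⧸ C) ⧸ LinearMap.range g1) := (LinearMap.range g1).mkQ.comp C.mkQ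
    have hp : C ⊔ Ideal.span (Set.range x) ≤ LinearMap.ker p := by
      refine sup_le ?_ (Ideal.span_le.2 ?_)
      · intro c hc
        rw [LinearMap.mem_ker, LinearMap.comp_apply, Submodule.mkQ_apply C, (Submodule.Quotient.mk_eq_zero C).2 hc,
          map_zero]
      · rintro _ ⟨i, rfl⟩
        change (LinearMap.range g1).mkQ (C.mkQ (x i)) = 0
        rw [Submodule.mkQ_apply, Submodule.Quotient.mk_eq_zero]
        refine ⟨fun j => Ideal.Quotient.mk B (if j = i then 1 else 0), ?_⟩
        rw [hg1 (fun j => if j = i then 1 else 0)]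
        simp
    refine Module.length_le_of_surjective (Submodule.liftQ (C ⊔ Ideal.span (Set.range x)) p hp) ?_
    intro v
    obtain ⟨w, rfl⟩ := Submodule.mkQ_surjective _ v
    obtain ⟨w, rfl⟩ := Submodule.mkQ_surjective _ w
    exact ⟨Submodule.Quotient.mk w, rfl⟩
  have hB : 3 * ell B = Module.length R (LinearMap.ker g1) + Module.length R (LinearMap.range g1) := by
    rw [← length_range_add_ker, Module.length_pi]; simp
  have hC : ell C = Module.length R (LinearMap.range g1) + Module.length R ((R ⧸ C) ⧸ LinearMap.range g1) :=
    Module.length_eq_add_of_exact (LinearMap.range g1).subtype (LinearMap.range g1).mkQ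
      (Submodule.injective_subtype _) (Submodule.mkQ_surjective _) (by
      rw [LinearMap.exact_iff, Submodule.ker_mkQ, Submodule.range_subtype])
  have h5 : Module.length R (LinearMap.range g2) ≤ Module.length R (LinearMap.ker g1) :=
    Module.length_le_of_injective (Submodule.inclusion hle) (Submodule.inclusion_injective hle)
  rw [hC, hB]
  calc _ = Module.length R ((R ⧸ C) ⧸ LinearMap.range g1) + (3 * ell A + Module.length R (LinearMap.range g1)) := by ring
    _ ≤ _ := add_le_add hK (add_le_add (hA.trans h5) le_rfl)

lemma box_len {d : ℕ} (a : Fin d → R) {N : ℕ} (hN : 1 ≤ N) {W : Ideal R} {e₀ : ℕ} (he : ell (JJ a) = e₀)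
    (hQ : ∀ i, a i ^ N ∈ W) {c : R} (hc : c ∉ JJ a) (hcW : c * ∏ i, a i ^ (N - 1) ∈ W) :
    ell W < (N ^ d * e₀ : ℕ) := by
  classical
  let z : (Fin d → Fin N) → R := fun α => ∏ i, a i ^ (α i : ℕ)
  have hz : ∀ α : Fin d → Fin N, z α ∈ JJ a ^ (∑ i, (α i : ℕ)) := by
    intro α
    rw [← Finset.prod_pow_eq_pow_sum]
    exact Ideal.prod_mem_prod fun i _ => Ideal.pow_mem_pow (Ideal.subset_span (Set.mem_range_self i)) _
  have hbox : ∀ k, JJ a ^ k ≤ W ⊔ Ideal.span (z '' {α | ∑ i, (α i : ℕ) = k}) := by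
    intro k
    refine (pow_le_span_mon a k).trans (Ideal.span_le.2 ?_)
    rintro _ ⟨s, rfl⟩
    have hs : mon a s = ∏ i, a i ^ (s.exp i) := by
      rw [mon, MvPolynomial.eval_monomial, one_mul, Finsupp.prod_fintype _ _ (fun _ => pow_zero _)]
    by_cases h : ∃ i, N ≤ s.exp i
    · obtain ⟨i, hi⟩ := h
      refine Ideal.mem_sup_left ?_
      rw [hs, ← Finset.mul_prod_erase _ _ (Finset.mem_univ i)]
      refine Ideal.mul_mem_right _ _ ?_
      rw [← Nat.sub_add_cancel hi, pow_add]
      exact Ideal.mul_mem_left _ _ (hQ i)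
    · push Not at h
      refine Ideal.mem_sup_right (Ideal.subset_span ⟨fun i => ⟨s.exp i, h i⟩, ?_, hs.symm⟩)
      change ∑ i, s.exp i = k
      rw [← Finsupp.degree_eq_sum, s.degree_exp]
  let cnt : ℕ → ℕ := fun k => (univ.filter (fun α : Fin d → Fin N => ∑ i, (α i : ℕ) < k)).card
  have hstep : ∀ k, cnt (k + 1) = cnt k + Fintype.card {α : Fin d → Fin N // ∑ i, (α i : ℕ) = k} := by
    intro k
    rw [Fintype.card_subtype]
    simp only [cnt]
    rw [← Finset.card_union_of_disjoint]
    · congr 1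
      ext α; simp only [Finset.mem_filter, Finset.mem_univ, true_and, Finset.mem_union]; omega
    · rw [Finset.disjoint_filter]; intro α _ h; omega
  have hell : ∀ k, ell (W ⊔ JJ a ^ k) ≤ (cnt k * e₀ : ℕ) := by
    intro k
    induction k with
    | zero => rw [pow_zero, Ideal.one_eq_top, sup_top_eq, ell_top]; exact bot_le
    | succ k ih =>
      rw [ell_eq_add (A := W ⊔ JJ a ^ k) (sup_le_sup le_rfl (Ideal.pow_le_pow_right (Nat.le_succ k))), hstep, add_mul,
        Nat.cast_add]
      refine add_le_add ih ?_
      rw [Nat.cast_mul, ← he]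
      refine qlen_le (fun α => z α.1) (fun α => ?_) ?_ ?_
      · exact Ideal.mem_sup_right (by simpa only [α.2] using hz α.1)
      · refine sup_le (le_sup_left.trans le_sup_left) ((hbox k).trans (sup_le_sup le_sup_left (Ideal.span_mono ?_)))
        rintro _ ⟨α, hα, rfl⟩
        exact ⟨⟨α, hα⟩, rfl⟩
      · intro α r hr
        refine Ideal.mem_sup_right ?_
        rw [pow_succ']
        exact Ideal.mul_mem_mul hr (by simpa only [α.2] using hz α.1)
  let D := d * (N - 1)
  let w := ∏ i, a i ^ (N - 1)
  have hcnt : cnt D + 1 ≤ N ^ d := by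
    have h1 : cnt D < (univ : Finset (Fin d → Fin N)).card := by
      apply Finset.card_lt_card
      rw [Finset.filter_ssubset]
      exact ⟨fun _ => ⟨N - 1, by omega⟩, Finset.mem_univ _, by simp [D]⟩
    simpa using h1
  have hq : qlen (W ⊔ JJ a ^ D) W ≤ ell (JJ a ⊔ Ideal.span {c}) := by
    have := qlen_le (ι := Unit) (A := W ⊔ JJ a ^ D) (B := W) (K := JJ a ⊔ Ideal.span {c}) (fun _ => w) ?_ ?_ ?_
    · simpa using this
    · intro _
      refine Ideal.mem_sup_right ?_
      have := hz (fun _ => ⟨N - 1, by omega⟩)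
      simpa [D] using this
    · refine sup_le le_sup_left ((hbox D).trans (sup_le_sup le_rfl (Ideal.span_mono ?_)))
      rintro _ ⟨α, hα, rfl⟩
      refine ⟨(), ?_⟩
      have h1 : ∀ i ∈ univ, (α i : ℕ) = N - 1 := by
        have h2 : ∑ i, (α i : ℕ) = ∑ _i : Fin d, (N - 1) := by rw [hα]; simp [D]
        exact (Finset.sum_eq_sum_iff_of_le (fun i _ => by have := (α i).2; omega)).1 h2
      simp only [w, z]
      exact Finset.prod_congr rfl fun i hi => by rw [h1 i hi]
    · intro _ r hr
      obtain ⟨x, hx, y, hy, rfl⟩ := Submodule.mem_sup.1 hr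
      rw [add_mul]
      refine add_mem ?_ ?_
      · refine Submodule.span_induction (p := fun x _ => x * w ∈ W) ?_ (by simp) ?_ ?_ hx
        · rintro _ ⟨i, rfl⟩
          simp only [w]
          rw [← Finset.mul_prod_erase _ _ (Finset.mem_univ i), ← mul_assoc, ← pow_succ', Nat.sub_add_cancel hN]
          exact Ideal.mul_mem_right _ _ (hQ i)
        · intro x y _ _ h1 h2; rw [add_mul]; exact add_mem h1 h2
        · intro r x _ h; rw [smul_eq_mul, mul_assoc]; exact Ideal.mul_mem_left _ _ h
      · obtain ⟨r, rfl⟩ := Ideal.mem_span_singleton'.1 hy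
        rw [mul_assoc]
        exact Ideal.mul_mem_left _ _ hcW
  have hlt : ell (JJ a ⊔ Ideal.span {c}) + 1 ≤ e₀ := by
    rw [← he, ell_eq_add (A := JJ a ⊔ Ideal.span {c}) (B := JJ a) le_sup_left]
    refine add_le_add le_rfl ?_
    rw [Order.one_le_iff_pos, qlen, Module.length_pos_iff, Submodule.Quotient.nontrivial_iff, Ne, Submodule.eq_top_iff']
    intro h
    exact hc (h ⟨c, Ideal.mem_sup_right (Ideal.mem_span_singleton_self c)⟩)
  have h1 : ell W + 1 ≤ (N ^ d * e₀ : ℕ) := by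
    rw [ell_eq_add (A := W ⊔ JJ a ^ D) (B := W) le_sup_left, add_assoc]
    refine (add_le_add (hell D) ((add_le_add hq le_rfl).trans hlt)).trans ?_
    rw [← Nat.cast_add]
    have : cnt D * e₀ + e₀ ≤ N ^ d * e₀ := by
      rw [← Nat.succ_mul]; exact Nat.mul_le_mul_right _ hcnt
    exact_mod_cast this
  refine lt_of_lt_of_le ?_ h1
  have hne : ell W ≠ ⊤ := by
    intro h; rw [h, top_add, top_le_iff] at h1; exact ENat.natCast_ne_top _ h1
  exact ENat.lt_add_one_iff hne |>.2 le_rfl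

lemma two_mul_choose (m : ℕ) : 2 * (m + 1).choose 2 = m * (m + 1) := by
  induction m with
  | zero => rfl
  | succ m ih => rw [Nat.choose_succ_succ' (m + 1) 1, mul_add, ih, Nat.choose_one_right]; ring

lemma six_mul_choose (m : ℕ) : 6 * (m + 2).choose 3 = m * (m + 1) * (m + 2) := by
  induction m with
  | zero => rfl
  | succ m ih =>
    rw [Nat.choose_succ_succ' (m + 2) 2, mul_add, ih]
    have := two_mul_choose (m + 1)
    nlinarith

lemma poly3 {e : ℕ → ℤ} {L : ℕ → ℕ} {n₁ : ℕ}
    (hpoly : ∀ n ≥ n₁, (L n : ℤ) = ∑ i ∈ range 4, (-1 : ℤ) ^ i * e i * ((n + 3 - i).choose (3 - i)))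
    (m : ℕ) (hm : n₁ + 1 ≤ m) :
    6 * (L (m - 1) : ℤ) = e 0 * (m * (m + 1) * (m + 2)) - 3 * e 1 * (m * (m + 1)) + 6 * e 2 * m - 6 * e 3 := by
  rw [hpoly (m - 1) (by omega)]
  simp only [Finset.sum_range_succ, Finset.sum_range_zero]
  rw [show m - 1 + 3 - 0 = m + 2 by omega, show m - 1 + 3 - 1 = m + 1 by omega, show m - 1 + 3 - 2 = m by omega,
    show m - 1 + 3 - 3 = m - 1 by omega]
  have h1 : (2 * ((m + 1).choose 2 : ℕ) : ℤ) = m * (m + 1) := by exact_mod_cast two_mul_choose m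
  have h2 : (6 * ((m + 2).choose 3 : ℕ) : ℤ) = m * (m + 1) * (m + 2) := by exact_mod_cast six_mul_choose m
  simp only [show 3 - 0 = 3 from rfl, show 3 - 1 = 2 from rfl, show 3 - 2 = 1 from rfl, show 3 - 3 = 0 from rfl,
    Nat.choose_one_right, Nat.choose_zero_right]
  rw [← h2, ← h1]
  push_cast
  ring

theorem P7 [IsLocalRing R] [IsNoetherianRing R] {a : Fin 3 → R} (H : QRS a (maximalIdeal R)) {e₀ : ℕ}
    (he : ell (JJ a) = e₀) {e : ℕ → ℤ} (he0 : (e₀ : ℤ) ≤ e 0) (he3 : e 3 = 0) {L : ℕ → ℕ} {n₁ : ℕ}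
    (hL : ∀ n ≥ n₁, ell (V (JJ a) (n + 1)) = L n)
    (hpoly : ∀ n ≥ n₁, (L n : ℤ) = ∑ i ∈ range 4, (-1 : ℤ) ^ i * e i * ((n + 3 - i).choose (3 - i)))
    (n : ℕ) : V (JJ a) (n + 2) ≤ JJ a ^ n := by
  classical
  intro y hy
  by_contra hyn
  obtain ⟨l, hl, hyl, hyl'⟩ : ∃ l, l < n ∧ y ∈ JJ a ^ l ∧ y ∉ JJ a ^ (l + 1) := by
    have hex : ∃ k, y ∉ JJ a ^ k := ⟨n, hyn⟩
    have h1 := Nat.find_spec hex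
    have h2 : Nat.find hex ≤ n := Nat.find_min' hex hyn
    have h0 : Nat.find hex ≠ 0 := by intro h; rw [h] at h1; simp at h1
    refine ⟨Nat.find hex - 1, by omega, ?_, ?_⟩
    · have := Nat.find_min hex (m := Nat.find hex - 1) (by omega); simpa using this
    · rwa [Nat.sub_add_cancel (by omega)]
  obtain ⟨f, hf, rfl⟩ := (mem_JJ_pow a).1 hyl
  have hc : ¬ CIn (JJ a) f := by
    intro h
    have := eval_mem_mul a hf h
    rw [← pow_succ'] at this
    exact hyl' this
  simp only [CIn, not_forall] at hc
  obtain ⟨α, hα⟩ := hc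
  have hαl : α.degree = l := by
    rw [Finsupp.degree_eq_weight_one]
    exact hf (fun h => hα (by rw [h]; exact zero_mem _))
  have hαi : ∀ i, α i ≤ l := fun i => hαl ▸ Finsupp.le_degree i α
  set N := n₁ + n + 1 with hN
  let W := V (JJ a) (3 * N) ⊔ Ideal.span (Set.range fun i => a i ^ N)
  have hQ : ∀ i, a i ^ N ∈ W := fun i => Ideal.mem_sup_right (Ideal.subset_span ⟨i, rfl⟩)
  have hlt : ell W < (N ^ 3 * e₀ : ℕ) := by
    refine box_len a (by omega) he hQ hα ?_
    let h := ∏ i, a i ^ (N - 1 - α i)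
    have hh : h ∈ JJ a ^ (3 * (N - 1) - l) := by
      have e1 : 3 * (N - 1) - l = ∑ i, (N - 1 - α i) := by
        have := Finsupp.degree_eq_sum α
        rw [hαl] at this
        rw [Fin.sum_univ_three] at this ⊢
        have := hαi 0; have := hαi 1; have := hαi 2
        omega
      rw [e1, ← Finset.prod_pow_eq_pow_sum]
      exact Ideal.prod_mem_prod fun i _ => Ideal.pow_mem_pow (Ideal.subset_span (Set.mem_range_self i)) _
    have h1 : h * f.eval a ∈ W := by
      refine Ideal.mem_sup_left ?_
      have := V_mul (JJ a) (Ideal.mul_mem_mul (pow_le_V _ _ hh) hy)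
      exact V_anti (JJ a) (by omega) this
    have h2 : h * f.eval a - f.coeff α * ∏ i, a i ^ (N - 1) ∈ W := by
      rw [MvPolynomial.eval_eq', Finset.mul_sum,
        ← Finset.add_sum_erase _ _ (MvPolynomial.mem_support_iff.2 (fun h => hα (by rw [h]; exact zero_mem _)) :
          α ∈ f.support)]
      have h3 : h * (f.coeff α * ∏ i, a i ^ α i) = f.coeff α * ∏ i, a i ^ (N - 1) := by
        have : h * ∏ i, a i ^ α i = ∏ i, a i ^ (N - 1) := by
          simp only [h]
          rw [← Finset.prod_mul_distrib]
          refine Finset.prod_congr rfl fun i _ => ?_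
          rw [← pow_add, Nat.sub_add_cancel (by have := hαi i; omega)]
        rw [← this]; ring
      rw [h3, add_sub_cancel_left]
      refine Ideal.sum_mem _ fun β hβ => ?_
      rw [Finset.mem_erase] at hβ
      have hβl : β.degree = l := by
        rw [Finsupp.degree_eq_weight_one]
        exact hf (MvPolynomial.mem_support_iff.1 hβ.2)
      obtain ⟨i, hi⟩ : ∃ i, α i < β i := by
        by_contra hcon
        push Not at hcon
        apply hβ.1
        have h4 : ∑ i, β i = ∑ i, α i := by
          rw [← Finsupp.degree_eq_sum, ← Finsupp.degree_eq_sum, hβl, hαl]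
        ext i
        exact (Finset.sum_eq_sum_iff_of_le (fun i _ => hcon i)).1 h4 i (Finset.mem_univ i)
      have h5 : h * (f.coeff β * ∏ i, a i ^ β i) = f.coeff β * ∏ i, a i ^ (N - 1 - α i + β i) := by
        simp only [h, pow_add]
        rw [Finset.prod_mul_distrib]; ring
      rw [h5, ← Finset.mul_prod_erase _ _ (Finset.mem_univ i)]
      refine Ideal.mul_mem_left _ _ (Ideal.mul_mem_right _ _ ?_)
      have : N - 1 - α i + β i = N + (β i - α i - 1) := by have := hαi i; omega
      rw [this, pow_add]
      exact Ideal.mul_mem_right _ _ (hQ i)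
    have := sub_mem h1 h2
    rwa [sub_sub_cancel] at this
  have hk := koszul_len (A := V (JJ a) N) (B := V (JJ a) (2 * N)) (C := V (JJ a) (3 * N)) (fun i => a i ^ N)
    (fun i b hb => by
      have h1 : a i ^ N ∈ V (JJ a) N := pow_le_V _ _ (Ideal.pow_mem_pow (Ideal.subset_span (Set.mem_range_self i)) _)
      exact V_anti (JJ a) (by omega) (V_mul (JJ a) (Ideal.mul_mem_mul h1 hb)))
    (fun i j hij b b' h => P6 (by norm_num) H he hij h)
  have hLN : ∀ k, 1 ≤ k → ell (V (JJ a) (k * N)) = L (k * N - 1) := by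
    intro k hk
    have : N ≤ k * N := Nat.le_mul_of_pos_left _ hk
    rw [← hL (k * N - 1) (by omega), Nat.sub_add_cancel (by omega)]
  obtain ⟨w, hw⟩ := ENat.ne_top_iff_exists.1 (ne_top_of_lt hlt)
  have hk' : L (3 * N - 1) + 3 * L (N - 1) ≤ w + 3 * L (2 * N - 1) := by
    have h1 := hLN 1 le_rfl
    rw [one_mul] at h1
    rw [h1, hLN 2 (by norm_num), hLN 3 (by norm_num)] at hk
    change _ ≤ ell W + _ at hk
    rw [← hw] at hk
    exact_mod_cast hk
  rw [← hw] at hlt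
  have hlt' : w < N ^ 3 * e₀ := by exact_mod_cast hlt
  have p1 := poly3 hpoly N (by omega)
  have p2 := poly3 hpoly (2 * N) (by omega)
  have p3 := poly3 hpoly (3 * N) (by omega)
  push_cast at p1 p2 p3
  zify at hk' hlt'
  have hN0 : (0 : ℤ) ≤ (N : ℤ) ^ 3 := by positivity
  have h7 := mul_le_mul_of_nonneg_left he0 hN0
  rw [he3] at p1 p2 p3
  nlinarith

end
end Sally

namespace Sally
set_option linter.unusedSectionVars false
section
lemma nrm_le_of {A B : Type*} [CommRing A] [CommRing B] {J : Ideal A} {J' : Ideal B} {x : A} {y : B}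
    (h : ∀ s p, x ^ s ∈ J ^ p → y ^ s ∈ J' ^ p) : nrm J' y ≤ nrm J x := by
  have t1 := tendsto_smoothingFun_of_map_one_le_one (mu J) (mu_one J) x
  have t2 := tendsto_smoothingFun_of_map_one_le_one (mu J') (mu_one J') y
  refine le_of_tendsto_of_tendsto' t2 t1 fun s => ?_
  refine Real.rpow_le_rpow (apply_nonneg _ _) ?_ (by positivity)
  exact mu0_le_of J' _ (apply_nonneg (mu J) _) (fun p hp => h s p ((mu_le_iff J _ p).1 hp)) (mu0_cases J _)

lemma nrm_map_le {A B : Type*} [CommRing A] [CommRing B] {J : Ideal A} {J' : Ideal B} (f : A →+* B)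
    (h : J.map f ≤ J') (x : A) : nrm J' (f x) ≤ nrm J x := by
  refine nrm_le_of fun s p hx => ?_
  rw [← map_pow]
  have := Ideal.mem_map_of_mem f hx
  rw [Ideal.map_pow] at this
  exact Ideal.pow_right_mono h p this

lemma V_map_le {A B : Type*} [CommRing A] [CommRing B] {J : Ideal A} {J' : Ideal B} (f : A →+* B)
    (h : J.map f ≤ J') (n : ℕ) : (V J n).map f ≤ V J' n := by
  rw [Ideal.map_le_iff_le_comap]
  intro x hx
  exact (nrm_map_le f h x).trans hx

variable {R : Type*} [CommRing R] {d k : ℕ}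

lemma mem_mapC {J : Ideal R} {Y : MvPolynomial (Fin k) R} : Y ∈ J.map (MvPolynomial.C) ↔ CIn J Y :=
  MvPolynomial.mem_map_C_iff

/-- the sequence in the polynomial ring -/
noncomputable abbrev aC (k : ℕ) (a : Fin d → R) : Fin d → MvPolynomial (Fin k) R := fun i => MvPolynomial.C (a i)

lemma JJ_aC (a : Fin d → R) : JJ (aC k a) = (JJ a).map MvPolynomial.C := by
  rw [JJ, JJ, Ideal.map_span, ← Set.range_comp]; rfl

lemma mon_aC (a : Fin d → R) {n : ℕ} (s : Mon d n) : mon (aC k a) s = MvPolynomial.C (mon a s) := by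
  simp [mon, MvPolynomial.eval_monomial, Finsupp.prod, map_prod]

lemma coeff_eval_aC (a : Fin d → R) {n : ℕ} (r : Mon d n → MvPolynomial (Fin k) R) (α) :
    ((ofCoeff r).eval (aC k a)).coeff α = (ofCoeff fun s => (r s).coeff α).eval a := by
  rw [eval_ofCoeff, eval_ofCoeff, MvPolynomial.coeff_sum]
  refine Finset.sum_congr rfl fun s _ => ?_
  rw [mon_aC, mul_comm, MvPolynomial.coeff_C_mul, mul_comm]

lemma CIn_ofCoeff {n : ℕ} {J : Ideal R} {r : Mon d n → R} : CIn J (ofCoeff r) ↔ ∀ s, r s ∈ J := by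
  constructor
  · intro h s
    have := h s.exp
    rwa [coeff_ofCoeff] at this
  · intro h α
    by_cases hα : α.degree = n
    · obtain ⟨s, rfl⟩ := Mon.exists_exp α hα
      rw [coeff_ofCoeff]; exact h s
    · have : (ofCoeff r).coeff α = 0 := by
        by_contra hne
        exact hα (by rw [Finsupp.degree_eq_weight_one]; exact ofCoeff_homog r hne)
      rw [this]; exact zero_mem _

lemma QRS.poly {a : Fin d → R} {m : Ideal R} (H : QRS a m) (k : ℕ) :
    QRS (aC k a) (m.map (MvPolynomial.C : R →+* MvPolynomial (Fin k) R)) where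
  prime := by
    have := H.prime
    refine ⟨fun h => ?_, fun {x y} h => ?_⟩
    · rw [Ideal.eq_top_iff_one, mem_mapC] at h
      have h1 := h 0
      rw [MvPolynomial.coeff_zero_one] at h1
      exact this.ne_top ((Ideal.eq_top_iff_one _).2 h1)
    · rw [mem_mapC] at h
      simpa only [mem_mapC] using CIn.mul_mem h
  le := by rw [JJ_aC]; exact Ideal.map_mono H.le
  pow_le := by
    obtain ⟨c, hc⟩ := H.pow_le
    exact ⟨c, by rw [← Ideal.map_pow, JJ_aC]; exact Ideal.map_mono hc⟩
  sat := by
    intro s b hs hb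
    rw [JJ_aC, mem_mapC] at hb ⊢
    rw [mem_mapC] at hs
    exact CIn.of_mul H.sat hs hb
  qr := by
    intro n f hf hfe
    rw [eq_ofCoeff hf] at hfe ⊢
    rw [CIn_ofCoeff]
    intro s
    rw [JJ_aC, mem_mapC]
    intro α
    rw [JJ_aC, ← Ideal.map_pow, mem_mapC] at hfe
    have h1 := hfe α
    rw [coeff_eval_aC] at h1
    exact CIn_ofCoeff.1 (H.qr n _ (ofCoeff_homog _) h1) s

lemma V_poly (J : Ideal R) (n : ℕ) :
    V (J.map (MvPolynomial.C : R →+* MvPolynomial (Fin k) R)) n = (V J n).map MvPolynomial.C := by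
  classical
  refine le_antisymm ?_ (V_map_le _ le_rfl n)
  intro Y hY
  obtain ⟨N, hN⟩ : ∃ N, Y.support.card = N := ⟨_, rfl⟩
  induction N generalizing Y with
  | zero =>
    rw [Finset.card_eq_zero, MvPolynomial.support_eq_empty] at hN
    rw [hN]; exact zero_mem _
  | succ N ih =>
    let M : MonomialOrder (Fin k) := MonomialOrder.lex
    have hne : Y ≠ 0 := by rintro rfl; simp at hN
    have h1 : M.leadingCoeff Y ∈ V J n := by
      rw [mem_V]
      refine le_trans (nrm_le_of fun s p hs => ?_) hY
      rw [← Ideal.map_pow, mem_mapC] at hs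
      have := hs (s • M.degree Y)
      rwa [M.coeff_pow_nsmul_degree] at this
    have h2 : MvPolynomial.monomial (M.degree Y) (M.leadingCoeff Y) ∈
        (V J n).map (MvPolynomial.C : R →+* MvPolynomial (Fin k) R) := by
      rw [← mul_one (M.leadingCoeff Y), ← MvPolynomial.C_mul_monomial]
      exact Ideal.mul_mem_right _ _ (Ideal.mem_map_of_mem _ h1)
    have h3 := ih (Y := Y - MvPolynomial.monomial (M.degree Y) (M.leadingCoeff Y))
      (sub_mem hY (V_map_le _ le_rfl n h2)) (by
        have : (Y - MvPolynomial.monomial (M.degree Y) (M.leadingCoeff Y)).support = Y.support.erase (M.degree Y) := by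
          ext α
          rw [Finset.mem_erase, MvPolynomial.mem_support_iff, MvPolynomial.mem_support_iff, MvPolynomial.coeff_sub,
            MvPolynomial.coeff_monomial]
          by_cases h : M.degree Y = α
          · subst h; simp [MonomialOrder.leadingCoeff]
          · rw [if_neg h, sub_zero]; simp [Ne.symm h]
        rw [this, Finset.card_erase_of_mem (M.degree_mem_support hne), hN]; rfl)
    have := add_mem h3 h2
    rwa [sub_add_cancel] at this

end
end Sally

namespace Sally
set_option linter.unusedSectionVars false
section
variable {A : Type*} [CommRing A] {d : ℕ}

/-- the substitution `T_d ↦ ∑ u_j T_j`. -/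
noncomputable def sig (A : Type*) [CommRing A] (d : ℕ) :
    MvPolynomial (Fin (d + 1)) (MvPolynomial (Fin d) A) →ₐ[MvPolynomial (Fin d) A]
      MvPolynomial (Fin d) (MvPolynomial (Fin d) A) :=
  MvPolynomial.aeval (Fin.lastCases (∑ j, MvPolynomial.C (MvPolynomial.X j) * MvPolynomial.X j)
    (fun j => MvPolynomial.X j))

lemma sig_last : sig A d (MvPolynomial.X (Fin.last d)) = ∑ j, MvPolynomial.C (MvPolynomial.X j) * MvPolynomial.X j := by
  simp [sig]
lemma sig_castSucc (j : Fin d) : sig A d (MvPolynomial.X j.castSucc) = MvPolynomial.X j := by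
  simp [sig]
lemma sig_C (s : MvPolynomial (Fin d) A) : sig A d (MvPolynomial.C s) = MvPolynomial.C s := by
  rw [← MvPolynomial.algebraMap_eq, AlgHom.commutes, MvPolynomial.algebraMap_eq]

/-- the generic linear form -/
noncomputable def xi (A : Type*) [CommRing A] (d : ℕ) : MvPolynomial (Fin (d + 1)) (MvPolynomial (Fin d) A) :=
  MvPolynomial.X (Fin.last d) - ∑ j : Fin d, MvPolynomial.C (MvPolynomial.X j) * MvPolynomial.X j.castSucc

lemma sig_xi : sig A d (xi A d) = 0 := by
  rw [xi, map_sub, sig_last, map_sum]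
  simp only [map_mul, sig_C, sig_castSucc, sub_self]

lemma xi_homog : (xi A d).IsHomogeneous 1 := by
  refine (MvPolynomial.isHomogeneous_X _ _).sub (MvPolynomial.IsHomogeneous.sum _ _ _ fun j _ => ?_)
  simpa using (MvPolynomial.isHomogeneous_C (Fin (d+1)) (MvPolynomial.X j : MvPolynomial (Fin d) A)).mul
    (MvPolynomial.isHomogeneous_X _ j.castSucc)

lemma xi_coeff : (xi A d).coeff (Finsupp.single (Fin.last d) 1) = 1 := by
  classical
  rw [xi, MvPolynomial.coeff_sub, MvPolynomial.coeff_X, MvPolynomial.coeff_sum]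
  rw [Finset.sum_eq_zero, sub_zero]
  · simp
  intro j _
  rw [MvPolynomial.coeff_C_mul, MvPolynomial.coeff_X, if_neg, mul_zero]
  intro h
  have := (Finsupp.single_left_inj one_ne_zero).1 h
  exact (Fin.castSucc_lt_last j).ne this

/-- kill the variable `u_i` -/
noncomputable def eps (A : Type*) [CommRing A] {d : ℕ} (i : Fin d) : MvPolynomial (Fin d) A →ₐ[A] MvPolynomial (Fin d) A :=
  MvPolynomial.aeval (fun j => if j = i then 0 else MvPolynomial.X j)

lemma eps_X (i : Fin d) : eps A i (MvPolynomial.X i) = 0 := by simp [eps]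
lemma eps_X_ne (i : Fin d) {j : Fin d} (h : j ≠ i) : eps A i (MvPolynomial.X j) = MvPolynomial.X j := by simp [eps, h]
lemma eps_C (i : Fin d) (r : A) : eps A i (MvPolynomial.C r) = MvPolynomial.C r := by
  rw [← MvPolynomial.algebraMap_eq, AlgHom.commutes]
lemma eps_eps (i : Fin d) (Y : MvPolynomial (Fin d) A) : eps A i (eps A i Y) = eps A i Y := by
  rw [← AlgHom.comp_apply]
  congr 1
  apply MvPolynomial.algHom_ext
  intro j
  by_cases h : j = i
  · subst h; rw [AlgHom.comp_apply, eps_X, map_zero]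
  · rw [AlgHom.comp_apply, eps_X_ne i h, eps_X_ne i h]

lemma sig_inj_eps (i : Fin d) (F : MvPolynomial (Fin (d + 1)) (MvPolynomial (Fin d) A))
    (hF : MvPolynomial.map (eps A i).toRingHom F = F) (h0 : sig A d F = 0) : F = 0 := by
  classical
  let t : MvPolynomial (Fin (d + 1)) (MvPolynomial (Fin d) A) := MvPolynomial.X i.castSucc
  let Lc := Localization.Away t
  let ι : (MvPolynomial (Fin (d + 1)) (MvPolynomial (Fin d) A)) →+* Lc := algebraMap _ Lc
  have hι : Function.Injective ι := by
    apply IsLocalization.injective Lc (M := Submonoid.powers t)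
    rw [Submonoid.powers_le]
    refine mvpoly_nzd _ (Finsupp.single i.castSucc 1) ?_
    have h1 : (MvPolynomial.X i.castSucc : MvPolynomial (Fin (d + 1)) (MvPolynomial (Fin d) A)).coeff (Finsupp.single i.castSucc 1) = 1 := by simp
    rw [h1]; exact one_mem _
  let τ : MvPolynomial (Fin d) (MvPolynomial (Fin d) A) →+* Lc :=
    MvPolynomial.eval₂Hom (MvPolynomial.eval₂Hom ((ι.comp MvPolynomial.C).comp MvPolynomial.C)
      (fun j => if j = i then ι (MvPolynomial.X (Fin.last d) -
          ∑ j ∈ univ.erase i, MvPolynomial.C (MvPolynomial.X j) * MvPolynomial.X j.castSucc) *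
            IsLocalization.Away.invSelf t
        else ι (MvPolynomial.C (MvPolynomial.X j)))) (fun j => ι (MvPolynomial.X j.castSucc))
  have hτC : ∀ r, τ (MvPolynomial.C (MvPolynomial.C r)) = ι (MvPolynomial.C (MvPolynomial.C r)) := by
    intro r; simp [τ]
  have hτu : ∀ j, j ≠ i → τ (MvPolynomial.C (MvPolynomial.X j)) = ι (MvPolynomial.C (MvPolynomial.X j)) := by
    intro j hj; simp [τ, hj]
  have hτX : ∀ j, τ (MvPolynomial.X j) = ι (MvPolynomial.X j.castSucc) := by
    intro j; simp [τ]
  have hτi : τ (MvPolynomial.C (MvPolynomial.X i)) = ι (MvPolynomial.X (Fin.last d) -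
          ∑ j ∈ univ.erase i, MvPolynomial.C (MvPolynomial.X j) * MvPolynomial.X j.castSucc) *
            IsLocalization.Away.invSelf t := by
    simp [τ]
  have key : (τ.comp ((sig A d).toRingHom)).comp (MvPolynomial.map (eps A i).toRingHom) =
      ι.comp (MvPolynomial.map (eps A i).toRingHom) := by
    apply MvPolynomial.ringHom_ext
    · intro r
      have : (((τ.comp ((sig A d).toRingHom)).comp (MvPolynomial.map (eps A i).toRingHom)).comp MvPolynomial.C) =
        (ι.comp (MvPolynomial.map (eps A i).toRingHom)).comp MvPolynomial.C := by
        apply MvPolynomial.ringHom_ext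
        · intro r
          simp only [RingHom.comp_apply, MvPolynomial.map_C, AlgHom.toRingHom_eq_coe, RingHom.coe_coe, eps_C, sig_C, hτC]
        · intro j
          simp only [RingHom.comp_apply, MvPolynomial.map_C, AlgHom.toRingHom_eq_coe, RingHom.coe_coe]
          by_cases h : j = i
          · subst h; simp only [eps_X, map_zero]
          · rw [eps_X_ne i h, sig_C, hτu j h]
      exact congrArg (fun f => f r) this
    · intro j
      simp only [RingHom.comp_apply, MvPolynomial.map_X, AlgHom.toRingHom_eq_coe, RingHom.coe_coe]
      induction j using Fin.lastCases with
      | cast j => rw [sig_castSucc, hτX]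
      | last =>
        rw [sig_last, map_sum, ← Finset.add_sum_erase _ _ (Finset.mem_univ i), map_mul, hτi, hτX]
        have e1 : ∀ z : Lc, z * IsLocalization.Away.invSelf t * ι (MvPolynomial.X i.castSucc) = z := by
          intro z
          have : ι (MvPolynomial.X i.castSucc) * IsLocalization.Away.invSelf (S := Lc) t = 1 :=
            IsLocalization.Away.mul_invSelf t
          rw [mul_assoc, mul_comm (IsLocalization.Away.invSelf t), this, mul_one]
        rw [e1, map_sub, map_sum]
        have : ∀ j ∈ univ.erase i, τ (MvPolynomial.C (MvPolynomial.X j) * MvPolynomial.X j) =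
            ι (MvPolynomial.C (MvPolynomial.X j) * MvPolynomial.X j.castSucc) := by
          intro j hj
          rw [map_mul, map_mul, hτu j (Finset.ne_of_mem_erase hj), hτX]
        rw [Finset.sum_congr rfl this, sub_add_cancel]
  have h1 := congrArg (fun f => f F) key
  simp only [RingHom.comp_apply] at h1
  rw [hF] at h1
  apply hι
  rw [← h1, map_zero]
  change τ (sig A d F) = 0
  rw [h0, map_zero]

variable {R : Type*} [CommRing R]

lemma CIn_map2 {k l : ℕ} {J : Ideal R} {F : MvPolynomial (Fin l) (MvPolynomial (Fin k) R)} :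
    CIn (J.map MvPolynomial.C) F ↔ MvPolynomial.map (MvPolynomial.map (Ideal.Quotient.mk J)) F = 0 := by
  constructor
  · intro h
    ext1 α
    rw [MvPolynomial.coeff_map, MvPolynomial.coeff_zero]
    exact CIn.map_eq.1 (mem_mapC.1 (h α))
  · intro h α
    rw [mem_mapC, CIn.map_eq, ← MvPolynomial.coeff_map, h, MvPolynomial.coeff_zero]

lemma CIn_sig {K : Ideal (MvPolynomial (Fin d) R)} {F : MvPolynomial (Fin (d + 1)) (MvPolynomial (Fin d) R)}
    (h : CIn K F) : CIn K (sig R d F) := by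
  rw [← mem_mapC] at h ⊢
  have := Ideal.mem_map_of_mem (sig R d).toRingHom h
  rw [Ideal.map_map] at this
  have e : (sig R d).toRingHom.comp MvPolynomial.C = MvPolynomial.C := RingHom.ext fun s => sig_C s
  rw [e] at this
  exact this

lemma CIn_of_sig {J : Ideal R} (i : Fin d) {F : MvPolynomial (Fin (d + 1)) (MvPolynomial (Fin d) R)}
    (hF : MvPolynomial.map (eps R i).toRingHom F = F) (h : CIn (J.map MvPolynomial.C) (sig R d F)) :
    CIn (J.map MvPolynomial.C) F := by
  rw [CIn_map2] at h ⊢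
  apply sig_inj_eps i
  · conv_rhs => rw [← hF]
    rw [MvPolynomial.map_map, MvPolynomial.map_map]
    congr 1
    congr 1
    apply MvPolynomial.ringHom_ext
    · intro r
      simp [eps_C]
    · intro j
      by_cases hj : j = i
      · subst hj; simp [eps_X]
      · simp [eps_X_ne i hj]
  · rw [← h]
    have : ((sig (R ⧸ J) d).toRingHom.comp (MvPolynomial.map (MvPolynomial.map (Ideal.Quotient.mk J)))) =
        (MvPolynomial.map (MvPolynomial.map (Ideal.Quotient.mk J))).comp (sig R d).toRingHom := by
      apply MvPolynomial.ringHom_ext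
      · intro s; simp [sig_C]
      · intro j
        induction j using Fin.lastCases with
        | cast j => simp [sig_castSucc]
        | last => simp [sig_last]
    exact congrArg (fun f => f F) this

variable {a : Fin (d + 1) → R} {m : Ideal R}

/-- generic element -/
noncomputable def gx (a : Fin (d + 1) → R) : MvPolynomial (Fin d) R := (xi R d).eval (aC d a)

lemma gx_eq (a : Fin (d + 1) → R) : gx a = MvPolynomial.C (a (Fin.last d)) -
    ∑ j : Fin d, MvPolynomial.X j * MvPolynomial.C (a j.castSucc) := by
  simp [gx, xi]

lemma gx_mem (a : Fin (d + 1) → R) : gx a ∈ JJ (aC d a) := by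
  have := eval_mem_pow (aC d a) (xi_homog (A := R) (d := d))
  rwa [pow_one] at this

lemma xi_not (H : QRS a m) : ¬ CIn (m.map (MvPolynomial.C : R →+* MvPolynomial (Fin d) R)) (xi R d) := by
  intro h
  have := h (Finsupp.single (Fin.last d) 1)
  rw [xi_coeff] at this
  exact (H.poly d).prime.ne_top ((Ideal.eq_top_iff_one _).2 this)

lemma L2 (H : QRS a m) {n : ℕ} {F : MvPolynomial (Fin (d + 1)) (MvPolynomial (Fin d) R)} (hF : F.IsHomogeneous n)
    (h : F.eval (aC d a) ∈ JJ (aC d a) ^ (n + 1) ⊔ Ideal.span {gx a}) : CIn (JJ (aC d a)) (sig R d F) := by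
  have HS := H.poly d
  rcases Nat.eq_zero_or_pos n with rfl | hn
  · apply CIn_sig
    refine HS.qr 0 F hF ?_
    rw [zero_add, pow_one] at h ⊢
    exact (sup_le le_rfl ((Ideal.span_singleton_le_iff_mem _).2 (gx_mem a))) h
  · obtain ⟨G, hG, y, hy, hGy⟩ := Submodule.mem_sup.1 h
    obtain ⟨W, rfl⟩ := Ideal.mem_span_singleton'.1 hy
    have h1 : (xi R d).eval (aC d a) * W ∈ JJ (aC d a) ^ (1 + (n - 1)) := by
      rw [show 1 + (n - 1) = n by omega]
      have h2 : (xi R d).eval (aC d a) * W = F.eval (aC d a) - G := by rw [← hGy, gx]; ring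
      rw [h2]
      exact sub_mem (eval_mem_pow _ hF) (Ideal.pow_le_pow_right (Nat.le_succ n) hG)
    obtain ⟨w, hw, hwe⟩ := (mem_JJ_pow _).1 (HS.nzd xi_homog (xi_not H) h1)
    have hh : (F - xi R d * w).IsHomogeneous n := hF.sub (by
      have := xi_homog (A := R) (d := d) |>.mul hw
      rwa [show 1 + (n - 1) = n by omega] at this)
    have h3 := HS.qr n _ hh (by
      rw [map_sub, map_mul, hwe, ← hGy, ← gx]
      have : G + W * gx a - gx a * W = G := by ring
      rwa [this])
    have h4 := CIn_sig h3
    rwa [map_sub, map_mul, sig_xi, zero_mul, sub_zero] at h4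

/-- quasi-regularity of the quotient -/
lemma Qpoly (H : QRS a m) {n : ℕ} {f : MvPolynomial (Fin d) (MvPolynomial (Fin d) R)} (hf : f.IsHomogeneous n)
    (h : f.eval (fun j => aC d a j.castSucc) ∈ JJ (aC d a) ^ (n + 1) ⊔ Ideal.span {gx a}) : CIn (JJ (aC d a)) f := by
  have h1 := L2 H (F := MvPolynomial.rename Fin.castSucc f) (hf.rename_isHomogeneous) (by
    rw [MvPolynomial.eval_rename]; exact h)
  have h2 : sig R d (MvPolynomial.rename Fin.castSucc f) = f := by
    rw [sig, MvPolynomial.aeval_rename]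
    have : (Fin.lastCases (∑ j, MvPolynomial.C (MvPolynomial.X j) * MvPolynomial.X j)
        (fun j => MvPolynomial.X j) : Fin (d + 1) → MvPolynomial (Fin d) (MvPolynomial (Fin d) R)) ∘ Fin.castSucc =
        MvPolynomial.X := by
      funext j; simp
    rw [this, MvPolynomial.aeval_X_left_apply]
  rwa [h2] at h1

lemma eps_aC (i : Fin d) (F : MvPolynomial (Fin (d + 1)) (MvPolynomial (Fin d) R)) :
    (MvPolynomial.map (eps R i).toRingHom F).eval (aC d a) = eps R i (F.eval (aC d a)) := by
  rw [MvPolynomial.eval_map]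
  change _ = (eps R i).toRingHom _
  rw [MvPolynomial.eval, MvPolynomial.coe_eval₂Hom, MvPolynomial.hom_eval₂]
  congr 1
  funext j
  exact (eps_C i (a j)).symm

/-- C1 -/
lemma C1 (H : QRS a m) (i : Fin d) {Y s : MvPolynomial (Fin d) R} (hY : eps R i Y = Y)
    (hs : s ∉ m.map (MvPolynomial.C : R →+* MvPolynomial (Fin d) R)) {p : ℕ}
    (h : s * Y ∈ JJ (aC d a) ^ p ⊔ Ideal.span {gx a}) : Y ∈ JJ (aC d a) ^ p := by
  have HS := H.poly d
  have key : ∀ q ≤ p, Y ∈ JJ (aC d a) ^ q := by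
    intro q
    induction q with
    | zero => intro _; simp
    | succ q ih =>
      intro hq
      obtain ⟨F₀, hF₀, hF₀Y⟩ := (mem_JJ_pow _).1 (ih (by omega))
      let F := MvPolynomial.map (eps R i).toRingHom F₀
      have hF : F.IsHomogeneous q := hF₀.map _
      have hFY : F.eval (aC d a) = Y := by rw [eps_aC, hF₀Y, hY]
      have hFF : MvPolynomial.map (eps R i).toRingHom F = F := by
        simp only [F]
        rw [MvPolynomial.map_map]
        congr 1
        congr 1
        exact RingHom.ext fun Z => eps_eps i Z
      have h1 := L2 H (F := MvPolynomial.C s * F) (n := q) (by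
        simpa using (MvPolynomial.isHomogeneous_C (Fin (d+1)) s).mul hF) (by
        rw [map_mul, MvPolynomial.eval_C, hFY]
        exact (sup_le_sup_right (Ideal.pow_le_pow_right hq) _ :
          JJ (aC d a) ^ p ⊔ Ideal.span {gx a} ≤ JJ (aC d a) ^ (q + 1) ⊔ Ideal.span {gx a}) h)
      rw [map_mul, sig_C] at h1
      have h2 := CIn.of_mul HS.sat (h := MvPolynomial.C s) (fun h => hs (by
        have := h 0
        rwa [MvPolynomial.coeff_C, if_pos rfl] at this)) h1
      rw [JJ_aC] at h2
      have h3 := eval_mem_mul (aC d a) hF (CIn_of_sig i hFF h2)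
      rwa [← JJ_aC, hFY, ← pow_succ'] at h3
  exact key p le_rfl

/-- elimination of `u_i` -/
lemma elim (a : Fin (d + 1) → R) (i : Fin d) (Y : MvPolynomial (Fin d) R) : ∃ m₀ : ℕ, ∀ n ≥ m₀, ∃ Z, eps R i Z = Z ∧
    MvPolynomial.C (a i.castSucc) ^ n * Y - Z ∈ Ideal.span {gx a} := by
  classical
  suffices h : ∃ n, ∃ Z, eps R i Z = Z ∧ MvPolynomial.C (a i.castSucc) ^ n * Y - Z ∈ Ideal.span {gx a} by
    obtain ⟨n, Z, hZ, h⟩ := h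
    refine ⟨n, fun k hk => ⟨MvPolynomial.C (a i.castSucc) ^ (k - n) * Z, ?_, ?_⟩⟩
    · rw [map_mul, map_pow, eps_C, hZ]
    · have : MvPolynomial.C (a i.castSucc) ^ k * Y - MvPolynomial.C (a i.castSucc) ^ (k - n) * Z =
        MvPolynomial.C (a i.castSucc) ^ (k - n) * (MvPolynomial.C (a i.castSucc) ^ n * Y - Z) := by
        rw [mul_sub, ← mul_assoc, ← pow_add, Nat.sub_add_cancel hk]
      rw [this]; exact Ideal.mul_mem_left _ _ h
  induction Y using MvPolynomial.induction_on with
  | C r => exact ⟨0, MvPolynomial.C r, eps_C i r, by simp⟩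
  | add Y Y' h h' =>
    obtain ⟨n, Z, hZ, h⟩ := h
    obtain ⟨n', Z', hZ', h'⟩ := h'
    refine ⟨n + n', MvPolynomial.C (a i.castSucc) ^ n' * Z + MvPolynomial.C (a i.castSucc) ^ n * Z', ?_, ?_⟩
    · rw [map_add, map_mul, map_mul, map_pow, map_pow, eps_C, hZ, hZ']
    · have := add_mem (Ideal.mul_mem_left _ (MvPolynomial.C (a i.castSucc) ^ n') h)
        (Ideal.mul_mem_left _ (MvPolynomial.C (a i.castSucc) ^ n) h')
      convert this using 1
      ring
  | mul_X Y j h =>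
    obtain ⟨n, Z, hZ, h⟩ := h
    by_cases hj : j = i
    · subst hj
      let g : MvPolynomial (Fin d) R := MvPolynomial.C (a (Fin.last d)) -
        ∑ l ∈ univ.erase j, MvPolynomial.X l * MvPolynomial.C (a l.castSucc)
      refine ⟨n + 1, Z * g, ?_, ?_⟩
      · rw [map_mul, hZ]
        congr 1
        simp only [g, map_sub, map_sum, map_mul, eps_C]
        congr 1
        refine Finset.sum_congr rfl fun l hl => ?_
        rw [eps_X_ne j (Finset.ne_of_mem_erase hl)]
      · have hg : MvPolynomial.C (a j.castSucc) * MvPolynomial.X j = g - gx a := by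
          rw [gx_eq, ← Finset.add_sum_erase _ _ (Finset.mem_univ j)]
          simp only [g]; ring
        have : MvPolynomial.C (a j.castSucc) ^ (n + 1) * (Y * MvPolynomial.X j) - Z * g =
            (MvPolynomial.C (a j.castSucc) ^ n * Y - Z) * (MvPolynomial.C (a j.castSucc) * MvPolynomial.X j) +
              (- Z) * gx a := by
          rw [sub_mul, hg]
          have : MvPolynomial.C (a j.castSucc) ^ (n + 1) * (Y * MvPolynomial.X j) =
            MvPolynomial.C (a j.castSucc) ^ n * Y * (g - gx a) := by rw [← hg]; ring
          rw [this]; ring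
        rw [this]
        exact add_mem (Ideal.mul_mem_right _ _ h) (Ideal.mul_mem_left _ _ (Ideal.mem_span_singleton_self _))
    · refine ⟨n, Z * MvPolynomial.X j, ?_, ?_⟩
      · rw [map_mul, hZ, eps_X_ne i hj]
      · rw [← mul_assoc, ← sub_mul]; exact Ideal.mul_mem_right _ _ h

end
end Sally

namespace Sally
set_option linter.unusedSectionVars false
section
variable {A B : Type*} [CommRing A] [CommRing B]

lemma ell_colon {K K' : Ideal A} {x : A} (h : ∀ r, r * x ∈ K ↔ r ∈ K') :
    ell K = ell (K ⊔ Ideal.span {x}) + ell K' := by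
  rw [ell_eq_add (le_sup_left : K ≤ K ⊔ Ideal.span {x})]
  congr 1
  have hx : x ∈ K ⊔ Ideal.span {x} := Ideal.mem_sup_right (Ideal.mem_span_singleton_self x)
  apply le_antisymm
  · have := qlen_le (ι := Unit) (A := K ⊔ Ideal.span {x}) (B := K) (K := K') (fun _ => x) (fun _ => hx)
      (by simp) (fun _ r hr => (h r).2 hr)
    simpa using this
  · have := le_qlen (ι := Unit) (A := K ⊔ Ideal.span {x}) (B := K) (K := K') (fun _ => x) (fun _ => hx)
      (fun r hr _ => (h _).1 (by simpa using hr))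
    simpa using this

lemma ell_map_surj (q : A →+* B) (hq : Function.Surjective q) {K : Ideal A} (hK : RingHom.ker q ≤ K) :
    ell (K.map q) = ell K := by
  have : RingHomSurjective q := ⟨hq⟩
  have hc : (K.map q).comap q = K := by
    rw [Ideal.comap_map_of_surjective q hq]
    exact sup_eq_left.2 (by rw [← RingHom.ker_eq_comap_bot]; exact hK)
  let g : A →ₛₗ[q] B := q.toSemilinearMap
  have hle : K ≤ Submodule.comap g (K.map q) := fun x hx => Ideal.mem_map_of_mem q hx
  let f : (A ⧸ K) →ₛₗ[q] (B ⧸ K.map q) := Submodule.mapQ K (K.map q) g hle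
  have hf : Function.Bijective f := by
    constructor
    · rw [injective_iff_map_eq_zero]
      intro z hz
      obtain ⟨y, rfl⟩ := Submodule.Quotient.mk_surjective _ z
      rw [Submodule.mapQ_apply, Submodule.Quotient.mk_eq_zero] at hz
      rw [Submodule.Quotient.mk_eq_zero]
      rw [← hc]; exact hz
    · intro z
      obtain ⟨y, rfl⟩ := Submodule.Quotient.mk_surjective _ z
      obtain ⟨y, rfl⟩ := hq y
      exact ⟨Submodule.Quotient.mk y, by rw [Submodule.mapQ_apply]; rfl⟩
  rw [ell, ell, Module.length, Module.length, WithBot.unbot_inj]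
  exact (Order.krullDim_eq_of_orderIso (Submodule.orderIsoMapComapOfBijective f hf)).symm

lemma ell_map_local [IsLocalRing A] [IsLocalRing B] [IsNoetherianRing A] (f : A →+* B)
    (hm : (maximalIdeal A).map f = maximalIdeal B) (hc : ∀ K : Ideal A, ∀ z, f z ∈ K.map f → z ∈ K)
    (K : Ideal A) (c : ℕ) (hK : maximalIdeal A ^ c ≤ K) : ell (K.map f) = ell K := by
  induction K using WellFoundedGT.induction with
  | ind K ih =>
    by_cases hT : K = ⊤
    · subst hT; rw [Ideal.map_top, ell_top, ell_top]
    obtain ⟨z, hz, hzm⟩ : ∃ z, z ∉ K ∧ ∀ r ∈ maximalIdeal A, r * z ∈ K := by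
      classical
      have hex : ∃ c, maximalIdeal A ^ c ≤ K := ⟨c, hK⟩
      obtain ⟨k, hk⟩ : ∃ k, Nat.find hex = k + 1 := by
        refine Nat.exists_eq_succ_of_ne_zero fun h => hT ?_
        have := Nat.find_spec hex
        rw [h, pow_zero, Ideal.one_eq_top] at this
        exact top_le_iff.1 this
      have h1 := Nat.find_spec hex
      have h2 : ¬ maximalIdeal A ^ k ≤ K := Nat.find_min hex (by omega)
      rw [hk, pow_succ'] at h1
      obtain ⟨z, hz, hzK⟩ := SetLike.not_le_iff_exists.1 h2
      exact ⟨z, hzK, fun r hr => h1 (Ideal.mul_mem_mul hr hz)⟩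
    have hu : ∀ r, r * z ∈ K ↔ r ∈ maximalIdeal A := by
      refine fun r => ⟨fun h => ?_, hzm r⟩
      by_contra hr
      have hr' : IsUnit r := by rwa [mem_maximalIdeal, mem_nonunits_iff, not_not] at hr
      exact hz ((Ideal.unit_mul_mem_iff_mem K hr').1 h)
    have hu' : ∀ r, r * f z ∈ K.map f ↔ r ∈ maximalIdeal B := by
      refine fun r => ⟨fun h => ?_, fun h => ?_⟩
      · by_contra hr
        have hr' : IsUnit r := by rwa [mem_maximalIdeal, mem_nonunits_iff, not_not] at hr
        exact hz (hc K z ((Ideal.unit_mul_mem_iff_mem _ hr').1 h))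
      · rw [← hm] at h
        have h3 : r * f z ∈ (maximalIdeal A).map f * (Ideal.span {z}).map f :=
          Ideal.mul_mem_mul h (Ideal.mem_map_of_mem f (Ideal.mem_span_singleton_self z))
        rw [← Ideal.map_mul] at h3
        refine Ideal.map_mono ?_ h3
        rw [Ideal.mul_le]
        intro r hr w hw
        obtain ⟨v, rfl⟩ := Ideal.mem_span_singleton'.1 hw
        rw [mul_left_comm]; exact Ideal.mul_mem_left _ _ (hzm r hr)
    rw [ell_colon hu, ell_colon hu', ell_maximalIdeal, ell_maximalIdeal]
    congr 1
    have e : K.map f ⊔ Ideal.span {f z} = (K ⊔ Ideal.span {z}).map f := by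
      rw [Ideal.map_sup, Ideal.map_span, Set.image_singleton]
    rw [e]
    refine ih _ ?_ (hK.trans le_sup_left)
    refine lt_of_le_of_ne le_sup_left fun h => hz ?_
    rw [h]; exact Ideal.mem_sup_right (Ideal.mem_span_singleton_self z)
end

section
universe u
variable {R : Type u} [CommRing R] [IsLocalRing R] {d : ℕ}

/-- generic hyperplane section -/
structure Gen {R1 : Type u} [CommRing R1] [IsLocalRing R1] (a : Fin (d + 1) → R)
    (π : MvPolynomial (Fin d) R →+* R1) : Prop where
  den : ∀ y : R1, ∃ s, s ∉ (maximalIdeal R).map (MvPolynomial.C : R →+* MvPolynomial (Fin d) R) ∧ ∃ Y, π s * y = π Y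
  unit : ∀ s, s ∉ (maximalIdeal R).map (MvPolynomial.C : R →+* MvPolynomial (Fin d) R) → IsUnit (π s)
  ker : ∀ Y, π Y = 0 → ∃ s, s ∉ (maximalIdeal R).map (MvPolynomial.C : R →+* MvPolynomial (Fin d) R) ∧
    s * Y ∈ Ideal.span {gx a}
  gx0 : π (gx a) = 0
  max : maximalIdeal R1 = ((maximalIdeal R).map (MvPolynomial.C : R →+* MvPolynomial (Fin d) R)).map π

theorem gen_aux [IsNoetherianRing R] {a : Fin (d + 1) → R} (H : QRS a (maximalIdeal R))
    (P : Ideal (MvPolynomial (Fin d) R)) [hPp : P.IsPrime]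
    (hP : P = (maximalIdeal R).map (MvPolynomial.C : R →+* MvPolynomial (Fin d) R))
    (R' R1 : Type u) [CommRing R'] [IsLocalRing R'] [Algebra (MvPolynomial (Fin d) R) R'] [IsLocalization.AtPrime R' P]
    [CommRing R1] [IsLocalRing R1] (q : R' →+* R1) (hq : Function.Surjective q)
    (hkq : RingHom.ker q = Ideal.span {algebraMap (MvPolynomial (Fin d) R) R' (gx a)}) :
      ∃ (π : MvPolynomial (Fin d) R →+* R1), Gen a π ∧
      (∀ n, ell (V (JJ a) (n + 1)) = ell ((V (JJ a) (n + 1)).map (π.comp MvPolynomial.C)) + ell (V (JJ a) n)) ∧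
      ell ((JJ a).map (π.comp MvPolynomial.C)) = ell (JJ a) := by
  have HS := H.poly d
  let ι : MvPolynomial (Fin d) R →+* R' := algebraMap _ _
  let f : R →+* R' := ι.comp MvPolynomial.C
  have hfm : (maximalIdeal R).map f = maximalIdeal R' := by
    rw [← Ideal.map_map, ← hP]
    exact IsLocalization.AtPrime.map_eq_maximalIdeal P _
  have hmem : ∀ (K : Ideal (MvPolynomial (Fin d) R)) Y, ι Y ∈ K.map ι ↔ ∃ s, s ∉ P ∧ s * Y ∈ K := fun K Y =>
    IsLocalization.algebraMap_mem_map_algebraMap_iff P.primeCompl R' K Y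
  have hfc : ∀ K : Ideal R, ∀ z, f z ∈ K.map f → z ∈ K := by
    intro K z hz
    rw [← Ideal.map_map] at hz
    obtain ⟨s, hs, h⟩ := (hmem _ _).1 hz
    rw [hP, mem_mapC] at hs
    simp only [CIn, not_forall] at hs
    obtain ⟨α, hα⟩ := hs
    have h1 : MvPolynomial.coeff α (s * MvPolynomial.C z) ∈ K := mem_mapC.1 h α
    rw [mul_comm, MvPolynomial.coeff_C_mul] at h1
    rw [mem_maximalIdeal, mem_nonunits_iff, not_not] at hα
    exact (Ideal.mul_unit_mem_iff_mem K hα).1 h1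
  obtain ⟨x, hx⟩ : ∃ x, x = ι (gx a) := ⟨_, rfl⟩
  rw [show algebraMap (MvPolynomial (Fin d) R) R' (gx a) = x from hx.symm] at hkq
  have hcolon : ∀ n r, r * x ∈ (V (JJ a) (n+1)).map f ↔ r ∈ (V (JJ a) n).map f := by
    intro n r
    obtain ⟨⟨Y, s⟩, hY⟩ := IsLocalization.surj P.primeCompl r
    have hsu : IsUnit (ι s) := IsLocalization.map_units _ s
    rw [← Ideal.mul_unit_mem_iff_mem _ hsu, ← Ideal.mul_unit_mem_iff_mem ((V (JJ a) n).map f) hsu]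
    have e1 : r * ι s = ι Y := hY
    have e2 : r * x * ι s = ι (gx a * Y) := by rw [map_mul, ← hx, ← e1]; ring
    rw [e1, e2, ← Ideal.map_map, ← Ideal.map_map, hmem, hmem]
    refine exists_congr fun s => and_congr_right fun _ => ?_
    rw [← V_poly, ← V_poly, ← JJ_aC, mem_V, mem_V, mul_left_comm]
    have := HS.nrm_form xi_homog (xi_not H) (s * Y)
    rw [gx, this, pow_one, pow_succ']
    exact mul_le_mul_iff_right₀ (by norm_num)
  obtain ⟨c, hc⟩ := H.pow_le
  have hpl : ∀ n, maximalIdeal R ^ (c * n) ≤ V (JJ a) n := by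
    intro n
    rw [pow_mul]
    exact (Ideal.pow_right_mono hc n).trans (pow_le_V _ n)
  have hmq : ∀ K : Ideal R, ell (K.map ((q.comp ι).comp MvPolynomial.C)) = ell (K.map f ⊔ Ideal.span {x}) := by
    intro K
    have : K.map ((q.comp ι).comp MvPolynomial.C) = (K.map f ⊔ Ideal.span {x}).map q := by
      rw [Ideal.map_sup, Ideal.map_span, Set.image_singleton]
      have : q x = 0 := by rw [← RingHom.mem_ker, hkq]; exact Ideal.mem_span_singleton_self x
      rw [this, Ideal.span_singleton_zero, sup_bot_eq, Ideal.map_map]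
      rfl
    rw [this]
    exact ell_map_surj q hq (hkq.le.trans le_sup_right)
  have hmaxq : maximalIdeal (R1) = (maximalIdeal R').map q := by
    symm
    refine (IsLocalRing.eq_maximalIdeal ?_)
    refine (Ideal.map_eq_top_or_isMaximal_of_surjective q hq (maximalIdeal.isMaximal _)).resolve_left ?_
    intro h
    have h2 : (maximalIdeal R').map q ≤ maximalIdeal _ :=
      ((IsLocalRing.local_hom_TFAE q).out 0 2).1 (IsLocalHom.of_surjective q hq)
    rw [h] at h2
    exact (maximalIdeal.isMaximal _).ne_top (top_le_iff.1 h2)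
  refine ⟨q.comp ι, ?_, ?_, ?_⟩
  · refine ⟨?_, ?_, ?_, ?_, ?_⟩
    · intro y
      obtain ⟨y, rfl⟩ := hq y
      obtain ⟨⟨Y, s⟩, hY⟩ := IsLocalization.surj P.primeCompl y
      refine ⟨s, ?_, Y, ?_⟩
      · rw [← hP]; exact s.2
      · have e1 : y * ι s = ι Y := hY
        rw [RingHom.comp_apply, RingHom.comp_apply, ← e1, map_mul, mul_comm]
    · intro s hs
      rw [← hP] at hs
      exact (IsLocalization.map_units R' (⟨s, hs⟩ : P.primeCompl)).map q
    · intro Y hY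
      rw [← hP]
      rw [RingHom.comp_apply, ← RingHom.mem_ker, hkq, hx] at hY
      have : Ideal.span {ι (gx a)} = (Ideal.span {gx a}).map ι := by
        rw [Ideal.map_span, Set.image_singleton]
      rw [this] at hY
      exact (hmem _ _).1 hY
    · rw [RingHom.comp_apply, ← hx, ← RingHom.mem_ker, hkq]
      exact Ideal.mem_span_singleton_self x
    · rw [hmaxq, ← hfm, ← Ideal.map_map, ← Ideal.map_map, Ideal.map_map ι]
  · intro n
    rw [hmq, ← ell_map_local f hfm hfc _ _ (hpl (n+1)), ell_colon (hcolon n),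
      ← ell_map_local f hfm hfc _ _ (hpl n)]
  · rw [hmq, ← ell_map_local f hfm hfc _ _ hc]
    congr 1
    refine sup_eq_left.2 ?_
    rw [Ideal.span_singleton_le_iff_mem, hx, ← Ideal.map_map, ← JJ_aC]
    exact Ideal.mem_map_of_mem _ (gx_mem a)

theorem exists_gen [IsNoetherianRing R] {a : Fin (d + 1) → R} (H : QRS a (maximalIdeal R)) :
    ∃ (R1 : Type u) (_ : CommRing R1) (_ : IsLocalRing R1) (_ : IsNoetherianRing R1)
      (π : MvPolynomial (Fin d) R →+* R1), Gen a π ∧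
      (∀ n, ell (V (JJ a) (n + 1)) = ell ((V (JJ a) (n + 1)).map (π.comp MvPolynomial.C)) + ell (V (JJ a) n)) ∧
      ell ((JJ a).map (π.comp MvPolynomial.C)) = ell (JJ a) := by
  have HS := H.poly d
  obtain ⟨P, hP⟩ : ∃ P, P = (maximalIdeal R).map (MvPolynomial.C : R →+* MvPolynomial (Fin d) R) := ⟨_, rfl⟩
  have hPp : P.IsPrime := hP ▸ HS.prime
  obtain ⟨x, hx⟩ : ∃ x, x = algebraMap (MvPolynomial (Fin d) R) (Localization.AtPrime P) (gx a) := ⟨_, rfl⟩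
  have hxm : x ∈ maximalIdeal (Localization.AtPrime P) := by
    rw [hx, ← IsLocalization.AtPrime.map_eq_maximalIdeal P (Localization.AtPrime P)]
    refine Ideal.mem_map_of_mem _ ?_
    rw [hP]; exact HS.le (gx_mem a)
  have hnt : Nontrivial (Localization.AtPrime P ⧸ Ideal.span {x}) := by
    rw [Ideal.Quotient.nontrivial_iff]
    intro h
    rw [Ideal.eq_top_iff_one] at h
    have h2 : Ideal.span {x} ≤ maximalIdeal (Localization.AtPrime P) := by
      rw [Ideal.span_singleton_le_iff_mem]; exact hxm
    exact (maximalIdeal.isMaximal _).ne_top ((Ideal.eq_top_iff_one _).2 (h2 h))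
  have hq : Function.Surjective (Ideal.Quotient.mk (Ideal.span {x})) := Ideal.Quotient.mk_surjective
  have hloc : IsLocalRing (Localization.AtPrime P ⧸ Ideal.span {x}) := IsLocalRing.of_surjective' _ hq
  have hN : IsNoetherianRing (Localization.AtPrime P) :=
    IsLocalization.isNoetherianRing P.primeCompl _ inferInstance
  obtain ⟨π, h⟩ := gen_aux H P hP (Localization.AtPrime P) (Localization.AtPrime P ⧸ Ideal.span {x})
    (Ideal.Quotient.mk (Ideal.span {x})) hq (by rw [Ideal.mk_ker, hx])
  exact ⟨_, _, hloc, inferInstance, π, h⟩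
end
end Sally

namespace Sally
set_option linter.unusedSectionVars false
section
universe u
variable {R : Type u} [CommRing R] [IsLocalRing R] {d : ℕ} {R1 : Type u} [CommRing R1] [IsLocalRing R1]
  {a : Fin (d + 1) → R} {π : MvPolynomial (Fin d) R →+* R1}

lemma Gen.lift (g : Gen a π) (H : QRS a (maximalIdeal R)) (K : Ideal (MvPolynomial (Fin d) R)) {z : R1}
    (hz : z ∈ K.map π) : ∃ s, s ∉ (maximalIdeal R).map (MvPolynomial.C : R →+* MvPolynomial (Fin d) R) ∧
      ∃ Y ∈ K, π s * z = π Y := by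
  have hp := (H.poly d).prime
  have h1 : (1 : MvPolynomial (Fin d) R) ∉ (maximalIdeal R).map (MvPolynomial.C : R →+* MvPolynomial (Fin d) R) :=
    fun h => hp.ne_top ((Ideal.eq_top_iff_one _).2 h)
  have hmul : ∀ s t, s ∉ (maximalIdeal R).map (MvPolynomial.C : R →+* MvPolynomial (Fin d) R) →
      t ∉ (maximalIdeal R).map (MvPolynomial.C : R →+* MvPolynomial (Fin d) R) →
      s * t ∉ (maximalIdeal R).map (MvPolynomial.C : R →+* MvPolynomial (Fin d) R) :=
    fun s t hs ht h => (hp.mem_or_mem h).elim hs ht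
  rw [Ideal.map] at hz
  induction hz using Submodule.span_induction with
  | mem z hz =>
    obtain ⟨Y, hY, rfl⟩ := hz
    exact ⟨1, h1, Y, hY, by rw [map_one, one_mul]⟩
  | zero => exact ⟨1, h1, 0, zero_mem _, by rw [mul_zero, map_zero]⟩
  | add z z' _ _ h h' =>
    obtain ⟨s, hs, Y, hY, e⟩ := h
    obtain ⟨s', hs', Y', hY', e'⟩ := h'
    refine ⟨s * s', hmul _ _ hs hs', s' * Y + s * Y', add_mem (Ideal.mul_mem_left _ _ hY) (Ideal.mul_mem_left _ _ hY'), ?_⟩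
    rw [map_add, map_mul, map_mul, map_mul, ← e, ← e']; ring
  | smul r z _ h =>
    obtain ⟨s, hs, Y, hY, e⟩ := h
    obtain ⟨s', hs', Y', e'⟩ := g.den r
    refine ⟨s' * s, hmul _ _ hs' hs, Y' * Y, Ideal.mul_mem_left _ _ hY, ?_⟩
    rw [map_mul, map_mul, ← e, ← e', smul_eq_mul]; ring

lemma Gen.mem_map (g : Gen a π) (H : QRS a (maximalIdeal R)) {K : Ideal (MvPolynomial (Fin d) R)}
    {Y : MvPolynomial (Fin d) R} (hY : π Y ∈ K.map π) :
    ∃ s, s ∉ (maximalIdeal R).map (MvPolynomial.C : R →+* MvPolynomial (Fin d) R) ∧ s * Y ∈ K ⊔ Ideal.span {gx a} := by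
  have hp := (H.poly d).prime
  obtain ⟨s, hs, Y', hY', e⟩ := g.lift H K hY
  obtain ⟨t, ht, h⟩ := g.ker (s * Y - Y') (by rw [map_sub, map_mul, e, sub_self])
  refine ⟨t * s, fun h => (hp.mem_or_mem h).elim ht hs, ?_⟩
  have : t * s * Y = t * Y' + t * (s * Y - Y') := by ring
  rw [this]
  exact Submodule.add_mem_sup (Ideal.mul_mem_left _ _ hY') h

/-- the images -/
noncomputable def bb (a : Fin (d + 1) → R) (π : MvPolynomial (Fin d) R →+* R1) : Fin d → R1 :=
  fun j => π (MvPolynomial.C (a j.castSucc))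

lemma Gen.JJ_bb (g : Gen a π) : JJ (bb a π) = (JJ (aC d a)).map π := by
  apply le_antisymm
  · rw [JJ, Ideal.span_le]
    rintro _ ⟨j, rfl⟩
    exact Ideal.mem_map_of_mem _ (Ideal.subset_span ⟨j.castSucc, rfl⟩)
  · rw [JJ, Ideal.map_span, Ideal.span_le]
    rintro _ ⟨_, ⟨j, rfl⟩, rfl⟩
    induction j using Fin.lastCases with
    | cast j => exact Ideal.subset_span ⟨j, rfl⟩
    | last =>
      have h := g.gx0
      rw [gx_eq, map_sub, sub_eq_zero, map_sum] at h
      change π (MvPolynomial.C (a (Fin.last d))) ∈ _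
      rw [h]
      refine Ideal.sum_mem _ fun j _ => ?_
      rw [map_mul]
      exact Ideal.mul_mem_left _ _ (Ideal.subset_span ⟨j, rfl⟩)

lemma Gen.JJ_bb_pow (g : Gen a π) (n : ℕ) : JJ (bb a π) ^ n = (JJ (aC d a) ^ n).map π := by
  rw [g.JJ_bb, Ideal.map_pow]

lemma Gen.JJ_bb' (g : Gen a π) : JJ (bb a π) = (JJ a).map (π.comp MvPolynomial.C) := by
  rw [g.JJ_bb, JJ_aC, Ideal.map_map]

lemma Gen.common (g : Gen a π) (H : QRS a (maximalIdeal R)) {ι : Type*} [Fintype ι] (y : ι → R1) :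
    ∃ s, s ∉ (maximalIdeal R).map (MvPolynomial.C : R →+* MvPolynomial (Fin d) R) ∧
      ∃ Y : ι → MvPolynomial (Fin d) R, ∀ i, π s * y i = π (Y i) := by
  classical
  have hp := (H.poly d).prime
  choose s hs Y hY using fun i => g.den (y i)
  refine ⟨∏ i, s i, ?_, fun i => (∏ j ∈ univ.erase i, s j) * Y i, fun i => ?_⟩
  · intro h
    obtain ⟨i, _, hi⟩ := (hp.prod_mem_iff).1 h
    exact hs i hi
  · rw [map_mul, ← hY, ← Finset.mul_prod_erase _ _ (Finset.mem_univ i), map_mul]; ring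

lemma Gen.qrs (g : Gen a π) (H : QRS a (maximalIdeal R)) : QRS (bb a π) (maximalIdeal R1) where
  prime := (maximalIdeal.isMaximal R1).isPrime
  le := by rw [g.JJ_bb, g.max]; exact Ideal.map_mono (H.poly d).le
  pow_le := by
    obtain ⟨c, hc⟩ := (H.poly d).pow_le
    refine ⟨c, ?_⟩
    rw [g.max, g.JJ_bb, ← Ideal.map_pow]; exact Ideal.map_mono hc
  sat := by
    intro s b hs h
    rw [mem_maximalIdeal, mem_nonunits_iff, not_not] at hs
    exact (Ideal.unit_mul_mem_iff_mem _ hs).1 h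
  qr := by
    intro n f hf hfe
    rw [eq_ofCoeff hf] at hfe ⊢
    obtain ⟨c, hc⟩ : ∃ c, c = (fun s : Mon d n => f.coeff s.exp) := ⟨_, rfl⟩
    rw [← hc] at hfe ⊢
    obtain ⟨s, hs, Y, hY⟩ := g.common H c
    have e : π ((ofCoeff Y).eval (fun j => aC d a j.castSucc)) = π s * (ofCoeff c).eval (bb a π) := by
      rw [eval_ofCoeff, eval_ofCoeff, map_sum, Finset.mul_sum]
      refine Finset.sum_congr rfl fun t _ => ?_
      rw [map_mul, ← hY, mul_assoc]
      congr 2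
      simp only [mon, MvPolynomial.eval_monomial, one_mul, Finsupp.prod, map_prod, map_pow]
      rfl
    have h1 : π ((ofCoeff Y).eval (fun j => aC d a j.castSucc)) ∈ (JJ (aC d a) ^ (n+1)).map π := by
      rw [e, ← g.JJ_bb_pow]; exact Ideal.mul_mem_left _ _ hfe
    obtain ⟨t, ht, h2⟩ := g.mem_map H h1
    have h3 := Qpoly H (f := MvPolynomial.C t * ofCoeff Y) (n := n) (by
      simpa using (MvPolynomial.isHomogeneous_C (Fin d) t).mul (ofCoeff_homog Y)) (by
      rw [map_mul, MvPolynomial.eval_C]; exact h2)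
    have h4 := CIn.of_mul (H.poly d).sat (h := MvPolynomial.C t) (fun h => ht (by
        have := h 0
        rwa [MvPolynomial.coeff_C, if_pos rfl] at this)) h3
    rw [CIn_ofCoeff] at h4 ⊢
    intro t
    rw [← Ideal.unit_mul_mem_iff_mem _ (g.unit s hs), hY, g.JJ_bb]
    exact Ideal.mem_map_of_mem _ (h4 t)

/-- C1 restated -/
lemma Gen.C1' (g : Gen a π) (H : QRS a (maximalIdeal R)) (i : Fin d) {Y : MvPolynomial (Fin d) R}
    (hY : eps R i Y = Y) {p : ℕ} (h : π Y ∈ JJ (bb a π) ^ p) : Y ∈ JJ (aC d a) ^ p := by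
  rw [g.JJ_bb_pow] at h
  obtain ⟨s, hs, h⟩ := g.mem_map H h
  exact C1 H i hY hs h

lemma Gen.V_of (g : Gen a π) (H : QRS a (maximalIdeal R)) (i : Fin d) {Y : MvPolynomial (Fin d) R}
    (hY : eps R i Y = Y) {p : ℕ} (h : π Y ∈ V (JJ (bb a π)) p) :
    Y ∈ (V (JJ a) p).map (MvPolynomial.C : R →+* MvPolynomial (Fin d) R) := by
  rw [← V_poly, ← JJ_aC]
  rw [mem_V] at h ⊢
  refine (nrm_le_of fun s p h => ?_).trans h
  rw [← map_pow] at h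
  exact g.C1' H i (by rw [map_pow, hY]) h

/-- descend -/
lemma Gen.descend (g : Gen a π) (H : QRS a (maximalIdeal R)) (i : Fin d) {n k : ℕ}
    (h : V (JJ (bb a π)) k ≤ JJ (bb a π) ^ n) : V (JJ a) k ≤ JJ a ^ n := by
  intro y hy
  have h1 : (π.comp MvPolynomial.C) y ∈ V (JJ (bb a π)) k :=
    V_map_le (π.comp MvPolynomial.C) g.JJ_bb'.ge k (Ideal.mem_map_of_mem _ hy)
  have h2 := g.C1' H i (eps_C i y) (h h1)
  rw [JJ_aC, ← Ideal.map_pow, mem_mapC] at h2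
  have := h2 0
  rwa [MvPolynomial.coeff_C, if_pos rfl] at this

lemma Gen.elim_V (g : Gen a π) (H : QRS a (maximalIdeal R)) (i : Fin d) (Y : MvPolynomial (Fin d) R) :
    ∃ m₀ : ℕ, ∀ n ≥ m₀, ∀ N, π Y ∈ V (JJ (bb a π)) N → bb a π i ^ n * π Y ∈ (V (JJ a) (n + N)).map (π.comp MvPolynomial.C) := by
  obtain ⟨m₀, h⟩ := elim a i Y
  refine ⟨m₀, fun n hn N hY => ?_⟩
  obtain ⟨Z, hZ, hz⟩ := h n hn
  have e : bb a π i ^ n * π Y = π Z := by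
    have h1 : Ideal.span {gx a} ≤ RingHom.ker π := by
      rw [Ideal.span_singleton_le_iff_mem]; exact g.gx0
    have := h1 hz
    rw [RingHom.mem_ker, map_sub, sub_eq_zero, map_mul, map_pow] at this
    exact this
  rw [e, ← Ideal.map_map]
  refine Ideal.mem_map_of_mem _ (g.V_of H i hZ ?_)
  rw [← e]
  have hi : bb a π i ∈ JJ (bb a π) := Ideal.subset_span ⟨i, rfl⟩
  exact V_mul _ (Ideal.mul_mem_mul (pow_le_V _ n (Ideal.pow_mem_pow hi n)) hY)

/-- C3 -/
lemma Gen.rees (g : Gen a π) (H : QRS a (maximalIdeal R)) (i : Fin d) {c : ℕ}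
    (hc : ∀ n, V (JJ a) (n + c) ≤ JJ a ^ n) (N : ℕ) : V (JJ (bb a π)) (N + c) ≤ JJ (bb a π) ^ N := by
  intro y hy
  obtain ⟨s, hs, Y, hY⟩ := g.den y
  rw [← Ideal.unit_mul_mem_iff_mem _ (g.unit s hs)] at hy ⊢
  rw [hY] at hy ⊢
  obtain ⟨m₀, h⟩ := g.elim_V H i Y
  have h1 := h m₀ le_rfl _ hy
  rw [← add_assoc] at h1
  have h2 := Ideal.map_mono (f := π.comp MvPolynomial.C) (hc (m₀ + N)) h1
  rw [Ideal.map_pow, ← g.JJ_bb'] at h2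
  have H1 := g.qrs H
  refine H1.nzd (h := MvPolynomial.X i ^ m₀) (M := m₀) ?_ (CIn_X_pow H1.prime.ne_top i m₀) ?_
  · simpa using (MvPolynomial.isHomogeneous_X R1 i).pow m₀
  · rw [map_pow, MvPolynomial.eval_X]; exact h2

/-- pigeonhole -/
lemma JJ_pigeon {A : Type*} [CommRing A] (b : Fin d → A) {M k : ℕ} (hd : 1 ≤ d) (hk : d * M ≤ k) :
    JJ b ^ k ≤ ⨆ i, Ideal.span {b i ^ M} * JJ b ^ (k - M) := by
  classical
  refine (pow_le_span_mon b k).trans ?_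
  rw [Ideal.span_le]
  rintro _ ⟨s, rfl⟩
  obtain ⟨i, hi⟩ : ∃ i, M ≤ s.exp i := by
    by_contra hcon
    push Not at hcon
    have h1 := s.degree_exp
    rw [Finsupp.degree_eq_sum] at h1
    have : (univ : Finset (Fin d)).Nonempty := ⟨⟨0, hd⟩, mem_univ _⟩
    have h2 := Finset.sum_lt_sum_of_nonempty this (fun i _ => hcon i)
    simp at h2
    omega
  refine Ideal.mem_iSup_of_mem i ?_
  have h1 : s.exp = Finsupp.single i M + (s.exp - Finsupp.single i M) := by
    rw [add_tsub_cancel_of_le]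
    exact Finsupp.single_le_iff.2 hi
  have h2 : mon b s = b i ^ M * (MvPolynomial.monomial (s.exp - Finsupp.single i M) (1:A)).eval b := by
    rw [mon]
    conv_lhs => rw [h1]
    rw [← one_mul (1:A), ← MvPolynomial.monomial_mul, map_mul, one_mul]
    congr 1
    rw [MvPolynomial.eval_monomial]; simp
  change mon b s ∈ _
  rw [h2]
  refine Ideal.mul_mem_mul (Ideal.mem_span_singleton_self _) (eval_mem_pow b (MvPolynomial.isHomogeneous_monomial _ ?_))
  have h3 := s.degree_exp
  rw [h1, map_add, Finsupp.degree_single] at h3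
  omega

/-- C4 -/
lemma Gen.V_eventually [IsNoetherianRing R1] (g : Gen a π) (H : QRS a (maximalIdeal R)) (hd : 1 ≤ d) {c : ℕ}
    (hc : ∀ n, V (JJ a) (n + c) ≤ JJ a ^ n) :
    ∃ N₀, ∀ N ≥ N₀, V (JJ (bb a π)) N = (V (JJ a) N).map (π.comp MvPolynomial.C) := by
  obtain ⟨n₀, hst⟩ := stable_filtration (J := JJ (bb a π)) (fun n => V (JJ (bb a π)) n)
    (fun p => V_anti _ (Nat.le_succ p)) (fun p => by
      have h1 : JJ (bb a π) ≤ V (JJ (bb a π)) 1 := by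
        have := pow_le_V (JJ (bb a π)) 1
        rwa [pow_one] at this
      refine (Ideal.mul_mono_left h1).trans ?_
      rw [add_comm p 1]
      exact V_mul _) c (fun p => by
      by_cases h : c ≤ p
      · have := g.rees H ⟨0, hd⟩ hc (p - c)
        rwa [Nat.sub_add_cancel h] at this
      · rw [Nat.sub_eq_zero_of_le (by omega), pow_zero, Ideal.one_eq_top]; exact le_top)
  obtain ⟨k, y, hy⟩ := Submodule.fg_iff_exists_fin_generating_family.1
      ((isNoetherianRing_iff_ideal_fg R1).1 inferInstance (V (JJ (bb a π)) n₀))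
  obtain ⟨s, hs, Y, hY⟩ := g.common H y
  choose m₀ hm₀ using fun (p : Fin d × Fin k) => g.elim_V H p.1 (Y p.2)
  obtain ⟨M, hM⟩ : ∃ M, ∀ p, m₀ p ≤ M := ⟨∑ p, m₀ p, fun p => Finset.single_le_sum (fun _ _ => Nat.zero_le _) (mem_univ p)⟩
  refine ⟨n₀ + (d + 1) * M, fun N hN => le_antisymm ?_ (V_map_le _ g.JJ_bb'.ge N)⟩
  obtain ⟨t, rfl⟩ : ∃ t, N = n₀ + t := ⟨N - n₀, by omega⟩
  have ht : (d + 1) * M ≤ t := by omega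
  have htM : M ≤ t := by nlinarith
  have hst' : V (JJ (bb a π)) (n₀ + t) = JJ (bb a π) ^ t * V (JJ (bb a π)) n₀ :=
    stable_pow (F := fun n => V (JJ (bb a π)) n) hst n₀ t le_rfl
  rw [hst']
  have hgen : ∀ i, Ideal.span {bb a π i ^ M} * V (JJ (bb a π)) n₀ ≤ (V (JJ a) (M + n₀)).map (π.comp MvPolynomial.C) := by
    intro i
    rw [← hy]
    change Ideal.span _ * Ideal.span _ ≤ _
    rw [Ideal.span_mul_span', Ideal.span_le]
    rintro _ ⟨_, rfl, _, ⟨j, rfl⟩, rfl⟩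
    have hyj : y j ∈ V (JJ (bb a π)) n₀ := by rw [← hy]; exact Submodule.subset_span ⟨j, rfl⟩
    change bb a π i ^ M * y j ∈ Ideal.map (π.comp MvPolynomial.C) (V (JJ a) (M + n₀))
    rw [← Ideal.unit_mul_mem_iff_mem _ (g.unit s hs), mul_left_comm, hY]
    refine hm₀ (i, j) M (hM _) n₀ ?_
    rw [← hY]; exact Ideal.mul_mem_left _ _ hyj
  refine (Ideal.mul_mono_left (JJ_pigeon (bb a π) (M := M) hd (by nlinarith))).trans ?_
  rw [Ideal.iSup_mul]
  refine iSup_le fun i => ?_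
  rw [mul_right_comm]
  refine (Ideal.mul_mono_left (hgen i)).trans ?_
  rw [g.JJ_bb', ← Ideal.map_pow, ← Ideal.map_mul]
  refine Ideal.map_mono ((Ideal.mul_mono_right (pow_le_V _ _)).trans ((V_mul _).trans (V_anti _ (by omega))))

end
end Sally

namespace Sally
set_option linter.unusedSectionVars false
section
universe u

lemma poly_diff (d : ℕ) (e : ℕ → ℤ) (n : ℕ) :
    ∑ i ∈ range (d + 2), (-1 : ℤ) ^ i * e i * ((n + 1 + (d + 1) - i).choose (d + 1 - i)) -
      ∑ i ∈ range (d + 2), (-1 : ℤ) ^ i * e i * ((n + (d + 1) - i).choose (d + 1 - i)) =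
      ∑ i ∈ range (d + 1), (-1 : ℤ) ^ i * e i * ((n + 1 + d - i).choose (d - i)) := by
  rw [Finset.sum_range_succ, Finset.sum_range_succ (n := d + 1)]
  have h0 : d + 1 - (d + 1) = 0 := by omega
  rw [h0, Nat.choose_zero_right, Nat.choose_zero_right, add_sub_add_right_eq_sub, ← Finset.sum_sub_distrib]
  refine Finset.sum_congr rfl fun i hi => ?_
  have hi' : i ≤ d := by have := Finset.mem_range.1 hi; omega
  obtain ⟨k, rfl⟩ : ∃ k, d = i + k := ⟨d - i, by omega⟩
  have e1 : n + 1 + (i + k + 1) - i = (n + 1 + k) + 1 := by omega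
  have e2 : i + k + 1 - i = k + 1 := by omega
  have e3 : n + (i + k + 1) - i = n + 1 + k := by omega
  have e4 : n + 1 + (i + k) - i = n + 1 + k := by omega
  have e5 : i + k - i = k := by omega
  rw [e1, e2, e3, e4, e5, Nat.choose_succ_succ]
  push_cast; ring

theorem P8 (k : ℕ) : ∀ (R : Type u) [CommRing R] [IsLocalRing R] [IsNoetherianRing R] (a : Fin (k + 3) → R)
    (_ : QRS a (maximalIdeal R)) (e₀ : ℕ) (_ : ell (JJ a) = e₀) (e : ℕ → ℤ) (_ : (e₀ : ℤ) ≤ e 0) (_ : e 3 = 0)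
    (L : ℕ → ℕ) (n₁ : ℕ) (_ : ∀ n ≥ n₁, ell (V (JJ a) (n + 1)) = L n)
    (_ : ∀ n ≥ n₁, (L n : ℤ) = ∑ i ∈ range (k + 3 + 1), (-1 : ℤ) ^ i * e i * ((n + (k + 3) - i).choose (k + 3 - i)))
    (c : ℕ) (_ : ∀ n, V (JJ a) (n + c) ≤ JJ a ^ n) (n : ℕ), V (JJ a) (n + 2) ≤ JJ a ^ n := by
  induction k with
  | zero =>
    intro R _ _ _ a H e₀ he e he0 he3 L n₁ hL hp c hc n
    have hp' : ∀ n ≥ n₁, (L n : ℤ) = ∑ i ∈ range 4, (-1 : ℤ) ^ i * e i * ((n + 3 - i).choose (3 - i)) := by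
      simpa using hp
    exact P7 H he he0 he3 hL hp' n
  | succ k ih =>
    intro R _ _ _ a H e₀ he e he0 he3 L n₁ hL hp c hc n
    obtain ⟨R1, _, _, _, π, g, h1, h2⟩ := exists_gen (d := k + 3) (a := a) H
    obtain ⟨N₀, hN₀⟩ := g.V_eventually H (by omega) hc
    refine g.descend H ⟨0, by omega⟩ ?_
    refine ih R1 (bb a π) (g.qrs H) e₀ ?_ e he0 he3 (fun n => L n - L (n - 1)) (n₁ + N₀ + 1) ?_ ?_ c
      (g.rees H ⟨0, by omega⟩ hc) n
    · rw [g.JJ_bb', h2, he]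
    · intro n hn
      obtain ⟨n, rfl⟩ : ∃ t, n = t + 1 := ⟨n - 1, by omega⟩
      have := h1 (n + 1)
      rw [hL _ (by omega), hL _ (by omega), ← hN₀ _ (by omega)] at this
      have hne : ell (V (JJ (bb a π)) (n + 1 + 1)) ≠ ⊤ := fun h => by
        rw [h, top_add] at this; exact ENat.natCast_ne_top _ this
      obtain ⟨x, hx⟩ := ENat.ne_top_iff_exists.1 hne
      rw [← hx] at this ⊢
      have h3 : L (n + 1) = x + L n := by exact_mod_cast this
      simp [h3]
    · intro n hn
      obtain ⟨n, rfl⟩ : ∃ t, n = t + 1 := ⟨n - 1, by omega⟩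
      have := h1 (n + 1)
      rw [hL _ (by omega), hL _ (by omega)] at this
      have h3 : L n ≤ L (n + 1) := by
        have : (L n : ℕ∞) ≤ L (n + 1) := by rw [this]; exact le_add_self
        exact_mod_cast this
      have := poly_diff (k + 3) e n
      rw [Nat.add_sub_cancel, Nat.cast_sub h3, hp _ (by omega), hp _ (by omega), ← this]
end
end Sally

namespace Sally
set_option linter.unusedSectionVars false
section

lemma choose_grow (k N c : ℕ) : (N + c + k + 1).choose (k + 1) ≤ (N + k + 1).choose (k + 1) + c * (N + c + k).choose k := by
  induction c with
  | zero => simp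
  | succ c ih =>
    have e : N + (c + 1) + k + 1 = (N + c + k + 1) + 1 := by omega
    rw [e, Nat.choose_succ_succ]
    have h1 : (N + c + k).choose k ≤ (N + (c + 1) + k).choose k := Nat.choose_le_choose k (by omega)
    have h2 : (N + (c + 1) + k).choose k = (N + c + k + 1).choose k := by congr 1; omega
    rw [h2] at h1 ⊢
    nlinarith

lemma lead_le {k e₀ c n₁ : ℕ} {e : ℕ → ℤ}
    (h : ∀ n ≥ n₁, ((e₀ * (n + k + 1).choose (k + 1) : ℕ) : ℤ) ≤
      ∑ i ∈ range (k + 2), (-1 : ℤ) ^ i * e i * ((n + c + (k + 1) - i).choose (k + 1 - i))) : (e₀ : ℤ) ≤ e 0 := by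
  by_contra hlt
  push Not at hlt
  obtain ⟨E, hE⟩ : ∃ E : ℕ, E = ∑ i ∈ range (k + 1), (e (i + 1)).natAbs := ⟨_, rfl⟩
  obtain ⟨n, hn⟩ : ∃ n : ℕ, n = n₁ + (E + c * e₀) * (k + 1) := ⟨_, rfl⟩
  have h1 := h n (by rw [hn]; omega)
  have hg := choose_grow k n c
  obtain ⟨B, hB⟩ : ∃ B, B = (n + c + k).choose k := ⟨_, rfl⟩
  obtain ⟨D, hD⟩ : ∃ D, D = (n + c + k + 1).choose (k + 1) := ⟨_, rfl⟩
  have hBpos : 0 < B := by rw [hB]; exact Nat.choose_pos (by omega)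
  have hDB : (n + c + k + 1) * B = D * (k + 1) := by rw [hB, hD]; exact Nat.add_one_mul_choose_eq _ _
  rw [Finset.sum_range_succ'] at h1
  have h2 : ∑ i ∈ range (k + 1), (-1 : ℤ) ^ (i + 1) * e (i + 1) * ((n + c + (k + 1) - (i + 1)).choose (k + 1 - (i + 1))) ≤
      E * B := by
    rw [hE]
    rw [Nat.cast_sum, Finset.sum_mul]
    refine Finset.sum_le_sum fun i hi => ?_
    rw [Int.natCast_natAbs]
    have hi' : i ≤ k := by have := Finset.mem_range.1 hi; omega
    have h3 : (n + c + (k + 1) - (i + 1)).choose (k + 1 - (i + 1)) ≤ B := by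
      obtain ⟨j, rfl⟩ : ∃ j, k = i + j := ⟨k - i, by omega⟩
      rw [hB, show n + c + (i + j + 1) - (i + 1) = n + c + j by omega, show i + j + 1 - (i + 1) = j by omega,
        ← Nat.choose_symm_add, ← Nat.choose_symm_add (a := n + c)]
      exact Nat.choose_le_choose _ (by omega)
    have h4 : (-1 : ℤ) ^ (i + 1) * e (i + 1) ≤ |e (i + 1)| := by
      refine (le_abs_self _).trans ?_
      rw [abs_mul, abs_pow, abs_neg, abs_one, one_pow, one_mul]
    have h5 : (((n + c + (k + 1) - (i + 1)).choose (k + 1 - (i + 1)) : ℕ) : ℤ) ≤ B := by exact_mod_cast h3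
    calc _ ≤ |e (i + 1)| * (((n + c + (k + 1) - (i + 1)).choose (k + 1 - (i + 1)) : ℕ) : ℤ) :=
          mul_le_mul_of_nonneg_right h4 (by positivity)
      _ ≤ _ := mul_le_mul_of_nonneg_left h5 (abs_nonneg _)
  have e1 : n + c + (k + 1) - 0 = n + c + k + 1 := by omega
  rw [e1, Nat.sub_zero, ← hD, pow_zero, one_mul] at h1
  rw [← hD, ← hB] at hg
  obtain ⟨F, hF⟩ : ∃ F, F = (n + k + 1).choose (k + 1) := ⟨_, rfl⟩
  rw [← hF] at h1 hg
  have h6 : (e 0) * D ≤ (e₀ - 1) * D := mul_le_mul_of_nonneg_right (by omega) (by positivity)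
  have h7 : (D : ℤ) ≤ F + c * B := by exact_mod_cast hg
  rw [Nat.cast_mul] at h1
  have h8 : (D : ℤ) ≤ (E + c * e₀) * B := by
    have h11 := mul_le_mul_of_nonneg_left h7 (by positivity : (0:ℤ) ≤ e₀)
    have h12 := h1.trans (add_le_add h2 h6)
    linarith
  have h9 : D ≤ (E + c * e₀) * B := by exact_mod_cast h8
  have h10 : (n + c + k + 1) * B ≤ (E + c * e₀) * (k + 1) * B := by
    rw [hDB]; nlinarith
  have := Nat.le_of_mul_le_mul_right h10 hBpos
  omega

variable {R : Type*} [CommRing R] [IsLocalRing R] [IsNoetherianRing R] {d : ℕ} {a : Fin d → R}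

theorem P5c (hR : IsReduced (AdicCompletion (maximalIdeal R) R)) (hd : 1 ≤ d) (H : QRS a (maximalIdeal R))
    {e₀ : ℕ} (he : ell (JJ a) = e₀) : ∃ c, ∀ n, V (JJ a) (n + c) ≤ JJ a ^ n := by
  obtain ⟨n₀, h⟩ := P5b hR hd H he
  refine ⟨n₀, fun n => ?_⟩
  have h2 : V (JJ a) (n₀ + n) = JJ a ^ n * V (JJ a) n₀ := stable_pow (F := V (JJ a)) h n₀ n le_rfl
  rw [add_comm, h2]
  exact (Ideal.mul_le_inf : JJ a ^ n * V (JJ a) n₀ ≤ _).trans inf_le_left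

theorem lead (H : QRS a (maximalIdeal R)) (hd : 1 ≤ d)
    {e₀ : ℕ} (he : ell (JJ a) = e₀) {c : ℕ} (hc : ∀ n, V (JJ a) (n + c) ≤ JJ a ^ n) {e : ℕ → ℤ} {L : ℕ → ℕ} {n₁ : ℕ}
    (hL : ∀ n ≥ n₁, ell (V (JJ a) (n + 1)) = L n)
    (hp : ∀ n ≥ n₁, (L n : ℤ) = ∑ i ∈ range (d + 1), (-1 : ℤ) ^ i * e i * ((n + d - i).choose (d - i))) :
    (e₀ : ℤ) ≤ e 0 := by
  obtain ⟨k, rfl⟩ : ∃ k, d = k + 1 := ⟨d - 1, by omega⟩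
  refine lead_le (k := k) (c := c) (n₁ := n₁) fun n hn => ?_
  rw [← hp (n + c) (by omega)]
  have h1 := ell_mono (hc (n + 1))
  rw [show n + 1 + c = n + c + 1 by omega, hL _ (by omega), H.ell_pow, he, sum_multichoose, Nat.multichoose_eq] at h1
  have h2 : (k + 1 + 1 + n - 1).choose n * e₀ ≤ L (n + c) := by exact_mod_cast h1
  have h3 : (k + 1 + 1 + n - 1).choose n = (n + k + 1).choose (k + 1) := by
    rw [show k + 1 + 1 + n - 1 = n + (k + 1) by omega, Nat.choose_symm_add]
    rfl
  rw [h3, mul_comm] at h2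
  exact_mod_cast h2
end
end Sally

namespace Sally
set_option linter.unusedSectionVars false
section
universe u
open scoped Pointwise
variable {R : Type u} [CommRing R] [IsLocalRing R] [IsNoetherianRing R]

lemma ass_step {M : Type*} [AddCommGroup M] [Module R M] [Module.Finite R M] {x : R}
    (hx : IsSMulRegular M x) (hxm : x ∈ maximalIdeal R) {P : Ideal R}
    (hP : P ∈ associatedPrimes R M) :
    ∃ Q ∈ associatedPrimes R (QuotSMulTop x M), P ≤ Q ∧ x ∈ Q := by
  have : IsNoetherian R M := isNoetherian_of_isNoetherianRing_of_finite R M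
  obtain ⟨hPp, y, hy⟩ := isAssociatedPrime_iff.1 (AssociatedPrimes.mem_iff.1 hP)
  obtain ⟨K, hK⟩ : ∃ K : Submodule R M, ∀ z, z ∈ K ↔ ∀ p ∈ P, p • z = 0 :=
    ⟨{ carrier := {z | ∀ p ∈ P, p • z = 0}
       add_mem' := fun {a b} ha hb p hp => by rw [smul_add, ha p hp, hb p hp, add_zero]
       zero_mem' := fun p _ => smul_zero p
       smul_mem' := fun c z hz p hp => by rw [smul_comm, hz p hp, smul_zero] }, fun z => Iff.rfl⟩
  have hyK : y ∈ K := by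
    rw [hK]
    intro p hp
    rw [hy, Submodule.mem_colon_singleton] at hp
    simpa using hp
  have hy0 : y ≠ 0 := by
    rintro rfl
    apply hPp.ne_top
    rw [hy]
    ext r
    simp [Submodule.mem_colon_singleton]
  have hnot : ¬ K ≤ x • (⊤ : Submodule R M) := by
    intro hle
    have hle2 : K ≤ Ideal.span {x} • K := by
      intro z hz
      obtain ⟨w, -, hw⟩ := (Submodule.mem_smul_pointwise_iff_exists _ _ _).1 (hle hz)
      rw [← hw]
      refine Submodule.smul_mem_smul (Ideal.mem_span_singleton_self x) ?_
      rw [hK]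
      intro p hp
      apply hx
      have := (hK z).1 hz p hp
      rw [← hw, smul_comm] at this
      simpa using this
    have := Submodule.eq_bot_of_le_smul_of_le_jacobson_bot _ K (IsNoetherian.noetherian K) hle2
      (by rw [IsLocalRing.jacobson_eq_maximalIdeal _ bot_ne_top]; rwa [Ideal.span_singleton_le_iff_mem])
    rw [this] at hyK
    exact hy0 (by simpa using hyK)
  obtain ⟨z, hz, hzx⟩ := SetLike.not_le_iff_exists.1 hnot
  obtain ⟨w, hw⟩ : ∃ w : QuotSMulTop x M, w = Submodule.Quotient.mk z := ⟨_, rfl⟩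
  have hw0 : w ≠ 0 := by
    rw [hw]; intro h
    exact hzx ((Submodule.Quotient.mk_eq_zero _).1 h)
  obtain ⟨Q, hQ, hle⟩ := exists_le_isAssociatedPrime_of_isNoetherianRing R w hw0
  refine ⟨Q, hQ, fun p hp => hle ?_, hle ?_⟩
  · rw [Submodule.mem_colon_singleton, hw, ← Submodule.Quotient.mk_smul, (hK z).1 hz p hp]
    simp
  · rw [Submodule.mem_colon_singleton, hw, ← Submodule.Quotient.mk_smul, Submodule.mem_bot,
      Submodule.Quotient.mk_eq_zero]
    exact Submodule.smul_mem_pointwise_smul _ _ _ trivial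

lemma ass_dim (rs : List R) : ∀ {M : Type u} [AddCommGroup M] [Module R M] [Module.Finite R M]
    (_ : ∀ r ∈ rs, r ∈ maximalIdeal R) (_ : RingTheory.Sequence.IsRegular M rs) {P : Ideal R}
    (_ : P ∈ associatedPrimes R M), ((rs.length : ℕ) : WithBot ℕ∞) ≤ ringKrullDim (R ⧸ P) := by
  induction rs with
  | nil =>
    intro M _ _ _ _ _ P hP
    have := hP.1
    have : Nontrivial (R ⧸ P) := inferInstance
    simpa using ringKrullDim_nonneg_of_nontrivial
  | cons x rs ih =>
    intro M _ _ _ hm hreg P hP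
    rw [RingTheory.Sequence.isRegular_cons_iff] at hreg
    obtain ⟨Q, hQ, hPQ, hxQ⟩ := ass_step hreg.1 (hm x (by simp)) hP
    have h1 := ih (fun r hr => hm r (by simp [hr])) hreg.2 hQ
    have := hP.1
    have hxP : x ∉ P := by
      intro hx
      have : x ∈ ⋃ p ∈ associatedPrimes R M, (p : Set R) := by
        simp only [Set.mem_iUnion]
        exact ⟨P, hP, hx⟩
      rw [biUnion_associatedPrimes_eq_compl_regular] at this
      exact this hreg.1
    have h2 := ringKrullDim_succ_le_of_surjective (Ideal.Quotient.factor hPQ)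
      (Ideal.Quotient.factor_surjective hPQ) (r := Ideal.Quotient.mk P x)
      (mem_nonZeroDivisors_of_ne_zero (by rwa [Ne, Ideal.Quotient.eq_zero_iff_mem]))
      (by rw [Ideal.Quotient.factor_mk, Ideal.Quotient.eq_zero_iff_mem]; exact hxQ)
    refine le_trans ?_ h2
    rw [List.length_cons]
    push_cast
    gcongr

lemma dim_le_of_pow_le (P : Ideal R) [P.IsPrime] (as : List R) (c : ℕ)
    (h : maximalIdeal R ^ c ≤ Ideal.span {x | x ∈ as} ⊔ P) (ham : ∀ r ∈ as, r ∈ maximalIdeal R) :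
    ringKrullDim (R ⧸ P) ≤ ((as.length : ℕ) : WithBot ℕ∞) := by
  classical
  have : IsLocalRing (R ⧸ P) := IsLocalRing.of_surjective' _ Ideal.Quotient.mk_surjective
  have hmax : maximalIdeal (R ⧸ P) = (maximalIdeal R).map (Ideal.Quotient.mk P) :=
    (IsLocalRing.map_maximalIdeal_of_surjective _ Ideal.Quotient.mk_surjective).symm
  rw [← maximalIdeal_height_eq_ringKrullDim]
  obtain ⟨s, hs⟩ : ∃ s : Finset (R ⧸ P), s = (as.map (Ideal.Quotient.mk P)).toFinset := ⟨_, rfl⟩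
  have hspan : Ideal.span (s : Set (R ⧸ P)) = (Ideal.span {x | x ∈ as}).map (Ideal.Quotient.mk P) := by
    rw [Ideal.map_span, hs]
    congr 1
    ext z; simp
  have hmin : maximalIdeal (R ⧸ P) ∈ (Ideal.span (s : Set (R ⧸ P))).minimalPrimes := by
    refine ⟨⟨inferInstance, ?_⟩, ?_⟩
    · rw [hspan, hmax]
      exact Ideal.map_mono (Ideal.span_le.2 ham)
    · rintro q ⟨hq, hle⟩ -
      have : maximalIdeal (R ⧸ P) ^ c ≤ q := by
        refine le_trans ?_ hle
        rw [hspan, hmax, ← Ideal.map_pow]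
        refine (Ideal.map_mono h).trans ?_
        rw [Ideal.map_sup, Ideal.map_quotient_self, sup_bot_eq]
      exact hq.le_of_pow_le this
  have h1 := Ideal.height_le_card_of_mem_minimalPrimes_span_finset hmin
  have h2 : s.card ≤ as.length := by
    rw [hs]
    exact (List.toFinset_card_le _).trans (by simp)
  exact_mod_cast h1.trans (by exact_mod_cast h2)

open CategoryTheory Abelian Limits in
lemma sop_regular (as : List R) : ∀ {M : Type u} [AddCommGroup M] [Module R M] [Module.Finite R M]
    [Nontrivial M]
    (_ : ∀ r ∈ as, r ∈ maximalIdeal R)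
    (_ : ∃ c, maximalIdeal R ^ c ≤ Ideal.span {x | x ∈ as} ⊔ Module.annihilator R M)
    (_ : ∃ rs : List R, rs.length = as.length ∧ (∀ r ∈ rs, r ∈ maximalIdeal R) ∧
      RingTheory.Sequence.IsRegular M rs),
    RingTheory.Sequence.IsRegular M as := by
  induction as with
  | nil => intro M _ _ _ _ _ _ _; exact RingTheory.Sequence.IsRegular.nil R M
  | cons a as ih =>
    intro M _ _ _ _ ham ⟨c, hc⟩ ⟨rs, hlen, hrm, hreg⟩
    have hann : Module.annihilator R M ⊔ Ideal.span {a} ≤ Module.annihilator R (QuotSMulTop a M) := by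
      refine sup_le ?_ ?_
      · intro r hr
        rw [Module.mem_annihilator] at hr ⊢
        intro z
        obtain ⟨z, rfl⟩ := Submodule.Quotient.mk_surjective _ z
        rw [← Submodule.Quotient.mk_smul, hr, Submodule.Quotient.mk_zero]
      · rw [Ideal.span_singleton_le_iff_mem, Module.mem_annihilator]
        intro z
        obtain ⟨z, rfl⟩ := Submodule.Quotient.mk_surjective _ z
        rw [← Submodule.Quotient.mk_smul, Submodule.Quotient.mk_eq_zero]
        exact Submodule.smul_mem_pointwise_smul _ _ _ trivial
    have hcons : Ideal.span {x | x ∈ a :: as} = Ideal.span {a} ⊔ Ideal.span {x | x ∈ as} := by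
      rw [← Ideal.span_union]
      congr 1
      ext z; simp
    have haM : IsSMulRegular M a := by
      by_contra hcon
      have : a ∈ ⋃ p ∈ associatedPrimes R M, (p : Set R) := by
        rw [biUnion_associatedPrimes_eq_compl_regular]; exact hcon
      simp only [Set.mem_iUnion] at this
      obtain ⟨P, hP, haP⟩ := this
      have := hP.1
      have h1 := ass_dim rs hrm hreg hP
      have h2 := dim_le_of_pow_le P as c (hc.trans (by
        rw [hcons]
        refine sup_le (sup_le ?_ le_sup_left) ?_
        · rw [Ideal.span_singleton_le_iff_mem]; exact Ideal.mem_sup_right haP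
        · have hPa := IsAssociatedPrime.annihilator_le hP
          rw [Submodule.annihilator_top] at hPa
          exact hPa.trans le_sup_right))
        (fun r hr => ham r (by simp [hr]))
      have h3 := h1.trans h2
      rw [hlen, List.length_cons] at h3
      have h4 : as.length + 1 ≤ as.length := by exact_mod_cast h3
      omega
    have ham0 : a ∈ maximalIdeal R := ham a (by simp)
    have : Nontrivial (QuotSMulTop a M) := nontrivial_quotSMulTop_of_mem_maximalIdeal M ham0
    rw [RingTheory.Sequence.isRegular_cons_iff]
    refine ⟨haM, ih (fun r hr => ham r (by simp [hr])) ⟨c, hc.trans ?_⟩ ?_⟩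
    · rw [hcons]
      refine sup_le (sup_le ?_ le_sup_left) ?_
      · exact (le_sup_right.trans hann).trans le_sup_right
      · exact (le_sup_left.trans hann).trans le_sup_right
    · have lt_of : ∀ (N : Type u) [AddCommGroup N] [Module R N] [Module.Finite R N] [Nontrivial N],
          maximalIdeal R • (⊤ : Submodule R N) < ⊤ := by
        intro N _ _ _ _
        refine lt_top_iff_ne_top.2 (Ne.symm ?_)
        exact Submodule.top_ne_ideal_smul_of_le_jacobson_annihilator (maximalIdeal_le_jacobson _)
      have t1 := (ModuleCat.exists_isRegular_tfae (maximalIdeal R) (as.length + 1) (ModuleCat.of R M)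
        (lt_of M)).out 3 1
      have t2 := (ModuleCat.exists_isRegular_tfae (maximalIdeal R) as.length
        (ModuleCat.of R (QuotSMulTop a M)) (lt_of (QuotSMulTop a M))).out 1 3
      have h_ext := t1.1 ⟨rs, by rw [hlen]; simp, hrm, hreg⟩
      refine t2.1 ?_
      intro i hi
      have zero1 := AddCommGrpCat.isZero_of_iff_subsingleton.mpr (h_ext i (by omega))
      have zero2 := AddCommGrpCat.isZero_of_iff_subsingleton.mpr (h_ext (i + 1) (by omega))
      exact AddCommGrpCat.subsingleton_of_isZero <| ShortComplex.Exact.isZero_of_both_zeros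
        ((Ext.covariant_sequence_exact₃' _ (IsSMulRegular.smulShortComplex_shortExact (M := ModuleCat.of R M) haM)) i (i + 1) rfl)
        (zero1.eq_zero_of_src _) (zero2.eq_zero_of_tgt _)

lemma exists_reg {d : ℕ} (hdim : ringKrullDim R = d) (hCM : IsCMLocal R) :
    ∃ rs : List R, rs.length = d ∧ (∀ r ∈ rs, r ∈ maximalIdeal R) ∧
      RingTheory.Sequence.IsRegular R rs := by
  rw [IsCMLocal, hdim] at hCM
  have h : rdepth R (maximalIdeal R) R = d := by exact_mod_cast hCM
  unfold rdepth at h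
  have hne : Nonempty {n : ℕ∞ | ∃ rs : List R, (rs.length : ℕ∞) = n ∧ (∀ x ∈ rs, x ∈ maximalIdeal R) ∧
      RingTheory.Sequence.IsRegular R rs} := ⟨⟨0, [], by simp, by simp, RingTheory.Sequence.IsRegular.nil R R⟩⟩
  have := ENat.sSup_mem_of_nonempty_of_lt_top (s := {n : ℕ∞ | ∃ rs : List R, (rs.length : ℕ∞) = n ∧ (∀ x ∈ rs, x ∈ maximalIdeal R) ∧
      RingTheory.Sequence.IsRegular R rs}) (by rw [h]; exact ENat.coe_lt_top d)
  rw [h] at this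
  obtain ⟨rs, h1, h2, h3⟩ := this
  exact ⟨rs, by exact_mod_cast h1, h2, h3⟩

lemma sop_regular' {d : ℕ} (hdim : ringKrullDim R = d) (hCM : IsCMLocal R) (a : Fin d → R)
    (ha : JJ a ≤ maximalIdeal R) (hc : ∃ c, maximalIdeal R ^ c ≤ JJ a) :
    RingTheory.Sequence.IsRegular R (List.ofFn a) := by
  have hs : Ideal.span {x | x ∈ List.ofFn a} = JJ a := by
    unfold JJ; congr 1; ext z; simp [List.mem_ofFn]
  refine sop_regular (List.ofFn a) ?_ ?_ ?_
  · intro r hr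
    apply ha
    rw [← hs]
    exact Ideal.subset_span hr
  · obtain ⟨c, hc⟩ := hc
    exact ⟨c, hc.trans (by rw [hs]; exact le_sup_left)⟩
  · simpa using exists_reg hdim hCM

end
end Sally

namespace Sally
set_option linter.unusedSectionVars false
section
variable {R : Type*} [CommRing R]

/-- weak regularity in the reversed order -/
def RevReg : (d : ℕ) → (Fin d → R) → Prop
  | 0, _ => True
  | d + 1, a => (∀ y, a 0 * y ∈ JJ (fun i : Fin d => a i.succ) → y ∈ JJ (fun i : Fin d => a i.succ)) ∧
      RevReg d (fun i => a i.succ)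

lemma hom_split {d n : ℕ} {F : MvPolynomial (Fin (d + 1)) R} (hF : F.IsHomogeneous (n + 1)) :
    ∃ (H : MvPolynomial (Fin (d + 1)) R) (G : MvPolynomial (Fin d) R), H.IsHomogeneous n ∧
      G.IsHomogeneous (n + 1) ∧ (∀ a : Fin (d + 1) → R, F.eval a = a 0 * H.eval a +
        G.eval (fun i => a i.succ)) ∧ ∀ K : Ideal R, CIn K H → CIn K G → CIn K F := by
  obtain ⟨H, hH⟩ : ∃ H, H = MvPolynomial.divMonomial F (Finsupp.single 0 1) := ⟨_, rfl⟩
  obtain ⟨G, hG⟩ : ∃ G, G = (MvPolynomial.finSuccEquiv R d F).coeff 0 := ⟨_, rfl⟩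
  have hHc : ∀ m, H.coeff m = F.coeff (Finsupp.single 0 1 + m) := by
    intro m; rw [hH, MvPolynomial.coeff_divMonomial]
  have hGc : ∀ m, G.coeff m = F.coeff (m.cons 0) := by
    intro m; rw [hG, MvPolynomial.finSuccEquiv_coeff_coeff]
  have key : ∀ (i : ℕ) (m : Fin d →₀ ℕ), (Finsupp.single 0 1 + m.cons i : Fin (d + 1) →₀ ℕ) = m.cons (i + 1) := by
    intro i m
    ext j
    refine Fin.cases ?_ (fun j => ?_) j
    · simp [add_comm]
    · simp
  have hdec : MvPolynomial.finSuccEquiv R d F = Polynomial.X * MvPolynomial.finSuccEquiv R d H + Polynomial.C G := by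
    ext i m
    cases i with
    | zero => simp [hG]
    | succ i =>
      rw [Polynomial.coeff_add, Polynomial.coeff_X_mul, MvPolynomial.coeff_add,
        MvPolynomial.finSuccEquiv_coeff_coeff, MvPolynomial.finSuccEquiv_coeff_coeff, hHc, key]
      simp
  refine ⟨H, G, ?_, ?_, ?_, ?_⟩
  · intro m hm
    rw [hHc] at hm
    have := hF hm
    rw [map_add, Finsupp.weight_single] at this
    have h1 : (1 : ℕ) • (1 : Fin (d + 1) → ℕ) 0 = 1 := by simp
    rw [h1] at this
    omega
  · rw [hG]
    exact hF.finSuccEquiv_coeff_isHomogeneous 0 (n + 1) (by omega)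
  · intro a
    have ha : a = Fin.cons (a 0) (fun i => a i.succ) := by
      ext j; refine Fin.cases rfl (fun j => rfl) j
    have e1 := MvPolynomial.eval_eq_eval_mv_eval' (fun i : Fin d => a i.succ) (a 0) F
    have e2 := MvPolynomial.eval_eq_eval_mv_eval' (fun i : Fin d => a i.succ) (a 0) H
    rw [← ha] at e1 e2
    rw [e1, e2, hdec]
    simp
  · intro K h1 h2 α
    rw [← Finsupp.cons_tail α]
    obtain ⟨i, hi⟩ : ∃ i, i = α 0 := ⟨_, rfl⟩
    rw [← hi]
    cases i with
    | zero => rw [← hGc]; exact h2 _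
    | succ i => rw [← key, ← hHc]; exact h1 _

lemma qr_of_zero {d : ℕ} {a : Fin d → R} {n : ℕ}
    (h : ∀ F : MvPolynomial (Fin d) R, F.IsHomogeneous n → F.eval a = 0 → CIn (JJ a) F)
    {f : MvPolynomial (Fin d) R} (hf : f.IsHomogeneous n) (he : f.eval a ∈ JJ a ^ (n + 1)) :
    CIn (JJ a) f := by
  rw [pow_succ'] at he
  obtain ⟨p, hp, hc, hpe⟩ := mem_mul_pow a he
  have := (h (f - p) (hf.sub hp) (by rw [map_sub, hpe, sub_self])).add hc
  simpa using this

lemma RevReg.zero : ∀ {d : ℕ} {a : Fin d → R} (_ : RevReg d a) (n : ℕ)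
    (F : MvPolynomial (Fin d) R) (_ : F.IsHomogeneous n) (_ : F.eval a = 0), CIn (JJ a) F := by
  intro d
  induction d with
  | zero =>
    intro a _ n F _ h0
    rw [MvPolynomial.eq_C_of_isEmpty F] at h0 ⊢
    simp only [MvPolynomial.eval_C] at h0
    rw [h0]
    intro α
    simp
  | succ d ih =>
    intro a ⟨ha0, ha⟩ n
    obtain ⟨b, hb⟩ : ∃ b : Fin d → R, b = fun i => a i.succ := ⟨_, rfl⟩
    rw [← hb] at ha0 ha
    have hba : JJ b ≤ JJ a := by
      refine Ideal.span_mono ?_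
      rintro _ ⟨i, rfl⟩
      exact ⟨i.succ, by rw [hb]⟩
    have ha0m : a 0 ∈ JJ a := Ideal.subset_span ⟨0, rfl⟩
    have nzd : ∀ k y, a 0 * y ∈ JJ b ^ k → y ∈ JJ b ^ k := by
      intro k
      induction k with
      | zero => intro y _; simp
      | succ k ihk =>
        intro y hy
        obtain ⟨g, hg, rfl⟩ := (mem_JJ_pow b).1 (ihk y (Ideal.pow_le_pow_right (by omega) hy))
        have h1 : CIn (JJ b) (MvPolynomial.C (a 0) * g) := by
          refine qr_of_zero (n := k) (ih ha k) ?_ (by simpa using hy)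
          simpa using (MvPolynomial.isHomogeneous_C (Fin d) (a 0)).mul hg
        have h2 : CIn (JJ b) g := by
          intro α
          have := h1 α
          rw [MvPolynomial.coeff_C_mul] at this
          exact ha0 _ this
        have := eval_mem_mul b hg h2
        rwa [← pow_succ'] at this
    induction n with
    | zero =>
      intro F hF h0
      have h1 := (MvPolynomial.totalDegree_zero_iff_isHomogeneous _).2 hF
      rw [MvPolynomial.totalDegree_eq_zero_iff_eq_C] at h1
      rw [h1] at h0 ⊢
      simp only [MvPolynomial.eval_C] at h0
      rw [h0]
      intro α
      simp
    | succ n ihn =>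
      intro F hF h0
      obtain ⟨H, G, hH, hG, hev, hK⟩ := hom_split hF
      rw [hev a, ← hb] at h0
      have h1 : H.eval a ∈ JJ b ^ (n + 1) := by
        apply nzd
        rw [eq_neg_of_add_eq_zero_left h0]
        exact neg_mem (eval_mem_pow b hG)
      have h2 : CIn (JJ a) H := qr_of_zero ihn hH (Ideal.pow_right_mono hba _ h1)
      obtain ⟨h, hh, hhe⟩ := (mem_JJ_pow b).1 h1
      have h3 : CIn (JJ b) (G + MvPolynomial.C (a 0) * h) := by
        refine ih ha (n + 1) _ (hG.add ?_) ?_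
        · simpa using (MvPolynomial.isHomogeneous_C (Fin d) (a 0)).mul hh
        · rw [map_add, map_mul, MvPolynomial.eval_C, hhe, add_comm]; exact h0
      refine hK _ h2 fun α => ?_
      have h4 := hba (h3 α)
      rw [MvPolynomial.coeff_add, MvPolynomial.coeff_C_mul] at h4
      exact (Ideal.add_mem_iff_left _ (Ideal.mul_mem_right _ _ ha0m)).1 h4

lemma RevReg.of_reverse : ∀ {d : ℕ} {a : Fin d → R}
    (_ : RingTheory.Sequence.IsWeaklyRegular R (List.ofFn a).reverse), RevReg d a := by
  intro d
  induction d with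
  | zero => intro a _; trivial
  | succ d ih =>
    intro a h
    rw [List.ofFn_succ, List.reverse_cons, RingTheory.Sequence.isWeaklyRegular_append_iff] at h
    refine ⟨fun y hy => ?_, ih h.1⟩
    have h2 := (RingTheory.Sequence.isWeaklyRegular_singleton_iff _ _).1 h.2
    have hs : Ideal.ofList (List.ofFn fun i : Fin d => a i.succ).reverse • (⊤ : Submodule R R) =
        JJ (fun i : Fin d => a i.succ) := by
      rw [smul_eq_mul, Ideal.mul_top]
      unfold Ideal.ofList JJ
      congr 1
      ext z; simp [List.mem_ofFn]
    have := mem_of_isSMulRegular_quotient_of_smul_mem h2 (x := y) (by rw [hs]; exact hy)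
    rwa [hs] at this

lemma QRS_of_regular {R : Type*} [CommRing R] [IsLocalRing R] [IsNoetherianRing R] {d : ℕ}
    {a : Fin d → R} (h : RingTheory.Sequence.IsRegular R (List.ofFn a))
    (ha : JJ a ≤ maximalIdeal R) (hc : ∃ c, maximalIdeal R ^ c ≤ JJ a) : QRS a (maximalIdeal R) where
  prime := inferInstance
  le := ha
  pow_le := hc
  sat := fun s b hs hsb => by
    have hu : IsUnit s := by
      by_contra hn
      exact hs ((mem_maximalIdeal s).2 hn)
    exact (Ideal.unit_mul_mem_iff_mem _ hu).1 hsb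
  qr := fun n f hf he => qr_of_zero (RevReg.zero (RevReg.of_reverse
    (IsLocalRing.isRegular_of_perm h (List.reverse_perm _).symm).toIsWeaklyRegular) n) hf he

end
end Sally

namespace Sally
set_option linter.unusedSectionVars false
section
variable {R : Type*} [CommRing R]

lemma qlen_le' {ι : Type*} [Fintype ι] {A B Q K : Ideal R} (z : ι → R)
    (h : ∀ y ∈ A, ∃ r : ι → R, (∀ i, r i ∈ Q) ∧ y - ∑ i, r i * z i ∈ B)
    (hK : ∀ i, ∀ r ∈ K, r * z i ∈ B) :
    qlen A B ≤ (Fintype.card ι : ℕ∞) * qlen Q K := by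
  classical
  obtain ⟨f, hf⟩ : ∃ f : (A ⧸ (Submodule.comap A.subtype B)) →ₗ[R] (R ⧸ B),
    f = Submodule.mapQ _ _ A.subtype le_rfl := ⟨_, rfl⟩
  have hfi : Function.Injective f := by
    rw [← LinearMap.ker_eq_bot, hf, Submodule.ker_mapQ, Submodule.mkQ_map_self]
  obtain ⟨g, hg⟩ : ∃ g : ι → (Q ⧸ (Submodule.comap Q.subtype K)) →ₗ[R] (R ⧸ B),
      ∀ i (r : Q), g i (Submodule.Quotient.mk r) = Submodule.Quotient.mk ((r : R) * z i) :=
    ⟨fun i => Submodule.mapQ _ _ ((LinearMap.mulRight R (z i)).comp Q.subtype)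
      (fun r hr => hK i _ hr), fun i r => rfl⟩
  obtain ⟨Φ, hΦ⟩ : ∃ Φ : (ι → (Q ⧸ (Submodule.comap Q.subtype K))) →ₗ[R] (R ⧸ B),
      ∀ x, Φ x = ∑ i, g i (x i) := ⟨∑ i, (g i).comp (LinearMap.proj i), fun x => by simp⟩
  have hr : LinearMap.range f ≤ LinearMap.range Φ := by
    rintro _ ⟨y, rfl⟩
    obtain ⟨⟨y, hy⟩, rfl⟩ := Submodule.Quotient.mk_surjective _ y
    obtain ⟨r, hrQ, hrB⟩ := h y hy
    refine ⟨fun i => Submodule.Quotient.mk ⟨r i, hrQ i⟩, ?_⟩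
    rw [hΦ, hf]
    simp only [hg]
    have : (Submodule.Quotient.mk (∑ i, r i * z i) : R ⧸ B) = Submodule.Quotient.mk y := by
      rw [eq_comm, Submodule.Quotient.eq]; exact hrB
    rw [← Submodule.mkQ_apply, map_sum] at this
    exact this
  have e1 : qlen A B = Module.length R (LinearMap.range f) := (LinearEquiv.ofInjective f hfi).length_eq
  have e2 : Module.length R (LinearMap.range f) ≤ Module.length R (LinearMap.range Φ) :=
    Module.length_le_of_injective (Submodule.inclusion hr) (Submodule.inclusion_injective hr)
  have e3 : Module.length R (LinearMap.range Φ) ≤ Module.length R (ι → (Q ⧸ (Submodule.comap Q.subtype K))) :=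
    Module.length_le_of_surjective Φ.rangeRestrict Φ.surjective_rangeRestrict
  have e4 : Module.length R (ι → (Q ⧸ (Submodule.comap Q.subtype K))) = (Fintype.card ι : ℕ∞) * qlen Q K := by
    rw [Module.length_pi_of_fintype]; simp
  rw [e1, ← e4]
  exact e2.trans e3

lemma integral_pow_mem {I : Ideal R} {x : R} (h : IsIntegralOverIdeal I x) :
    ∃ r, ∀ s, x ^ s ∈ I ^ (s - r) := by
  obtain ⟨r, hr, a, ha, he⟩ := h
  refine ⟨r, fun s => ?_⟩
  induction s using Nat.strong_induction_on with
  | _ s ih =>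
    by_cases hs : s ≤ r
    · rw [Nat.sub_eq_zero_of_le hs]; simp
    push Not at hs
    have h1 : x ^ s = - ∑ i ∈ Finset.Icc 1 r, a i * x ^ (s - i) := by
      have h2 : x ^ s = x ^ (s - r) * x ^ r := by rw [← pow_add]; congr 1; omega
      rw [h2, eq_neg_of_add_eq_zero_left he, mul_neg, Finset.mul_sum]
      congr 1
      refine Finset.sum_congr rfl fun i hi => ?_
      rw [Finset.mem_Icc] at hi
      rw [mul_left_comm, ← pow_add]
      congr 2; omega
    rw [h1]
    refine neg_mem (Ideal.sum_mem _ fun i hi => ?_)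
    have hi' := Finset.mem_Icc.1 hi
    have h3 := Ideal.mul_mem_mul (ha i hi) (ih (s - i) (by omega))
    rw [← pow_add] at h3
    exact Ideal.pow_le_pow_right (by omega) h3

lemma integral_mono {I K : Ideal R} (h : K ≤ I) {x : R} (hx : IsIntegralOverIdeal K x) :
    IsIntegralOverIdeal I x := by
  obtain ⟨r, hr, a, ha, he⟩ := hx
  exact ⟨r, hr, a, fun i hi => Ideal.pow_right_mono h i (ha i hi), he⟩

lemma le_intCl (I : Ideal R) : I ≤ intCl I := by
  intro x hx
  refine Ideal.subset_span ⟨1, one_pos, fun _ => -x, ?_, ?_⟩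
  · intro i hi
    have : i = 1 := by simpa using hi
    subst this
    simpa using hx
  · simp

lemma red_pow {I J : Ideal R} {N : ℕ} (hN : ∀ n ≥ N, I ^ (n + 1) = J * I ^ n) (j : ℕ) :
    I ^ j ≤ J ^ (j - N) := by
  induction j with
  | zero => simp
  | succ j ih =>
    by_cases h : N ≤ j
    · rw [hN j h, show j + 1 - N = (j - N) + 1 by omega, pow_succ']
      exact Ideal.mul_mono_right ih
    · rw [Nat.sub_eq_zero_of_le (by omega)]; simp

lemma intCl_le_V {I J : Ideal R} {N : ℕ} (hN : ∀ n ≥ N, I ^ (n + 1) = J * I ^ n) (n : ℕ) :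
    intCl (I ^ n) ≤ V J n := by
  refine Ideal.span_le.2 fun x hx => ?_
  obtain ⟨r, hr⟩ := integral_pow_mem hx
  refine mem_V_of J (c := n * r + N) fun s _ => ?_
  have := hr s
  rw [← pow_mul] at this
  have h2 := red_pow hN _ this
  rwa [Nat.mul_sub, Nat.sub_sub] at h2

lemma intCl_le_radical {I J : Ideal R} {N : ℕ} (hN : ∀ n ≥ N, I ^ (n + 1) = J * I ^ n) :
    intCl I ≤ J.radical := by
  refine Ideal.span_le.2 fun x hx => ?_
  obtain ⟨r, hr⟩ := integral_pow_mem hx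
  refine ⟨N + 1 + r, ?_⟩
  have h := red_pow hN _ (hr (N + 1 + r))
  simpa using h

lemma V_inf_pow {d : ℕ} {a : Fin d → R} {m : Ideal R} (H : QRS a m) (h1 : nrm (JJ a) 1 = 1) (n : ℕ) :
    V (JJ a) (n + 1) ⊓ JJ a ^ n ≤ m * JJ a ^ n := by
  rintro y ⟨hy, hyn⟩
  obtain ⟨f, hf, rfl⟩ := (mem_JJ_pow a).1 hyn
  by_cases hm : CIn m f
  · exact eval_mem_mul a hf hm
  · exfalso
    have h2 := H.nrm_form hf hm 1
    rw [mul_one, h1, mul_one] at h2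
    have h3 : nrm (JJ a) (f.eval a) ≤ (1/2 : ℝ) ^ (n + 1) := hy
    rw [h2, pow_succ] at h3
    have : (0:ℝ) < (1/2) ^ n := by positivity
    linarith

end
end Sally

namespace Sally
set_option linter.unusedSectionVars false
section
variable {R : Type*} [CommRing R]

lemma span_ofFn {d : ℕ} (a : Fin d → R) : Ideal.span {x | x ∈ List.ofFn a} = JJ a := by
  unfold JJ; congr 1; ext z; simp [List.mem_ofFn]

lemma nrm_one_of {J : Ideal R} {n : ℕ} (h : V J n ≠ ⊤) : nrm J 1 = 1 := by
  refine le_antisymm (nrm_le_one J 1) ?_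
  by_contra hlt
  push Not at hlt
  apply h
  rw [Ideal.eq_top_iff_one, mem_V]
  have h1 := nrm_mul J 1 1
  rw [mul_one] at h1
  have h2 := nrm_nonneg J 1
  have h3 : nrm J 1 = 0 := by nlinarith
  rw [h3]; positivity

theorem final_bound [IsLocalRing R] [IsNoetherianRing R] {d : ℕ} {a : Fin d → R}
    (H : QRS a (maximalIdeal R)) (h1 : nrm (JJ a) 1 = 1)
    (hV : ∀ n, V (JJ a) (n + 2) ≤ JJ a ^ n) (hm : maximalIdeal R = V (JJ a) 1) (n : ℕ) :
    qlen (V (JJ a) (n + 2)) (JJ a ^ (n + 1) * maximalIdeal R) ≤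
      (d.multichoose n : ℕ∞) * qlen ((JJ a).colon (maximalIdeal R)) (JJ a) := by
  have e : Submodule.comap (V (JJ a) (n + 2)).subtype (JJ a ^ (n + 1) * maximalIdeal R) =
      Submodule.comap (V (JJ a) (n + 2)).subtype (JJ a ^ (n + 1)) := by
    ext ⟨y, hy⟩
    constructor
    · intro h
      exact Ideal.mul_le_left (I := JJ a ^ (n + 1)) (J := maximalIdeal R) h
    · intro h
      have := V_inf_pow H h1 (n + 1) ⟨hy, h⟩
      rw [mul_comm] at this
      exact this
  rw [qlen, e, ← card_Mon]
  refine qlen_le' (mon a) ?_ ?_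
  · intro y hy
    obtain ⟨f, hf, hfe⟩ := (mem_JJ_pow a).1 (hV n hy)
    refine ⟨fun s => f.coeff s.exp, fun s => ?_, ?_⟩
    · rw [Submodule.mem_colon]
      intro c hc
      have hc' : c ∈ maximalIdeal R := hc
      have h2 : c * y ∈ JJ a ^ (n + 1) := by
        apply hV
        have : c * y ∈ V (JJ a) 1 * V (JJ a) (n + 2) := Ideal.mul_mem_mul (hm ▸ hc') hy
        have := V_mul (JJ a) this
        rwa [show 1 + (n + 2) = n + 1 + 2 by omega] at this
      have h3 := H.qr n (MvPolynomial.C c * f)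
        (by simpa using (MvPolynomial.isHomogeneous_C (Fin d) c).mul hf) (by simpa [hfe] using h2) s.exp
      rw [MvPolynomial.coeff_C_mul, mul_comm] at h3
      exact h3
    · rw [← eval_ofCoeff, ← eq_ofCoeff hf, hfe, sub_self]
      exact Ideal.zero_mem _
  · intro s r hr
    have := Ideal.mul_mem_mul hr (mon_mem a s)
    rwa [← pow_succ'] at this

end
end Sally

theorem length_sally_components_le_type
    (R : Type*) [CommRing R] [IsLocalRing R] [IsNoetherianRing R]
    (d : ℕ) (hd : 3 ≤ d) (hdim : ringKrullDim R = d)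
    (hCM : IsCMLocal R) (hAU : AnalyticallyUnramified R)
    (hres : Infinite (ResidueField R))
    (t : ℕ) (ht : CMTypeData R d t)
    (I J : Ideal R) (hIm : intCl I = maximalIdeal R)
    (hJ : IsMinimalReduction d J I)
    (L : ℕ → ℕ) (e : ℕ → ℤ) (hHilb : NormalHilbertData d I L e)
    (he3 : e 3 = 0) :
    ∀ n, 1 ≤ n →
      mlen R (idealQuot (intCl (I ^ (n + 1))) (J ^ n * intCl I)) ≤
        ((t * (n + d - 2).choose (d - 1) : ℕ) : WithBot ℕ∞) := by
  obtain ⟨hJI, ⟨a, ha⟩, N, hN⟩ := hJ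
  obtain ⟨k, rfl⟩ : ∃ k, d = k + 3 := ⟨d - 3, by omega⟩
  have haJ : J = Sally.JJ a := ha
  subst haJ
  have hJm : Sally.JJ a ≤ maximalIdeal R := by
    rw [← hIm]; exact hJI.trans (Sally.le_intCl I)
  have hc : ∃ c, maximalIdeal R ^ c ≤ Sally.JJ a := by
    refine Ideal.exists_pow_le_of_le_radical_of_fg ?_ (IsNoetherian.noetherian _)
    rw [← hIm]; exact Sally.intCl_le_radical hN
  have hreg := Sally.sop_regular' hdim hCM a hJm hc
  have H := Sally.QRS_of_regular hreg hJm hc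
  have hcl : ∀ n, intCl (I ^ n) = Sally.V (Sally.JJ a) n := by
    intro n
    refine le_antisymm (Sally.intCl_le_V hN n) fun x hx => Ideal.subset_span ?_
    exact Sally.integral_mono (Ideal.pow_right_mono hJI n) (Sally.integral_of_mem_V (by omega) H hx)
  obtain ⟨e₀, he⟩ : ∃ e₀ : ℕ, Sally.ell (Sally.JJ a) = e₀ := by
    obtain ⟨c, hc⟩ := hc
    have := Sally.ell_lt_top_of_pow_le hc
    obtain ⟨e₀, h⟩ := ENat.ne_top_iff_exists.1 this
    exact ⟨e₀, h.symm⟩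
  obtain ⟨c, hcV⟩ := Sally.P5c hAU (by omega) H he
  obtain ⟨hL, n₁, hp⟩ := hHilb
  have hL' : ∀ n ≥ n₁, Sally.ell (Sally.V (Sally.JJ a) (n + 1)) = L n := by
    intro n _
    have := hL n
    rw [hcl, mlen, ← Module.coe_length] at this
    exact_mod_cast this
  have he0 := Sally.lead H (by omega) he hcV hL' hp
  have hV := Sally.P8 k R a H e₀ he e he0 he3 L n₁ hL' hp c hcV
  have hne : Sally.V (Sally.JJ a) (1 + c) ≠ ⊤ := by
    intro h
    have h2 := hcV 1
    rw [h, pow_one] at h2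
    exact (maximalIdeal.isMaximal R).ne_top (top_le_iff.1 (h2.trans hJm))
  have hone := Sally.nrm_one_of hne
  have hm : maximalIdeal R = Sally.V (Sally.JJ a) 1 := by
    rw [← hIm, ← hcl 1, pow_one]
  intro n hn
  obtain ⟨n, rfl⟩ : ∃ n', n = n' + 1 := ⟨n - 1, by omega⟩
  have hfin := Sally.final_bound H hone hV hm n
  have hs : Ideal.span {x | x ∈ List.ofFn a} = Sally.JJ a := Sally.span_ofFn a
  have htt := ht (List.ofFn a) (by simp)
    (fun x hx => hJm (by rw [← hs]; exact Ideal.subset_span hx)) hreg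
  rw [hs, mlen, ← Module.coe_length] at htt
  have htt' : Sally.qlen ((Sally.JJ a).colon (maximalIdeal R)) (Sally.JJ a) = t := by exact_mod_cast htt
  rw [htt'] at hfin
  have hb : (k + 3).multichoose n = (n + 1 + (k + 3) - 2).choose (k + 3 - 1) := by
    rw [Nat.multichoose_eq]
    rw [show n + 1 + (k + 3) - 2 = k + 3 + n - 1 by omega]
    refine Nat.choose_symm_of_eq_add ?_
    omega
  rw [hcl, hIm, mlen, ← Module.coe_length, ← hb]
  have hfin2 : Sally.qlen (Sally.V (Sally.JJ a) (n + 2)) (Sally.JJ a ^ (n + 1) * maximalIdeal R) ≤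
      ((t * (k + 3).multichoose n : ℕ) : ℕ∞) := by
    refine hfin.trans (le_of_eq ?_)
    push_cast
    ring
  exact_mod_cast hfin2
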